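/- arXiv:0910.1880 — 5 statements merged into one kernel-verified Lean document; each statement's English description precedes it below -/
import Mathlib

section
/- For every δ > 0 there exists N₀ = N₀(δ) such that for every integer N > N₀, every subset A of {1, …, N} with |A| ≥ δN contains two distinct elements a, a' ∈ A such that a − a' is a perfect square (i.e., a − a' = n² for some positive integer n). -/
open Filter Topology Finset
open scoped BoundedContinuousFunction

section Hilbert

variable {H : Type*} [NormedAddCommGroup H] [InnerProductSpace ℝ H]

/-- A van der Corput type inequality: a sequence whose correlations are asymptotically small cannot
have inner products with a fixed vector that stay bounded away from zero. -/
theorem sq_le_of_inner_le_of_tendsto_correlation {u : ℕ → H} {f : H} {c η : ℝ} {L : ℕ → ℕ → ℝ}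
    (hc : 0 ≤ c) (hf : ‖f‖ ≤ 1) (huf : ∀ n, inner ℝ (u n) f ≤ -c)
    (hL : ∀ d d', Tendsto (fun N : ℕ ↦ (N : ℝ)⁻¹ * ∑ n ∈ range N, inner ℝ (u (n + d)) (u (n + d')))
      atTop (𝓝 (L d d')))
    (hdiag : ∀ d, L d d ≤ 1) (hoff : ∀ d d', d ≠ d' → L d d' ≤ η) (hη : 0 ≤ η) :
    c ^ 2 ≤ η := by
  have hpoint (D n : ℕ) :
      (D * c) ^ 2 ≤ ∑ d ∈ range D, ∑ d' ∈ range D, inner ℝ (u (n + d)) (u (n + d')) := by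
    set y := ∑ d ∈ range D, u (n + d) with hy
    have hyy : ∑ d ∈ range D, ∑ d' ∈ range D, inner ℝ (u (n + d)) (u (n + d')) = ‖y‖ ^ 2 := by
      rw [← real_inner_self_eq_norm_sq, hy, sum_inner]
      simp_rw [inner_sum]
    have hyf : inner ℝ y f ≤ -(D * c) := by
      rw [hy, sum_inner]
      calc _ ≤ ∑ _d ∈ range D, -c := sum_le_sum fun d _ ↦ huf _
        _ = _ := by simp
    rw [hyy]
    have h1 : D * c ≤ ‖y‖ * ‖f‖ := by
      have := neg_le_of_abs_le (abs_real_inner_le_norm y f)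
      linarith
    have h2 : ‖y‖ * ‖f‖ ≤ ‖y‖ := mul_le_of_le_one_right (norm_nonneg _) hf
    exact pow_le_pow_left₀ (by positivity) (h1.trans h2) 2
  have hsum (D : ℕ) : (D * c) ^ 2 ≤ ∑ d ∈ range D, ∑ d' ∈ range D, L d d' := by
    refine ge_of_tendsto (tendsto_finsetSum (range D) fun d _ ↦
      tendsto_finsetSum (range D) fun d' _ ↦ hL d d') ?_
    filter_upwards [eventually_gt_atTop 0] with N hN
    have hN' : (0 : ℝ) < N := by exact_mod_cast hN
    simp_rw [← mul_sum]
    rw [show ∑ d ∈ range D, ∑ d' ∈ range D, ∑ n ∈ range N, inner ℝ (u (n + d)) (u (n + d'))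
      = ∑ n ∈ range N, ∑ d ∈ range D, ∑ d' ∈ range D, inner ℝ (u (n + d)) (u (n + d')) by
        rw [sum_comm (s := range N)]
        exact sum_congr rfl fun d _ ↦ sum_comm]
    rw [le_inv_mul_iff₀ hN']
    calc (N : ℝ) * (D * c) ^ 2 = ∑ _n ∈ range N, (D * c) ^ 2 := by simp
      _ ≤ _ := sum_le_sum fun n _ ↦ hpoint D n
  have hbound (D : ℕ) : (D * c) ^ 2 ≤ D * (1 + D * η) := by
    refine (hsum D).trans ?_
    calc ∑ d ∈ range D, ∑ d' ∈ range D, L d d'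
        ≤ ∑ d ∈ range D, ∑ d' ∈ range D, ((if d = d' then 1 else 0) + η) := by
          gcongr with d _ d' _
          split_ifs with h
          · subst h; linarith [hdiag d]
          · linarith [hoff d d' h]
      _ = ∑ d ∈ range D, (1 + D * η) := by
          refine sum_congr rfl fun d hd ↦ ?_
          simp [sum_add_distrib, mem_range.1 hd]
      _ = _ := by rw [sum_const, card_range, nsmul_eq_mul]
  have hlim : Tendsto (fun D : ℕ ↦ (D : ℝ)⁻¹ + η) atTop (𝓝 (0 + η)) :=
    tendsto_inv_atTop_nhds_zero_nat.add_const η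
  rw [zero_add] at hlim
  refine ge_of_tendsto hlim ?_
  filter_upwards [eventually_gt_atTop 0] with D hD
  have hD' : (0 : ℝ) < D := by exact_mod_cast hD
  have h := hbound D
  have : D * (D * c ^ 2) ≤ D * (1 + D * η) := by linarith
  have := le_of_mul_le_mul_left this hD'
  have : D * c ^ 2 ≤ D * ((D : ℝ)⁻¹ + η) := by
    rwa [mul_add, mul_inv_cancel₀ hD'.ne']
  exact le_of_mul_le_mul_left this hD'

variable {U : H →L[ℝ] H}

theorem inner_pow_apply (hU : ∀ x y, inner ℝ (U x) (U y) = inner ℝ x y) (n : ℕ) (x y : H) :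
    inner ℝ ((U ^ n) x) ((U ^ n) y) = inner ℝ x y := by
  induction n with
  | zero => simp
  | succ n ih => rw [pow_succ', mul_apply_eq_comp, mul_apply_eq_comp, hU, ih]

theorem norm_pow_apply (hU : ∀ x y, inner ℝ (U x) (U y) = inner ℝ x y) (n : ℕ) (x : H) :
    ‖(U ^ n) x‖ = ‖x‖ := by
  rw [norm_eq_sqrt_real_inner, inner_pow_apply hU, ← norm_eq_sqrt_real_inner]

variable [CompleteSpace H]

/-- The orthogonal projection onto the vectors fixed by `U ^ n`. -/
noncomputable def fixedProj (U : H →L[ℝ] H) (n : ℕ) : H →L[ℝ] H :=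
  ((U ^ n).eqLocus (1 : H →L[ℝ] H)).starProjection

theorem pow_apply_fixedProj {s t : ℕ} (h : s ∣ t) (x : H) :
    (U ^ t) (fixedProj U s x) = fixedProj U s x := by
  obtain ⟨k, rfl⟩ := h
  have hx : (U ^ s) (fixedProj U s x) = fixedProj U s x :=
    ((U ^ s).eqLocus (1 : H →L[ℝ] H)).starProjection_apply_mem x
  rw [pow_mul]
  induction k with
  | zero => simp
  | succ k ih => rw [pow_succ, mul_apply_eq_comp, hx, ih]

theorem fixedProj_eq_self {n : ℕ} {x : H} (hx : (U ^ n) x = x) : fixedProj U n x = x :=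
  Submodule.starProjection_eq_self_iff.2 hx

theorem norm_fixedProj_apply_le (n : ℕ) (x : H) : ‖fixedProj U n x‖ ≤ ‖x‖ :=
  Submodule.norm_starProjection_apply_le _ x

theorem inner_fixedProj_left (n : ℕ) (x y : H) :
    inner ℝ (fixedProj U n x) y = inner ℝ x (fixedProj U n y) :=
  Submodule.inner_starProjection_left_eq_right _ x y

theorem inner_fixedProj_self (n : ℕ) (x : H) :
    inner ℝ (fixedProj U n x) x = ‖fixedProj U n x‖ ^ 2 := by
  conv_lhs => rw [← fixedProj_eq_self (pow_apply_fixedProj dvd_rfl x), inner_fixedProj_left]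
  exact real_inner_self_eq_norm_sq _

theorem norm_sub_fixedProj_le (n : ℕ) (x : H) : ‖x - fixedProj U n x‖ ≤ ‖x‖ := by
  refine le_of_sq_le_sq ?_ (norm_nonneg _)
  rw [norm_sub_sq_real, real_inner_comm, inner_fixedProj_self]
  nlinarith [sq_nonneg ‖fixedProj U n x‖]

theorem norm_sq_fixedProj_sub_fixedProj {s t : ℕ} (h : s ∣ t) (x : H) :
    ‖fixedProj U t (x - fixedProj U s x)‖ ^ 2 = ‖fixedProj U t x‖ ^ 2 - ‖fixedProj U s x‖ ^ 2 := by
  have hts : fixedProj U t (fixedProj U s x) = fixedProj U s x :=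
    fixedProj_eq_self (pow_apply_fixedProj h x)
  rw [map_sub, hts, norm_sub_sq_real, inner_fixedProj_left, hts, real_inner_comm,
    inner_fixedProj_self]
  ring

theorem tendsto_average_inner_pow (hU : ∀ x y, inner ℝ (U x) (U y) = inner ℝ x y) (s c : ℕ)
    (x y : H) :
    Tendsto (fun N : ℕ ↦ (N : ℝ)⁻¹ * ∑ n ∈ range N, inner ℝ x ((U ^ (c + s * n)) y))
      atTop (𝓝 (inner ℝ x ((U ^ c) (fixedProj U s y)))) := by
  have hnorm : ‖U ^ s‖ ≤ 1 :=
    ContinuousLinearMap.opNorm_le_bound _ zero_le_one fun x ↦ by rw [norm_pow_apply hU, one_mul]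
  have h := (U ^ s).tendsto_birkhoffAverage_orthogonalProjection hnorm y
  have h' := ((innerSL ℝ x).comp (U ^ c)).continuous.continuousAt.tendsto.comp h
  refine h'.congr fun N ↦ ?_
  simp only [Function.comp_apply, birkhoffAverage, birkhoffSum, map_smul, map_sum, smul_eq_mul,
    ContinuousLinearMap.comp_apply, innerSL_apply_apply, id]
  congr 1
  refine sum_congr rfl fun n _ ↦ ?_
  rw [pow_add, pow_mul, mul_apply_eq_comp, FunLike.coe_pow_eq_iterate (U ^ s)]

/-- **Recurrence along squares** for an isometry of a Hilbert space. -/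
theorem exists_inner_pow_sq_ne_zero (hU : ∀ x y, inner ℝ (U x) (U y) = inner ℝ x y) {e f : H}
    (he : U e = e) (he' : ‖e‖ ≤ 1) (hf : ‖f‖ ≤ 1) (hef : 0 < inner ℝ f e) :
    ∃ n : ℕ, 0 < n ∧ inner ℝ ((U ^ n ^ 2) f) f ≠ 0 := by
  by_contra! hzero
  set δ : ℝ := inner ℝ f e
  obtain ⟨p, hp⟩ : ∃ p : ℕ, ∀ t : ℕ,
      ‖fixedProj U (t + 1) f‖ ^ 2 ≤ ‖fixedProj U (p + 1) f‖ ^ 2 + (δ ^ 4 / 2) ^ 2 := by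
    have hbdd : BddAbove (Set.range fun t : ℕ ↦ ‖fixedProj U (t + 1) f‖ ^ 2) :=
      ⟨‖f‖ ^ 2, Set.forall_mem_range.2 fun t ↦
        pow_le_pow_left₀ (norm_nonneg _) (norm_fixedProj_apply_le _ _) 2⟩
    obtain ⟨p, hp⟩ := exists_lt_of_lt_ciSup
      (sub_lt_self (⨆ t : ℕ, ‖fixedProj U (t + 1) f‖ ^ 2) (by positivity : 0 < (δ ^ 4 / 2) ^ 2))
    exact ⟨p, fun t ↦ by linarith [le_ciSup hbdd t]⟩
  set q := p + 1
  set h := f - fixedProj U q f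
  have hh : ‖h‖ ≤ 1 := (norm_sub_fixedProj_le q f).trans hf
  have hsmall {t : ℕ} (ht : 0 < t) (hqt : q ∣ t) : ‖fixedProj U t h‖ ≤ δ ^ 4 / 2 := by
    refine le_of_sq_le_sq ?_ (by positivity)
    rw [norm_sq_fixedProj_sub_fixedProj hqt]
    have := hp (t - 1)
    rw [Nat.sub_add_cancel ht] at this
    linarith
  have hlower : δ ≤ ‖fixedProj U q f‖ := by
    have hqe : (U ^ q) e = e := by
      rw [FunLike.coe_pow_eq_iterate]; exact Function.iterate_fixed he q
    calc δ = inner ℝ (fixedProj U q f) e := by rw [inner_fixedProj_left, fixedProj_eq_self hqe]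
      _ ≤ ‖fixedProj U q f‖ * ‖e‖ := real_inner_le_norm _ _
      _ ≤ _ := mul_le_of_le_one_right (norm_nonneg _) he'
  let u (n : ℕ) : H := (U ^ (q * (n + 1)) ^ 2) h
  let L (d d' : ℕ) : ℝ := inner ℝ h
    ((U ^ (q ^ 2 * (2 * (d + 1) * (d' - d) + (d' - d) ^ 2)))
      (fixedProj U (2 * q ^ 2 * (d' - d)) h))
  have hLtendsto (d k : ℕ) : Tendsto (fun N : ℕ ↦ (N : ℝ)⁻¹ *
      ∑ n ∈ range N, inner ℝ (u (n + d)) (u (n + (d + k)))) atTop (𝓝 (L d (d + k))) := by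
    refine (tendsto_average_inner_pow hU (2 * q ^ 2 * (d + k - d))
      (q ^ 2 * (2 * (d + 1) * (d + k - d) + (d + k - d) ^ 2)) h h).congr fun N ↦ ?_
    congr 1
    refine sum_congr rfl fun n _ ↦ ?_
    simp only [u, Nat.add_sub_cancel_left]
    rw [← inner_pow_apply hU ((q * (n + d + 1)) ^ 2), ← mul_apply_eq_comp (U ^ _),
      ← pow_add]
    congr 3
    ring
  have hLle (d k : ℕ) : L d (d + k) ≤ ‖fixedProj U (2 * q ^ 2 * k) h‖ := by
    refine (real_inner_le_norm _ _).trans ?_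
    rw [norm_pow_apply hU, Nat.add_sub_cancel_left]
    exact mul_le_of_le_one_left (norm_nonneg _) hh
  have hoff (d k : ℕ) (hk : 0 < k) : L d (d + k) ≤ δ ^ 4 / 2 :=
    (hLle d k).trans (hsmall (by positivity) ⟨2 * q * k, by ring⟩)
  have key : (‖fixedProj U q f‖ ^ 2) ^ 2 ≤ δ ^ 4 / 2 := by
    refine sq_le_of_inner_le_of_tendsto_correlation (u := u) (f := f)
      (L := fun d d' ↦ L (min d d') (max d d')) (by positivity) hf (fun n ↦ ?_) (fun d d' ↦ ?_)
      (fun d ↦ ?_) (fun d d' hd ↦ ?_) (by positivity)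
    · simp only [u, h, map_sub, inner_sub_left]
      rw [hzero _ (by positivity), pow_apply_fixedProj ⟨q * (n + 1) ^ 2, by ring⟩,
        inner_fixedProj_self]
      linarith
    · rcases le_total d d' with hd | hd
      · obtain ⟨k, rfl⟩ := Nat.exists_eq_add_of_le hd
        simpa using hLtendsto d k
      · obtain ⟨k, rfl⟩ := Nat.exists_eq_add_of_le hd
        simpa [real_inner_comm] using hLtendsto d' k
    · simpa using (hLle d 0).trans ((norm_fixedProj_apply_le _ _).trans hh)
    · rcases hd.lt_or_gt with hd | hd
      · obtain ⟨k, rfl⟩ := Nat.exists_eq_add_of_le hd.le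
        simpa using hoff d k (by omega)
      · obtain ⟨k, rfl⟩ := Nat.exists_eq_add_of_le hd.le
        simpa using hoff d' k (by omega)
  have : δ ^ 4 ≤ (‖fixedProj U q f‖ ^ 2) ^ 2 := by
    rw [← pow_mul]; exact pow_le_pow_left₀ hef.le hlower 4
  have : 0 < δ ^ 4 := by positivity
  linarith

end Hilbert

/-- Recurrence along squares for a linear map preserving a positive semidefinite form. -/
theorem LinearMap.exists_bilin_pow_sq_ne_zero {V : Type*} [AddCommGroup V] [Module ℝ V]
    (B : V →ₗ[ℝ] V →ₗ[ℝ] ℝ) (hsymm : ∀ x y, B x y = B y x) (hnonneg : ∀ x, 0 ≤ B x x)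
    (U : V →ₗ[ℝ] V) (hU : ∀ x y, B (U x) (U y) = B x y) {e f : V} (he : U e = e)
    (he' : B e e ≤ 1) (hf : B f f ≤ 1) (hef : 0 < B f e) :
    ∃ n : ℕ, 0 < n ∧ B ((U ^ n ^ 2) f) f ≠ 0 := by
  let core : PreInnerProductSpace.Core ℝ V :=
    { inner x y := B x y
      conj_inner_symm x y := hsymm y x
      re_inner_nonneg x := hnonneg x
      add_left x y z := by simp
      smul_left x y r := by simp }
  let : SeminormedAddCommGroup V :=
    InnerProductSpace.Core.toSeminormedAddCommGroup (𝕜 := ℝ) (c := core)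
  let : InnerProductSpace ℝ V := InnerProductSpace.ofCore core
  have hB (x y : V) : inner ℝ x y = B x y := rfl
  have hnorm (x : V) : ‖x‖ ≤ 1 ↔ B x x ≤ 1 := by
    rw [← hB, real_inner_self_eq_norm_sq, sq_le_one_iff₀ (norm_nonneg _)]
  let W : V →L[ℝ] V := LinearIsometry.toContinuousLinearMap
    ⟨U, fun x ↦ by simp only [norm_eq_sqrt_real_inner, hB, hU]⟩
  have hW (x : V) : W x = U x := rfl
  have hWpow (n : ℕ) (x : V) : (W.completion ^ n) x = ((U ^ n) x : V) := by
    induction n with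
    | zero => simp
    | succ n ih =>
      rw [pow_succ', mul_apply_eq_comp, ih, W.completion_apply_coe, pow_succ',
        Module.End.mul_apply, hW]
  obtain ⟨n, hn, h⟩ := exists_inner_pow_sq_ne_zero (U := W.completion) (e := (e : V)) (f := (f : V))
    (fun x y ↦ UniformSpace.Completion.induction_on₂ x y
      (isClosed_eq (by fun_prop) (by fun_prop)) fun a b ↦ by
        simp only [W.completion_apply_coe, UniformSpace.Completion.inner_coe, hB, hW, hU])
    (by rw [W.completion_apply_coe, hW, he])
    (by rwa [UniformSpace.Completion.norm_coe, hnorm])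
    (by rwa [UniformSpace.Completion.norm_coe, hnorm])
    (by rwa [UniformSpace.Completion.inner_coe, hB])
  refine ⟨n, hn, ?_⟩
  rwa [hWpow, UniformSpace.Completion.inner_coe, hB] at h

section Correspondence

/-- A limit of averages over the intervals `{1, …, N k}` along a nonprincipal ultrafilter. -/
theorem exists_linearMap_tendsto_average (N : ℕ → ℕ) :
    ∃ Λ : (ℕ × ℤ →ᵇ ℝ) →ₗ[ℝ] ℝ, ∀ F : ℕ × ℤ →ᵇ ℝ,
      Tendsto (fun k ↦ (N k : ℝ)⁻¹ * ∑ x ∈ Icc (1 : ℤ) (N k), F (k, x)) (hyperfilter ℕ)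
        (𝓝 (Λ F)) := by
  have hex (F : ℕ × ℤ →ᵇ ℝ) : ∃ l : ℝ,
      Tendsto (fun k ↦ (N k : ℝ)⁻¹ * ∑ x ∈ Icc (1 : ℤ) (N k), F (k, x)) (hyperfilter ℕ) (𝓝 l) := by
    have hmem (k : ℕ) : (N k : ℝ)⁻¹ * ∑ x ∈ Icc (1 : ℤ) (N k), F (k, x) ∈
        Metric.closedBall (0 : ℝ) ‖F‖ := by
      rw [mem_closedBall_zero_iff, norm_mul, norm_inv, Real.norm_natCast]
      refine inv_mul_le_of_le_mul₀ (Nat.cast_nonneg _) (norm_nonneg _) ?_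
      refine (norm_sum_le_of_le _ fun x _ ↦ F.norm_coe_le_norm (k, x)).trans ?_
      simp
    obtain ⟨l, -, hl⟩ := (isCompact_closedBall (0 : ℝ) ‖F‖).ultrafilter_le_nhds
      ((hyperfilter ℕ).map fun k ↦ (N k : ℝ)⁻¹ * ∑ x ∈ Icc (1 : ℤ) (N k), F (k, x))
      (le_principal_iff.2 (mem_map.2 (Eventually.of_forall hmem)))
    exact ⟨l, hl⟩
  choose Λ hΛ using hex
  refine ⟨⟨⟨Λ, fun F G ↦ ?_⟩, fun c F ↦ ?_⟩, hΛ⟩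
  · refine tendsto_nhds_unique (hΛ (F + G)) (((hΛ F).add (hΛ G)).congr fun k ↦ ?_)
    simp [sum_add_distrib, mul_add]
  · refine tendsto_nhds_unique (hΛ (c • F)) (((hΛ F).const_mul c).congr fun k ↦ ?_)
    simp [← mul_sum, mul_left_comm]

/-- The translation `(k, x) ↦ (k, x + 1)`, acting on bounded functions. -/
noncomputable def shift : (ℕ × ℤ →ᵇ ℝ) →ₗ[ℝ] (ℕ × ℤ →ᵇ ℝ) where
  toFun F := F.compContinuous ⟨fun p ↦ (p.1, p.2 + 1), continuous_of_discreteTopology⟩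
  map_add' _ _ := rfl
  map_smul' _ _ := rfl

theorem shift_apply (F : ℕ × ℤ →ᵇ ℝ) (k : ℕ) (x : ℤ) : shift F (k, x) = F (k, x + 1) := rfl

theorem shift_pow_apply (n : ℕ) (F : ℕ × ℤ →ᵇ ℝ) (k : ℕ) (x : ℤ) :
    (shift ^ n) F (k, x) = F (k, x + n) := by
  induction n generalizing x with
  | zero => simp
  | succ n ih =>
    rw [pow_succ', Module.End.mul_apply, shift_apply, ih]
    push_cast
    ring_nf

theorem sum_Icc_shift (g : ℤ → ℝ) (n : ℕ) :
    ∑ x ∈ Icc (1 : ℤ) n, g (x + 1) = ∑ x ∈ Icc (1 : ℤ) n, g x + (g (n + 1) - g 1) := by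
  induction n with
  | zero => simp
  | succ n ih =>
    have h : Icc (1 : ℤ) (n + 1 : ℕ) = insert ((n : ℤ) + 1) (Icc (1 : ℤ) n) := by
      ext x; simp only [mem_Icc, mem_insert]; omega
    rw [h, sum_insert (by simp), sum_insert (by simp), ih]
    push_cast
    ring

theorem map_shift_eq_of_tendsto_average {N : ℕ → ℕ} (hN : Tendsto N atTop atTop)
    {Λ : (ℕ × ℤ →ᵇ ℝ) →ₗ[ℝ] ℝ}
    (hΛ : ∀ F : ℕ × ℤ →ᵇ ℝ,
      Tendsto (fun k ↦ (N k : ℝ)⁻¹ * ∑ x ∈ Icc (1 : ℤ) (N k), F (k, x)) (hyperfilter ℕ)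
        (𝓝 (Λ F))) (F : ℕ × ℤ →ᵇ ℝ) :
    Λ (shift F) = Λ F := by
  have hinv : Tendsto (fun k ↦ (N k : ℝ)⁻¹) (hyperfilter ℕ) (𝓝 0) :=
    (tendsto_inv_atTop_nhds_zero_nat.comp hN).mono_left Nat.hyperfilter_le_atTop
  have hbdd : IsBoundedUnder (· ≤ ·) (hyperfilter ℕ : Filter ℕ)
      (norm ∘ fun k ↦ F (k, (N k : ℤ) + 1) - F (k, 1)) :=
    isBoundedUnder_of ⟨‖F‖ + ‖F‖, fun k ↦
      (norm_sub_le _ _).trans (add_le_add (F.norm_coe_le_norm _) (F.norm_coe_le_norm _))⟩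
  have herr := hinv.zero_mul_isBoundedUnder_le hbdd
  have h := (hΛ F).add herr
  rw [add_zero] at h
  refine tendsto_nhds_unique (hΛ (shift F)) (h.congr fun k ↦ ?_)
  simp only [shift_apply]
  rw [sum_Icc_shift (fun x ↦ F (k, x)), mul_add]

/-- The indicator function of a sequence of finite sets, as a bounded function. -/
noncomputable def indicatorSeq (A : ℕ → Finset ℕ) : ℕ × ℤ →ᵇ ℝ :=
  BoundedContinuousFunction.ofNormedAddCommGroupDiscrete
    (fun p ↦ if p.2 ∈ (A p.1).map Nat.castEmbedding then 1 else 0) 1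
    fun p ↦ by split_ifs <;> simp

theorem indicatorSeq_apply (A : ℕ → Finset ℕ) (k : ℕ) (x : ℤ) :
    indicatorSeq A (k, x) = if x ∈ (A k).map Nat.castEmbedding then 1 else 0 := rfl

theorem sum_indicatorSeq {A : ℕ → Finset ℕ} {k N : ℕ} (hA : A k ⊆ Icc 1 N) :
    ∑ x ∈ Icc (1 : ℤ) N, indicatorSeq A (k, x) = #(A k) := by
  simp only [indicatorSeq_apply]
  rw [sum_boole, filter_mem_eq_inter, inter_eq_right.2, card_map]
  intro x hx
  obtain ⟨a, ha, rfl⟩ := mem_map.1 hx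
  have := mem_Icc.1 (hA ha)
  simp only [Nat.castEmbedding_apply, mem_Icc]
  omega

end Correspondence

/-- **Sárközy's theorem (finitary form).** For every `δ > 0` there is `N₀(δ)` such that for
every `N > N₀`, any subset `A` of `{1, …, N}` of size at least `δN` contains two distinct
elements whose difference is a (positive) perfect square. -/
theorem sarkozy_finitary (δ : ℝ) (hδ : 0 < δ) :
    ∃ N₀ : ℕ, ∀ N : ℕ, N₀ < N → ∀ A : Finset ℕ, A ⊆ Finset.Icc 1 N →
      δ * (N : ℝ) ≤ (A.card : ℝ) →
      ∃ a ∈ A, ∃ a' ∈ A, a ≠ a' ∧ ∃ n : ℕ, 0 < n ∧ (a : ℤ) - (a' : ℤ) = (n : ℤ) ^ 2 := by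
  by_contra! hcon
  choose N hN A hA hcard hsq using hcon
  have hNtop : Tendsto N atTop atTop := tendsto_atTop_mono (fun k ↦ (hN k).le) tendsto_id
  have hNpos (k : ℕ) : (0 : ℝ) < N k := by exact_mod_cast (Nat.zero_le k).trans_lt (hN k)
  obtain ⟨Λ, hΛ⟩ := exists_linearMap_tendsto_average N
  have hnonneg (F : ℕ × ℤ →ᵇ ℝ) (hF : ∀ p, 0 ≤ F p) : 0 ≤ Λ F :=
    ge_of_tendsto' (hΛ F) fun k ↦
      mul_nonneg (inv_nonneg.2 (hNpos k).le) (sum_nonneg fun x _ ↦ hF _)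
  have hone : Λ 1 = 1 :=
    tendsto_nhds_unique (hΛ 1) (tendsto_const_nhds.congr fun k ↦ by simp [(hNpos k).ne'])
  set f := indicatorSeq A with hf
  have hff : f * f = f := by
    ext ⟨k, x⟩
    simp [hf, indicatorSeq_apply]
  have hf_le : Λ f ≤ 1 := by
    rw [← hone, ← sub_nonneg, ← map_sub]
    refine hnonneg _ fun ⟨k, x⟩ ↦ ?_
    simp only [hf, BoundedContinuousFunction.coe_sub, Pi.sub_apply, BoundedContinuousFunction.coe_one,
      Pi.one_apply, indicatorSeq_apply]
    split_ifs <;> simp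
  have hf_pos : δ ≤ Λ f := by
    refine ge_of_tendsto' (hΛ f) fun k ↦ ?_
    rw [sum_indicatorSeq (hA k), le_inv_mul_iff₀ (hNpos k), mul_comm]
    exact hcard k
  obtain ⟨n, hn, hne⟩ := LinearMap.exists_bilin_pow_sq_ne_zero
    ((LinearMap.mul ℝ (ℕ × ℤ →ᵇ ℝ)).compr₂ Λ) (fun F G ↦ by simp [mul_comm])
    (fun F ↦ by simpa using hnonneg _ fun p ↦ mul_self_nonneg (F p)) shift
    (fun F G ↦ map_shift_eq_of_tendsto_average hNtop hΛ (F * G)) (e := 1) (f := f) rfl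
    (by simp [hone]) (by simpa [hff] using hf_le) (by simpa using hδ.trans_le hf_pos)
  refine hne ?_
  have : (shift ^ n ^ 2) f * f = 0 := by
    ext ⟨k, x⟩
    rw [BoundedContinuousFunction.mul_apply, shift_pow_apply, hf, indicatorSeq_apply,
      indicatorSeq_apply, BoundedContinuousFunction.coe_zero, Pi.zero_apply, mul_ite, mul_one,
      mul_zero, ite_eq_right_iff, ite_eq_right_iff]
    intro h₂ h₁
    exfalso
    obtain ⟨a, ha, hax⟩ := mem_map.1 h₁
    obtain ⟨b, hb, rfl⟩ := mem_map.1 h₂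
    simp only [Nat.castEmbedding_apply, Nat.cast_pow] at hax
    have hn2 : (0 : ℤ) < (n : ℤ) ^ 2 := by positivity
    exact hsq k a ha b hb (by rintro rfl; linarith) n hn (by rw [hax]; ring)
  simp [this]
end

section
/- Let h ∈ ℤ[x] be an intersective polynomial of degree k ≥ 2 such that h and h' are positive and increasing for x ≥ 0, and let δ > 0. Then there exists a constant c(h,δ) > 0 depending only on h and δ such that for all N sufficiently large depending on h and δ, every subset A of {1, …, N} with |A| ≥ δN satisfies R(A,h) ≥ c(h,δ)|A|². -/
open Polynomial

/-- `r g n A` counts the pairs `(a, a')` of elements of `A` with `a - a' = g(n)`. -/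
def rCount (g : Polynomial ℤ) (n : ℕ) (A : Finset ℕ) : ℕ :=
  ((A ×ˢ A).filter (fun p => (p.1 : ℤ) - (p.2 : ℤ) = g.eval (n : ℤ))).card

/-- `RR g A = Σ_{n ≥ 0} g'(n) · r(g, n, A)`. -/
noncomputable def RR (g : Polynomial ℤ) (A : Finset ℕ) : ℝ :=
  ∑' n : ℕ, ((g.derivative.eval (n : ℤ) : ℤ) : ℝ) * (rCount g n A : ℝ)

/-- The additive character `x ↦ exp (2πix)`. -/
noncomputable def expi (x : ℝ) : ℂ := Complex.exp (((2 * Real.pi * x : ℝ) : ℂ) * Complex.I)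

lemma expi_add (x y : ℝ) : expi (x + y) = expi x * expi y := by
  unfold expi
  rw [← Complex.exp_add]
  congr 1
  push_cast
  ring

lemma expi_zero : expi 0 = 1 := by simp [expi]

lemma expi_int (n : ℤ) : expi n = 1 := by
  unfold expi
  rw [Complex.exp_eq_one_iff]
  exact ⟨n, by push_cast; ring⟩

lemma expi_natCast_mul (n : ℕ) (x : ℝ) : expi (n * x) = expi x ^ n := by
  unfold expi
  rw [← Complex.exp_nat_mul]
  congr 1
  push_cast
  ring

lemma norm_expi (x : ℝ) : ‖expi x‖ = 1 := Complex.norm_exp_ofReal_mul_I _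

lemma conj_expi (x : ℝ) : (starRingEnd ℂ) (expi x) = expi (-x) := by
  unfold expi
  rw [← Complex.exp_conj, map_mul, Complex.conj_ofReal, Complex.conj_I]
  congr 1
  push_cast
  ring

lemma expi_re (x : ℝ) : (expi x).re = Real.cos (2 * Real.pi * x) :=
  Complex.exp_ofReal_mul_I_re _

lemma expi_add_int (x : ℝ) (n : ℤ) : expi (x + n) = expi x := by
  rw [expi_add, expi_int, mul_one]

lemma four_mul_abs_le_norm_expi_sub_one {x : ℝ} (hx : |x| ≤ 1 / 2) :
    4 * |x| ≤ ‖expi x - 1‖ := by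
  have h1 : ‖expi x - 1‖ = ‖2 * Real.sin ((2 * Real.pi * x) / 2)‖ := by
    rw [← Complex.norm_exp_I_mul_ofReal_sub_one, expi, mul_comm]
  have h2 : 2 * Real.pi * x / 2 = Real.pi * x := by ring
  have h3 : |Real.pi * x| = Real.pi * |x| := by rw [abs_mul, abs_of_pos Real.pi_pos]
  have h4 := Real.mul_abs_le_abs_sin (x := Real.pi * x) (by
    rw [h3]; nlinarith [Real.pi_pos])
  rw [h3] at h4
  rw [h1, h2, norm_mul, Real.norm_eq_abs, Real.norm_eq_abs, abs_of_pos (by norm_num : (0:ℝ) < 2)]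
  have h5 : 2 / Real.pi * (Real.pi * |x|) = 2 * |x| := by
    field_simp
  linarith

lemma exists_int_abs_sub_le_of_geom_sum {η : ℝ} (hη : 0 < η) {L : ℕ} (hL : 0 < L) (θ : ℝ)
    (hS : η * L ≤ ‖∑ m ∈ Finset.range L, expi θ ^ m‖) :
    ∃ b : ℤ, |θ - b| ≤ 1 / η / L := by
  refine ⟨round θ, ?_⟩
  have hL' : (0 : ℝ) < L := by exact_mod_cast hL
  set x := θ - round θ with hx
  have h1 : expi θ = expi x := by
    have : θ = x + (round θ : ℤ) := by rw [hx]; ring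
    rw [congrArg expi this, expi_add_int]
  have h2 := four_mul_abs_le_norm_expi_sub_one (abs_sub_round θ)
  have h3 : ‖expi x ^ L - 1‖ ≤ 2 := by
    refine (norm_sub_le _ _).trans ?_
    rw [norm_pow, norm_expi]
    norm_num
  rw [h1] at hS
  rw [← geom_sum_mul, norm_mul] at h3
  have h4 : η * L * (4 * |x|) ≤ 2 := by
    refine le_trans (mul_le_mul hS h2 (by positivity) (by positivity)) h3
  rw [div_div, le_div_iff₀ (by positivity)]
  nlinarith

/-- The van der Corput identity. -/
lemma normSq_sum_range (z : ℕ → ℂ) (L : ℕ) :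
    ‖∑ m ∈ Finset.range L, z m‖ ^ 2 = ∑ m ∈ Finset.range L, ‖z m‖ ^ 2 +
      2 * (∑ h ∈ Finset.range L, ∑ m ∈ Finset.range (L - 1 - h),
        z (m + (h + 1)) * (starRingEnd ℂ) (z m)).re := by
  induction L with
  | zero => simp
  | succ L ih =>
    rw [Finset.sum_range_succ, Finset.sum_range_succ (fun m => ‖z m‖ ^ 2)]
    have h1 : ‖∑ m ∈ Finset.range L, z m + z L‖ ^ 2 = ‖∑ m ∈ Finset.range L, z m‖ ^ 2 + ‖z L‖ ^ 2
        + 2 * (z L * (starRingEnd ℂ) (∑ m ∈ Finset.range L, z m)).re := by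
      rw [Complex.sq_norm, Complex.sq_norm, Complex.sq_norm, Complex.normSq_add]
      congr 2
      simp only [Complex.mul_re, Complex.conj_re, Complex.conj_im]
      ring
    have h2 : ∑ h ∈ Finset.range (L + 1), ∑ m ∈ Finset.range (L + 1 - 1 - h),
        z (m + (h + 1)) * (starRingEnd ℂ) (z m) =
        ∑ h ∈ Finset.range L, ∑ m ∈ Finset.range (L - 1 - h),
        z (m + (h + 1)) * (starRingEnd ℂ) (z m) +
        z L * (starRingEnd ℂ) (∑ m ∈ Finset.range L, z m) := by
      rw [Finset.sum_range_succ, map_sum, ← Finset.sum_range_reflect (fun m => (starRingEnd ℂ) (z m)), Finset.mul_sum,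
        ← Finset.sum_add_distrib]
      simp only [Nat.add_sub_cancel, Nat.sub_self, Finset.range_zero, Finset.sum_empty, add_zero]
      refine Finset.sum_congr rfl fun h hh => ?_
      have hh' := Finset.mem_range.1 hh
      have e : L - h = (L - 1 - h) + 1 := by omega
      have e' : L - 1 - h + (h + 1) = L := by omega
      rw [e, Finset.sum_range_succ, e']
    rw [h1, h2, ih, Complex.add_re]
    ring

/-- If many translates of `H` fit in a short interval, then two of them meet. -/
lemma exists_eq_add_mul_of_card {L I s : ℕ} {H : Finset ℕ} (hH : H ⊆ Finset.Icc 1 L)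
    (hcard : L + s * I < (I + 1) * H.card) :
    ∃ h ∈ H, ∃ h' ∈ H, ∃ d : ℕ, 1 ≤ d ∧ d ≤ I ∧ h' = h + s * d := by
  obtain ⟨⟨a, i⟩, hx, ⟨b, j⟩, hy, hne, heq⟩ := Finset.exists_ne_map_eq_of_card_lt_of_maps_to
    (s := H ×ˢ Finset.range (I + 1)) (t := Finset.Icc 1 (L + s * I))
    (f := fun p => p.1 + s * p.2) (by simpa [mul_comm] using hcard) (by
      rintro ⟨a, i⟩ hx
      simp only [Finset.coe_product, Set.mem_prod, Finset.mem_coe, Finset.mem_range] at hx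
      have h1 := Finset.mem_Icc.1 (hH hx.1)
      have h2 : s * i ≤ s * I := Nat.mul_le_mul_left _ (by omega)
      simp only [Finset.coe_Icc, Set.mem_Icc]
      omega)
  simp only [Finset.mem_product, Finset.mem_range] at hx hy heq
  rcases lt_trichotomy i j with h | h | h
  · refine ⟨b, hy.1, a, hx.1, j - i, by omega, by omega, ?_⟩
    rw [Nat.mul_sub]
    have : s * i ≤ s * j := Nat.mul_le_mul_left _ h.le
    omega
  · subst h
    exact absurd (by simpa using heq) (by simpa using hne)
  · refine ⟨a, hx.1, b, hy.1, i - j, by omega, by omega, ?_⟩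
    rw [Nat.mul_sub]
    have : s * j ≤ s * i := Nat.mul_le_mul_left _ h.le
    omega

/-- If `hθ` is very close to an integer for a positive proportion of the `h ≤ L`, then a bounded
multiple of `θ` is within `O(ε / L)` of an integer. -/
lemma exists_int_abs_sub_le_of_many_close {η : ℝ} (hη : 0 < η) :
    ∃ q : ℕ, 0 < q ∧ ∃ ε₀ : ℝ, 0 < ε₀ ∧ ∃ C : ℝ, 0 < C ∧ ∃ L₀ : ℕ,
      ∀ L : ℕ, L₀ ≤ L → ∀ ε : ℝ, 0 < ε → ε ≤ ε₀ → ∀ θ : ℝ, ∀ H : Finset ℕ,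
        H ⊆ Finset.Icc 1 L → η * L ≤ H.card → (∀ h ∈ H, ∃ b : ℤ, |h * θ - b| ≤ ε) →
        ∃ b : ℤ, |q * θ - b| ≤ C * ε / L := by
  obtain ⟨I, hI⟩ := exists_nat_gt (2 / η)
  have hI0 : (0 : ℝ) < I := lt_trans (by positivity) hI
  have hI1 : (1 : ℝ) ≤ I := by exact_mod_cast (Nat.cast_pos.1 hI0)
  rw [div_lt_iff₀ hη] at hI
  refine ⟨I.factorial, Nat.factorial_pos _, 1 / (5 * I + 5), by positivity,
    I.factorial * (5 * I ^ 2), by positivity, I + 1, ?_⟩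
  intro L hL ε hε hεle θ H hH hcard hclose
  have hL' : (I : ℝ) + 1 ≤ L := by exact_mod_cast hL
  have hL0 : (0 : ℝ) < L := by linarith
  have hbig : 2 * (L : ℝ) < (I + 1) * H.card := by nlinarith
  rw [le_div_iff₀ (by positivity)] at hεle
  have diff : ∀ h ∈ H, ∀ h' ∈ H, ∀ e : ℕ, h' = h + e → ∃ b : ℤ, |e * θ - b| ≤ 2 * ε := by
    intro h hh h' hh' e he
    obtain ⟨b, hb⟩ := hclose h hh
    obtain ⟨b', hb'⟩ := hclose h' hh'
    refine ⟨b' - b, ?_⟩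
    rw [he] at hb'
    push_cast at hb' ⊢
    rw [abs_le] at *
    constructor <;> linarith
  obtain ⟨h, hh, h', hh', q, hq1, hqI, hqe⟩ := exists_eq_add_mul_of_card (I := I) (s := 1) hH (by
    have : ((L + 1 * I : ℕ) : ℝ) < ((I + 1) * H.card : ℕ) := by push_cast; linarith
    exact_mod_cast this)
  rw [one_mul] at hqe
  obtain ⟨b, hb⟩ := diff h hh h' hh' q hqe
  have hqI' : (q : ℝ) ≤ I := by exact_mod_cast hqI
  have hq1' : (1 : ℝ) ≤ q := by exact_mod_cast hq1
  set β := (q : ℝ) * θ - b with hβ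
  have key : |β| ≤ 5 * I ^ 2 * ε / L := by
    by_contra hcon
    push Not at hcon
    have hβ0 : 0 < |β| := lt_trans (by positivity) hcon
    rw [div_lt_iff₀ hL0] at hcon
    set s := ⌈3 * ε / |β|⌉₊ with hs
    have hs1 : 3 * ε ≤ s * |β| := by
      have := Nat.le_ceil (3 * ε / |β|)
      rwa [div_le_iff₀ hβ0] at this
    have hs2 : s * |β| ≤ 5 * ε := by
      have := (Nat.ceil_lt_add_one (a := 3 * ε / |β|) (by positivity)).le
      rw [← hs, ← sub_le_iff_le_add, le_div_iff₀ hβ0] at this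
      linarith
    have hsL : (I : ℝ) ^ 2 * s ≤ L := by
      by_contra hc
      push Not at hc
      have h1 : (I : ℝ) ^ 2 * s * |β| ≤ I ^ 2 * (5 * ε) := by
        rw [mul_assoc]
        exact mul_le_mul_of_nonneg_left hs2 (by positivity)
      nlinarith
    obtain ⟨g, hg, g', hg', d, hd1, hdI, hde⟩ :=
      exists_eq_add_mul_of_card (I := I) (s := q * s) hH (by
        have h1 : (q : ℝ) * s * I ≤ L := by
          refine le_trans ?_ hsL
          have : (q : ℝ) * (s * I) ≤ I * (s * I) := mul_le_mul_of_nonneg_right hqI' (by positivity)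
          nlinarith
        have : ((L + q * s * I : ℕ) : ℝ) < ((I + 1) * H.card : ℕ) := by push_cast; linarith
        exact_mod_cast this)
    obtain ⟨c, hc⟩ := diff g hg g' hg' _ hde
    have hd1' : (1 : ℝ) ≤ d := by exact_mod_cast hd1
    have hdI' : (d : ℝ) ≤ I := by exact_mod_cast hdI
    have hc' : |d * s * β - ((c - d * s * b : ℤ) : ℝ)| ≤ 2 * ε := by
      convert hc using 2
      rw [hβ]
      push_cast
      ring
    have habs : |d * s * β| = d * (s * |β|) := by
      rw [abs_mul, abs_mul, Nat.abs_cast, Nat.abs_cast, mul_assoc]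
    have hlow : 3 * ε ≤ |d * s * β| := by rw [habs]; nlinarith
    have hupp : |d * s * β| ≤ 5 * ε * I := by rw [habs]; nlinarith [abs_nonneg β]
    have hz : |((c - d * s * b : ℤ) : ℝ)| < 1 := by
      have := abs_sub_abs_le_abs_sub ((c - d * s * b : ℤ) : ℝ) (d * s * β)
      rw [abs_sub_comm] at hc'
      nlinarith
    have hz0 : c - d * s * b = 0 := by
      have : |c - d * s * b| < 1 := by exact_mod_cast hz
      exact Int.abs_lt_one_iff.1 this
    rw [hz0, Int.cast_zero, sub_zero] at hc'
    linarith
  obtain ⟨t, ht⟩ := Nat.dvd_factorial hq1 hqI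
  refine ⟨t * b, ?_⟩
  have htle : (t : ℝ) ≤ I.factorial := by
    exact_mod_cast Nat.le_of_dvd (Nat.factorial_pos _) ⟨q, by rw [ht, mul_comm]⟩
  have e : (I.factorial : ℝ) * θ - ((t * b : ℤ) : ℝ) = t * β := by
    rw [ht, hβ]; push_cast; ring
  rw [e, abs_mul, Nat.abs_cast]
  calc (t : ℝ) * |β| ≤ I.factorial * (5 * I ^ 2 * ε / L) :=
        mul_le_mul htle key (abs_nonneg _) (by positivity)
    _ = I.factorial * (5 * I ^ 2) * ε / L := by ring

lemma fwdDiff_iter_sub_shift (f : ℝ → ℝ) (n h : ℕ) (x : ℝ) :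
    (fwdDiff 1)^[n] (fun r => f (r + h) - f r) x =
      (fwdDiff 1)^[n] f (x + h) - (fwdDiff 1)^[n] f x := by
  have : (fun r => f (r + h) - f r) = (fun r => f (r + h)) + (-1 : ℝ) • f := by
    funext r
    simp [sub_eq_add_neg]
  rw [this, fwdDiff_iter_add, fwdDiff_iter_const_smul, Pi.add_apply, fwdDiff_iter_comp_add]
  simp [sub_eq_add_neg]

lemma add_nat_eq_of_fwdDiff_eq {g : ℝ → ℝ} {θ : ℝ} (hg : ∀ x, fwdDiff 1 g x = θ) (x : ℝ) (n : ℕ) :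
    g (x + n) = g x + n * θ := by
  induction n with
  | zero => simp
  | succ n ih =>
    have := hg (x + n)
    unfold fwdDiff at this
    push_cast
    rw [← add_assoc]
    linarith

/-- A large exponential sum has many large differenced sums. -/
lemma le_card_large_differences {η : ℝ} {L : ℕ} (hL : 2 ≤ η ^ 2 * L) (f : ℝ → ℝ) (hη : 0 < η)
    (hS : η * L ≤ ‖∑ m ∈ Finset.range L, expi (f m)‖) :
    η ^ 2 / 8 * L ≤ ((Finset.Icc 1 L).filter (fun h => η ^ 2 / 8 * L ≤
      ‖∑ m ∈ Finset.range (L - h), expi (f (m + h) - f m)‖)).card := by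
  set H := (Finset.Icc 1 L).filter (fun h => η ^ 2 / 8 * L ≤
      ‖∑ m ∈ Finset.range (L - h), expi (f (m + h) - f m)‖) with hH
  set T : ℕ → ℂ := fun h => ∑ m ∈ Finset.range (L - h), expi (f (m + h) - f m) with hT
  have hL0 : (0 : ℝ) < L := by
    by_contra hc
    have : (L : ℝ) = 0 := le_antisymm (not_lt.1 hc) (Nat.cast_nonneg _)
    rw [this] at hL
    linarith
  have h1 := normSq_sum_range (fun m => expi (f m)) L
  have h2 : ∑ h ∈ Finset.range L, ∑ m ∈ Finset.range (L - 1 - h),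
        expi (f ((m + (h + 1) : ℕ) : ℝ)) * (starRingEnd ℂ) (expi (f m)) =
      ∑ h ∈ Finset.Icc 1 L, T h := by
    rw [← Finset.Ico_succ_right_eq_Icc, Finset.sum_Ico_eq_sum_range]
    refine Finset.sum_congr (by simp) fun h _ => ?_
    rw [hT]
    dsimp only
    rw [Nat.sub_sub]
    refine Finset.sum_congr rfl fun m _ => ?_
    rw [conj_expi, ← expi_add, sub_eq_add_neg, add_comm 1 h]
    push_cast
    rfl
  rw [h2] at h1
  simp only [norm_expi, one_pow, Finset.sum_const, Finset.card_range, nsmul_eq_mul, mul_one] at h1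
  have h3 : (∑ h ∈ Finset.Icc 1 L, T h).re ≤ H.card * L + η ^ 2 / 8 * L * L := by
    refine (Complex.re_le_norm _).trans ((norm_sum_le _ _).trans ?_)
    have h4 : ∀ h ∈ Finset.Icc 1 L, ‖T h‖ ≤ (if η ^ 2 / 8 * L ≤ ‖T h‖ then (L : ℝ) else 0)
        + η ^ 2 / 8 * L := by
      intro h _
      split_ifs with hc
      · have : ‖T h‖ ≤ L := by
          refine (norm_sum_le _ _).trans ?_
          simp only [norm_expi, Finset.sum_const, Finset.card_range, nsmul_eq_mul, mul_one]
          exact_mod_cast Nat.sub_le _ _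
        have : 0 ≤ η ^ 2 / 8 * L := by positivity
        linarith
      · linarith
    refine (Finset.sum_le_sum h4).trans ?_
    rw [Finset.sum_add_distrib, ← Finset.sum_filter]
    simp only [Finset.sum_const, nsmul_eq_mul, Nat.card_Icc, Nat.add_sub_cancel]
    rw [hH]
    linarith
  have h5 : (η * L) ^ 2 ≤ ‖∑ m ∈ Finset.range L, expi (f m)‖ ^ 2 :=
    pow_le_pow_left₀ (by positivity) hS 2
  rw [h1] at h5
  have h6 : (η ^ 2 * L - 1 - η ^ 2 / 4 * L) * L ≤ (2 * H.card) * L := by nlinarith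
  have h7 := le_of_mul_le_mul_right h6 hL0
  linarith

/-- A qualitative form of Weyl's inequality: if `f` is a polynomial phase of degree `k + 1` whose
exponential sum is large, then its leading coefficient is close to a rational number with bounded
denominator. -/
theorem weyl_inequality (k : ℕ) : ∀ η : ℝ, 0 < η → ∃ D : ℕ, 0 < D ∧ ∃ K : ℝ, 0 < K ∧ ∃ L₀ : ℕ,
    ∀ L : ℕ, L₀ ≤ L → ∀ (f : ℝ → ℝ) (θ : ℝ), (∀ x, (fwdDiff 1)^[k + 1] f x = θ) →
      η * L ≤ ‖∑ m ∈ Finset.range L, expi (f m)‖ →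
      ∃ b : ℤ, |D * θ - b| ≤ K / (L : ℝ) ^ (k + 1) := by
  induction k with
  | zero =>
    intro η hη
    refine ⟨1, one_pos, 1 / η, by positivity, 1, ?_⟩
    intro L hL f θ hf hS
    have hlin : ∀ m : ℕ, expi (f m) = expi (f 0) * expi θ ^ m := by
      intro m
      rw [← expi_natCast_mul, ← expi_add, ← add_nat_eq_of_fwdDiff_eq hf, zero_add]
    simp only [hlin] at hS
    rw [← Finset.mul_sum, norm_mul, norm_expi, one_mul] at hS
    simpa using exists_int_abs_sub_le_of_geom_sum hη hL θ hS
  | succ k ih =>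
    intro η hη
    have hη' : 0 < η ^ 2 / 8 := by positivity
    obtain ⟨D, hD, K, hK, L₁, hW⟩ := ih (η ^ 2 / 8) hη'
    obtain ⟨q, hq, ε₀, hε₀, C, hC, L₂, hR⟩ := exists_int_abs_sub_le_of_many_close hη'
    obtain ⟨L₃, hL₃⟩ := exists_nat_ge ((1 + K / ε₀ + L₁) / (η ^ 2 / 8))
    refine ⟨q * D, by positivity, C * K / (η ^ 2 / 8) ^ (k + 1), by positivity, max L₂ L₃, ?_⟩
    intro L hL f θ hf hS
    have hL2 : L₂ ≤ L := le_trans (le_max_left _ _) hL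
    have hL3 : (L₃ : ℝ) ≤ L := by exact_mod_cast le_trans (le_max_right _ _) hL
    have hbig : 1 + K / ε₀ + L₁ ≤ η ^ 2 / 8 * L := by
      have := hL₃.trans hL3
      rwa [div_le_iff₀ hη', mul_comm] at this
    have hKε : 0 < K / ε₀ := by positivity
    have hL₁0 : (0 : ℝ) ≤ L₁ := Nat.cast_nonneg _
    have hcard := le_card_large_differences (by linarith) f hη hS
    set y := η ^ 2 / 8 * (L : ℝ) with hy
    have hy1 : 1 ≤ y := by linarith
    have hypow : y ≤ y ^ (k + 1) := le_self_pow₀ hy1 (by omega)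
    obtain ⟨b, hb⟩ := hR L hL2 (K / y ^ (k + 1)) (by positivity) (by
      rw [div_le_iff₀ (by positivity)]
      have : K / ε₀ ≤ y ^ (k + 1) := by linarith
      rwa [div_le_iff₀ hε₀, mul_comm] at this) (D * θ) _ (Finset.filter_subset _ _) hcard (by
      intro h hh
      have hTh := (Finset.mem_filter.1 hh).2
      have hTh' : ‖∑ m ∈ Finset.range (L - h), expi (f (m + h) - f m)‖ ≤ ((L - h : ℕ) : ℝ) := by
        refine (norm_sum_le _ _).trans ?_
        simp [norm_expi]
      have hyLh : y ≤ ((L - h : ℕ) : ℝ) := hTh.trans hTh'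
      obtain ⟨b, hb⟩ := hW (L - h) (by
        have : (L₁ : ℝ) ≤ ((L - h : ℕ) : ℝ) := by linarith
        exact_mod_cast this) (fun r => f (r + h) - f r) (h * θ) (by
          intro x
          rw [fwdDiff_iter_sub_shift, add_nat_eq_of_fwdDiff_eq (g := (fwdDiff 1)^[k + 1] f) (θ := θ)]
          · ring
          · intro x
            rw [← Function.iterate_succ_apply' (fwdDiff 1)]
            exact hf x) (by
          refine le_trans ?_ hTh
          rw [hy]
          refine mul_le_mul_of_nonneg_left ?_ hη'.le
          exact_mod_cast Nat.sub_le _ _)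
      refine ⟨b, ?_⟩
      have e : (h : ℝ) * (D * θ) - b = D * (h * θ) - b := by ring
      rw [e]
      refine hb.trans ?_
      exact div_le_div_of_nonneg_left hK.le (by positivity)
        (pow_le_pow_left₀ (by positivity) hyLh _))
    refine ⟨b, ?_⟩
    have e : ((q * D : ℕ) : ℝ) * θ - b = q * (D * θ) - b := by push_cast; ring
    rw [e]
    refine hb.trans (le_of_eq ?_)
    rw [hy, mul_pow, pow_succ (L : ℝ) (k + 1)]
    field_simp

lemma sum_expi_mul_div {M : ℕ} (hM : 0 < M) (u : ℤ) :
    ∑ j ∈ Finset.range M, expi (j * (u / M)) = if (M : ℤ) ∣ u then (M : ℂ) else 0 := by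
  have hM' : (M : ℝ) ≠ 0 := by positivity
  simp only [expi_natCast_mul]
  split_ifs with hd
  · obtain ⟨v, rfl⟩ := hd
    have : ((M * v : ℤ) : ℝ) / M = (v : ℤ) := by
      push_cast
      field_simp
    rw [this, expi_int]
    simp
  · have h1 : expi ((u : ℝ) / M) ^ M = 1 := by
      rw [← expi_natCast_mul, mul_div_cancel₀ _ hM', expi_int]
    have h2 : expi ((u : ℝ) / M) ≠ 1 := by
      intro h
      rw [expi, Complex.exp_eq_one_iff] at h
      obtain ⟨v, hv⟩ := h
      apply hd
      refine ⟨v, ?_⟩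
      have h3 : ((2 * Real.pi * ((u : ℝ) / M) : ℝ) : ℂ) * Complex.I =
          ((2 * Real.pi * v : ℝ) : ℂ) * Complex.I := by
        rw [hv]; push_cast; ring
      have h4 := Complex.ofReal_injective (mul_right_cancel₀ Complex.I_ne_zero h3)
      have h5 := mul_left_cancel₀ (by positivity : 2 * Real.pi ≠ 0) h4
      rw [div_eq_iff hM', mul_comm] at h5
      exact_mod_cast h5
    have h3 := geom_sum_mul (expi ((u : ℝ) / M)) M
    rw [h1, sub_self] at h3
    exact (mul_eq_zero.1 h3).resolve_right (sub_ne_zero.2 h2)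

/-- The energy of `A` at the frequency `j / (2N)`. -/
noncomputable def energyAt (N : ℕ) (A : Finset ℕ) (j : ℕ) : ℝ :=
  ‖∑ a ∈ A, expi (j / (2 * N : ℕ) * a)‖ ^ 2 / (2 * N : ℕ)

lemma energyAt_nonneg (N : ℕ) (A : Finset ℕ) (j : ℕ) : 0 ≤ energyAt N A j := by
  unfold energyAt
  positivity

lemma energyAt_zero (N : ℕ) (A : Finset ℕ) : energyAt N A 0 = (A.card : ℝ) ^ 2 / (2 * N) := by
  simp [energyAt, expi_zero]

/-- Fourier inversion for the number of representations of `t` as a difference. -/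
lemma sum_energyAt_mul_cos {N : ℕ} (hN : 0 < N) {A : Finset ℕ} (hA : A ⊆ Finset.Icc 1 N) {t : ℤ}
    (ht0 : 0 ≤ t) (htN : t ≤ N) :
    ∑ j ∈ Finset.range (2 * N), energyAt N A j * (expi (j / (2 * N : ℕ) * t)).re =
      ((A ×ˢ A).filter (fun p => (p.1 : ℤ) - (p.2 : ℤ) = t)).card := by
  have hM : 0 < 2 * N := by omega
  have hM' : ((2 * N : ℕ) : ℂ) ≠ 0 := by exact_mod_cast hM.ne'
  have h1 : ∀ j : ℕ, ((‖∑ a ∈ A, expi (j / (2 * N : ℕ) * a)‖ ^ 2 : ℝ) : ℂ) *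
      expi (-(j / (2 * N : ℕ) * t)) = ∑ p ∈ A ×ˢ A,
        expi (j * (((p.1 - p.2 - t : ℤ) : ℝ) / (2 * N : ℕ))) := by
    intro j
    push_cast
    rw [← Complex.mul_conj', map_sum, Finset.sum_mul_sum, ← Finset.sum_product', Finset.sum_mul]
    refine Finset.sum_congr rfl fun p _ => ?_
    rw [conj_expi, ← expi_add, ← expi_add]
    congr 1
    ring
  have h2 : ∑ j ∈ Finset.range (2 * N), ((energyAt N A j : ℝ) : ℂ) *
      expi (-(j / (2 * N : ℕ) * t)) =
      ((A ×ˢ A).filter (fun p => (p.1 : ℤ) - (p.2 : ℤ) = t)).card := by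
    have h3 : ∀ j : ℕ, ((energyAt N A j : ℝ) : ℂ) * expi (-(j / (2 * N : ℕ) * t)) =
        (∑ p ∈ A ×ˢ A, expi (j * (((p.1 - p.2 - t : ℤ) : ℝ) / (2 * N : ℕ)))) *
          ((2 * N : ℕ) : ℂ)⁻¹ := by
      intro j
      rw [← h1, energyAt, Complex.ofReal_div, Complex.ofReal_natCast]
      ring
    simp only [h3]
    rw [← Finset.sum_mul, Finset.sum_comm]
    simp only [sum_expi_mul_div hM]
    rw [← Finset.sum_filter, Finset.sum_const, nsmul_eq_mul, mul_inv_cancel_right₀ hM']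
    congr 2
    refine Finset.filter_congr fun p hp => ?_
    have hp1 := Finset.mem_Icc.1 (hA (Finset.mem_product.1 hp).1)
    have hp2 := Finset.mem_Icc.1 (hA (Finset.mem_product.1 hp).2)
    constructor
    · intro hd
      have := Int.eq_zero_of_abs_lt_dvd hd (by
        rw [abs_lt]
        push_cast
        constructor <;> omega)
      omega
    · intro he
      rw [show (p.1 : ℤ) - p.2 - t = 0 by omega]
      exact dvd_zero _
  have h4 := congrArg Complex.re h2
  rw [Complex.re_sum, Complex.natCast_re] at h4
  rw [← h4]
  refine Finset.sum_congr rfl fun j _ => ?_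
  rw [Complex.re_ofReal_mul, expi_re, expi_re, mul_neg, Real.cos_neg]

lemma sum_energyAt {N : ℕ} (hN : 0 < N) {A : Finset ℕ} (hA : A ⊆ Finset.Icc 1 N) :
    ∑ j ∈ Finset.range (2 * N), energyAt N A j = A.card := by
  have h1 := sum_energyAt_mul_cos hN hA le_rfl (by omega)
  simp only [Int.cast_zero, mul_zero, expi_zero, Complex.one_re, mul_one] at h1
  rw [h1]
  congr 1
  rw [← Finset.diag_card A]
  congr 1
  ext p
  rw [Finset.mem_filter, Finset.mem_product, Finset.mem_diag]
  constructor
  · rintro ⟨⟨h1, _⟩, h2⟩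
    exact ⟨h1, by omega⟩
  · rintro ⟨h1, h2⟩
    exact ⟨⟨h1, h2 ▸ h1⟩, by omega⟩

open Classical in
/-- The energy of `A` on the frequencies satisfying `P`. -/
noncomputable def energyOn (N : ℕ) (A : Finset ℕ) (P : ℕ → Prop) : ℝ :=
  ∑ j ∈ Finset.range (2 * N), if P j then energyAt N A j else 0

lemma energyOn_le_card {N : ℕ} (hN : 0 < N) {A : Finset ℕ} (hA : A ⊆ Finset.Icc 1 N)
    (P : ℕ → Prop) : energyOn N A P ≤ A.card := by
  classical
  rw [← sum_energyAt hN hA]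
  refine Finset.sum_le_sum fun j _ => ?_
  have := energyAt_nonneg N A j
  split_ifs <;> linarith

lemma energyOn_nonneg (N : ℕ) (A : Finset ℕ) (P : ℕ → Prop) : 0 ≤ energyOn N A P := by
  refine Finset.sum_nonneg fun j _ => ?_
  have := energyAt_nonneg N A j
  split_ifs <;> linarith

/-- If the exponential sum of `t` is nonnegative on `P` and small off `P'`, then the differences of
`A` represent many of the `t m`, up to the energy of `A` on `P' \ P`. -/
lemma le_sum_card_of_energy {N : ℕ} (hN : 0 < N) {A : Finset ℕ} (hA : A ⊆ Finset.Icc 1 N)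
    {L : ℕ} {t : ℕ → ℤ} (ht0 : ∀ m < L, 0 ≤ t m) (htN : ∀ m < L, t m ≤ N) {P P' : ℕ → Prop}
    {η : ℝ} (hη : 0 ≤ η) (hP0 : P 0) (hPP' : ∀ j, P j → P' j)
    (hP : ∀ j, P j → ∀ m < L, 0 ≤ (expi (j / (2 * N : ℕ) * t m)).re)
    (hP' : ∀ j, ¬ P' j → ‖∑ m ∈ Finset.range L, expi (j / (2 * N : ℕ) * t m)‖ ≤ η * L) :
    L * ((A.card : ℝ) ^ 2 / (2 * N) - η * A.card - (energyOn N A P' - energyOn N A P)) ≤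
      ∑ m ∈ Finset.range L,
        (((A ×ˢ A).filter (fun p => (p.1 : ℤ) - (p.2 : ℤ) = t m)).card : ℝ) := by
  classical
  have hL0 : (0 : ℝ) ≤ L := Nat.cast_nonneg L
  have h1 : ∑ m ∈ Finset.range L,
        (((A ×ˢ A).filter (fun p => (p.1 : ℤ) - (p.2 : ℤ) = t m)).card : ℝ) =
      ∑ j ∈ Finset.range (2 * N), energyAt N A j *
        (∑ m ∈ Finset.range L, expi (j / (2 * N : ℕ) * t m)).re := by
    simp only [Complex.re_sum, Finset.mul_sum]
    rw [Finset.sum_comm]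
    refine Finset.sum_congr rfl fun m hm => ?_
    rw [Finset.mem_range] at hm
    exact (sum_energyAt_mul_cos hN hA (ht0 m hm) (htN m hm)).symm
  have h2 : ∑ j ∈ Finset.range (2 * N), (if j = 0 then energyAt N A j else 0) =
      (A.card : ℝ) ^ 2 / (2 * N) := by
    rw [Finset.sum_ite_eq_of_mem' _ _ _ (Finset.mem_range.2 (by omega)), energyAt_zero]
  rw [h1, ← h2, ← sum_energyAt hN hA, energyOn, energyOn, Finset.mul_sum _ _ η,
    ← Finset.sum_sub_distrib, ← Finset.sum_sub_distrib, ← Finset.sum_sub_distrib, Finset.mul_sum]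
  refine Finset.sum_le_sum fun j _ => ?_
  have hw := energyAt_nonneg N A j
  set w := energyAt N A j
  set S := ∑ m ∈ Finset.range L, expi (j / (2 * N : ℕ) * t m) with hS
  suffices hs : (L : ℝ) * ((if j = 0 then 1 else 0) - η -
      ((if P' j then 1 else 0) - (if P j then 1 else 0))) ≤ S.re by
    have := mul_le_mul_of_nonneg_left hs hw
    refine le_trans (le_of_eq ?_) this
    split_ifs <;> ring
  have hηL : 0 ≤ η * L := by positivity
  have hlow : -(L : ℝ) ≤ S.re := by
    have h3 : ‖S‖ ≤ L := by
      refine (norm_sum_le _ _).trans ?_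
      simp [norm_expi]
    have := (abs_le.1 ((Complex.abs_re_le_norm S).trans h3)).1
    linarith
  by_cases hj : j = 0
  · subst hj
    have : S = L := by
      rw [hS]
      simp [expi_zero]
    rw [this, if_pos rfl, if_pos hP0, if_pos (hPP' 0 hP0), Complex.natCast_re]
    linarith
  rw [if_neg hj]
  by_cases hPj : P j
  · rw [if_pos hPj, if_pos (hPP' j hPj)]
    have : 0 ≤ S.re := by
      rw [hS, Complex.re_sum]
      exact Finset.sum_nonneg fun m hm => hP j hPj m (Finset.mem_range.1 hm)
    linarith
  rw [if_neg hPj]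
  by_cases hPj' : P' j
  · rw [if_pos hPj']
    linarith
  · rw [if_neg hPj']
    have := (abs_le.1 ((Complex.abs_re_le_norm S).trans (hP' j hPj'))).1
    linarith

/-- The frequency `j / (2N)` is within `K / (DN)` of a rational with denominator `D`. -/
def IsMajor (D : ℕ) (K : ℝ) (N j : ℕ) : Prop :=
  ∃ b : ℤ, |(D : ℝ) * (j / (2 * N : ℕ)) - b| ≤ K / N

lemma exists_scale (E k L₁ : ℕ) (hE : 0 < E) (hk : k ≠ 0) :
    ∃ N₀ : ℕ, ∀ N : ℕ, N₀ ≤ N → ∃ L : ℕ, L₁ ≤ L ∧ E * L ^ k ≤ N ∧ N < E * (L + 1) ^ k := by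
  refine ⟨E * L₁ ^ k, fun N hN => ?_⟩
  have hex : ∃ x, N < E * x ^ k := by
    refine ⟨N + 1, ?_⟩
    calc N < N + 1 := Nat.lt_succ_self N
      _ ≤ (N + 1) ^ k := Nat.le_self_pow hk _
      _ ≤ E * (N + 1) ^ k := Nat.le_mul_of_pos_left _ hE
  obtain ⟨L, hL⟩ : ∃ L, Nat.find hex = L + 1 := by
    refine Nat.exists_eq_succ_of_ne_zero fun h0 => ?_
    have := Nat.find_spec hex
    rw [h0, zero_pow hk] at this
    omega
  have h1 := Nat.find_spec hex
  rw [hL] at h1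
  have h2 := Nat.find_min hex (m := L) (by omega)
  refine ⟨L, ?_, by omega, h1⟩
  by_contra hc
  have : E * (L + 1) ^ k ≤ E * L₁ ^ k :=
    Nat.mul_le_mul_left _ (Nat.pow_le_pow_left (by omega) _)
  omega

lemma fwdDiff_iter_const_mul_comp_linear (h : ℤ[X]) {D : ℕ} (hD : 0 < D) (α s x : ℝ) :
    (fwdDiff 1)^[h.natDegree]
      (fun y => α * (h.map (Int.castRingHom ℝ)).eval (D * y + s)) x =
      α * (h.leadingCoeff * D ^ h.natDegree * h.natDegree.factorial) := by
  have hD' : (D : ℝ) ≠ 0 := by positivity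
  set g : ℝ[X] := (h.map (Int.castRingHom ℝ)).comp (C (D : ℝ) * X + C s) with hg
  have hlin : (C (D : ℝ) * X + C s).natDegree = 1 := natDegree_linear hD'
  have hmap : (h.map (Int.castRingHom ℝ)).natDegree = h.natDegree :=
    natDegree_map_eq_of_injective (RingHom.injective_int _) h
  have h1 : g.natDegree = h.natDegree := by
    rw [hg, natDegree_comp, hlin, mul_one, hmap]
  have h2 : g.leadingCoeff = h.leadingCoeff * D ^ h.natDegree := by
    rw [hg, leadingCoeff_comp (by rw [hlin]; exact one_ne_zero), leadingCoeff_linear hD', hmap,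
      leadingCoeff_map_of_injective (RingHom.injective_int _), eq_intCast]
  have h3 := congrFun (fwdDiff_iter_degree_eq_factorial g) x
  have h4 : (fun y => α * (h.map (Int.castRingHom ℝ)).eval (D * y + s)) = α • g.eval := by
    funext y
    simp [hg]
  rw [h4, fwdDiff_iter_const_smul, Pi.smul_apply, ← h1, h3, h1, ← h2]
  simp

lemma cos_nonneg_of_isMajor {D : ℕ} {K : ℝ} {N j : ℕ} (hj : IsMajor D K N j) (hD : 0 < D)
    (hK : 0 ≤ K) {t : ℤ} (ht0 : 0 ≤ t) (hDt : (D : ℤ) ∣ t) (htN : K / N * t ≤ 1 / 4) :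
    0 ≤ (expi (j / (2 * N : ℕ) * t)).re := by
  obtain ⟨b, hb⟩ := hj
  obtain ⟨s, rfl⟩ := hDt
  have hD1 : (1 : ℤ) ≤ D := by exact_mod_cast hD
  have hs0 : 0 ≤ s := nonneg_of_mul_nonneg_right ht0 (by omega)
  have hst : (s : ℝ) ≤ ((D * s : ℤ) : ℝ) := by
    exact_mod_cast le_mul_of_one_le_left hs0 hD1
  have hs0' : (0 : ℝ) ≤ s := by exact_mod_cast hs0
  have e : (j : ℝ) / (2 * N : ℕ) * ((D * s : ℤ) : ℝ) =
      ((D : ℝ) * (j / (2 * N : ℕ)) - b) * s + ((b * s : ℤ) : ℝ) := by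
    push_cast
    ring
  set β := (D : ℝ) * (j / (2 * N : ℕ)) - b
  have hβ : |β * s| ≤ 1 / 4 := by
    rw [abs_mul, abs_of_nonneg hs0']
    refine le_trans (mul_le_mul hb hst hs0' (by positivity)) htN
  rw [abs_le] at hβ
  rw [e, expi_add_int, expi_re]
  apply Real.cos_nonneg_of_neg_pi_div_two_le_of_le <;> nlinarith [Real.pi_pos]

set_option maxHeartbeats 1000000 in
lemma energy_increment_step {h : ℤ[X]} {k : ℕ} (hdeg : h.natDegree = k + 1)
    (hint : ∀ d : ℕ, 0 < d → ∃ n : ℤ, (d : ℤ) ∣ h.eval n)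
    (hnonneg : ∀ n : ℕ, 0 ≤ h.eval (n : ℤ))
    {B : ℕ} (hB : ∀ n : ℕ, 1 ≤ n → h.eval (n : ℤ) ≤ B * n ^ (k + 1))
    {c₀ : ℝ} (hc₀ : 0 < c₀) {n₀ : ℕ}
    (hderiv : ∀ n : ℕ, n₀ ≤ n → c₀ * (n : ℝ) ^ k ≤ (h.derivative.eval (n : ℤ) : ℤ))
    (hRR : ∀ (A : Finset ℕ) (s : Finset ℕ),
      ∑ n ∈ s, ((h.derivative.eval (n : ℤ) : ℤ) : ℝ) * (rCount h n A : ℝ) ≤ RR h A)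
    {δ : ℝ} (hδ : 0 < δ) {D : ℕ} (hD : 0 < D) {K : ℝ} (hK : 0 < K) :
    ∃ D' : ℕ, 0 < D' ∧ ∃ K' : ℝ, 0 < K' ∧ ∃ c : ℝ, 0 < c ∧ ∃ N₀ : ℕ, ∀ N : ℕ, N₀ ≤ N →
      ∀ A : Finset ℕ, A ⊆ Finset.Icc 1 N → δ * (N : ℝ) ≤ (A.card : ℝ) →
        c * (A.card : ℝ) ^ 2 ≤ RR h A ∨
        energyOn N A (IsMajor D K N) + δ / 8 * A.card ≤ energyOn N A (IsMajor D' K' N) := by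
  obtain ⟨D₁, hD₁, K₁, hK₁, L₁, hW⟩ := weyl_inequality k (δ / 8) (by positivity)
  obtain ⟨z, hz⟩ := hint D hD
  obtain ⟨r, hr⟩ : ∃ r : ℕ, (r : ℤ) = z % D :=
    ⟨(z % D).toNat, Int.toNat_of_nonneg (Int.emod_nonneg _ (by omega))⟩
  have hrD : r < D := by
    have := Int.emod_lt_of_pos z (b := D) (by omega)
    omega
  have hrdvd : ∀ n : ℕ, (D : ℤ) ∣ h.eval ((D * n + r : ℕ) : ℤ) := by
    intro n
    have h1 : (D : ℤ) ∣ ((D * n + r : ℕ) : ℤ) - z := by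
      refine ⟨n - z / D, ?_⟩
      have := Int.emod_add_mul_ediv z D
      push_cast
      rw [hr]
      linarith
    have h2 := h1.trans (sub_dvd_eval_sub _ z h)
    exact (Int.dvd_iff_dvd_of_dvd_sub h2).2 hz
  set a : ℤ := h.leadingCoeff with ha
  have ha0 : a ≠ 0 := by
    rw [ha, Ne, leadingCoeff_eq_zero]
    rintro rfl
    simp at hdeg
  set Kn : ℕ := ⌈K⌉₊ + 1 with hKn
  have hKKn : K ≤ Kn := by
    rw [hKn]
    push_cast
    linarith [Nat.le_ceil K]
  set E : ℕ := (B + 1) * (3 * D) ^ (k + 1) * (4 * Kn) with hE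
  have hE0 : 0 < E := by positivity
  have hE0' : (0 : ℝ) < E := by exact_mod_cast hE0
  have ha0' : (0 : ℝ) < |(a : ℝ)| := by positivity
  obtain ⟨N₁, hN₁⟩ := exists_scale E (k + 1) (max L₁ (max n₀ 1)) hE0 (Nat.succ_ne_zero k)
  set D' : ℕ := D₁ * D ^ (k + 1) * (k + 1).factorial * (a.natAbs ^ 2) * D with hD'
  have hD'0 : 0 < D' := by
    have := Int.natAbs_pos.2 ha0
    positivity
  have hD'R : (0 : ℝ) < D' := by exact_mod_cast hD'0
  have hDR : (0 : ℝ) < D := by exact_mod_cast hD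
  set K' : ℝ := |(a : ℝ)| * D * (K₁ * (E * 2 ^ (k + 1))) + D' * K with hK'
  refine ⟨D', hD'0, K', by positivity, c₀ * δ / (4 * (E * 2 ^ (k + 1))), by positivity,
    max N₁ 1, ?_⟩
  intro N hN A hA hAδ
  have hN0 : 0 < N := lt_of_lt_of_le one_pos ((le_max_right _ _).trans hN)
  have hNR : (0 : ℝ) < N := by exact_mod_cast hN0
  obtain ⟨L, hL, hEL, hNL⟩ := hN₁ N ((le_max_left _ _).trans hN)
  have hLL₁ : L₁ ≤ L := (le_max_left _ _).trans hL
  have hLn₀ : n₀ ≤ L := (le_max_left _ _).trans ((le_max_right _ _).trans hL)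
  have hL1 : 1 ≤ L := (le_max_right _ _).trans ((le_max_right _ _).trans hL)
  have hLR : (1 : ℝ) ≤ L := by exact_mod_cast hL1
  have hNle : (N : ℝ) ≤ E * 2 ^ (k + 1) * (L : ℝ) ^ (k + 1) := by
    have h1 : N ≤ E * (2 * L) ^ (k + 1) := by
      refine hNL.le.trans (Nat.mul_le_mul_left _ (Nat.pow_le_pow_left (by omega) _))
    have h2 : (N : ℝ) ≤ E * (2 * L) ^ (k + 1) := by exact_mod_cast h1
    rwa [mul_pow, ← mul_assoc] at h2
  rw [or_iff_not_imp_right, not_le]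
  intro hinc
  set ν : ℕ → ℕ := fun m => D * (m + L) + r with hν
  set t : ℕ → ℤ := fun m => h.eval (ν m : ℤ) with ht
  have ht0 : ∀ m, 0 ≤ t m := fun m => hnonneg _
  have hνL : ∀ m, L ≤ ν m := fun m => by
    have : m + L ≤ D * (m + L) := Nat.le_mul_of_pos_left _ hD
    rw [hν]
    dsimp only
    omega
  have ht4 : ∀ m < L, (4 * Kn : ℤ) * t m ≤ N := by
    intro m hm
    have h1 : ν m ≤ 3 * D * L := by
      have h2 : D * (m + L) ≤ D * (2 * L) := Nat.mul_le_mul_left _ (by omega)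
      have h3 : D ≤ D * L := Nat.le_mul_of_pos_right _ hL1
      have h4 : ν m = D * (m + L) + r := rfl
      nlinarith
    have h2 : t m ≤ (((B + 1) * (3 * D * L) ^ (k + 1) : ℕ) : ℤ) := by
      refine (hB (ν m) (hL1.trans (hνL m))).trans ?_
      exact_mod_cast Nat.mul_le_mul (Nat.le_succ B) (Nat.pow_le_pow_left h1 _)
    have h3 : (4 * Kn) * ((B + 1) * (3 * D * L) ^ (k + 1)) = E * L ^ (k + 1) := by
      rw [hE, mul_pow (3 * D) L]
      ring
    calc (4 * Kn : ℤ) * t m ≤ (4 * Kn : ℤ) * (((B + 1) * (3 * D * L) ^ (k + 1) : ℕ) : ℤ) :=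
          mul_le_mul_of_nonneg_left h2 (by positivity)
      _ = ((E * L ^ (k + 1) : ℕ) : ℤ) := by rw [← h3]; push_cast; ring
      _ ≤ N := by exact_mod_cast hEL
  have htN : ∀ m < L, t m ≤ N := by
    intro m hm
    have h1 := ht4 m hm
    have h2 := ht0 m
    have h3 : (1 : ℤ) ≤ 4 * Kn := by rw [hKn]; push_cast; omega
    nlinarith
  have hmain := le_sum_card_of_energy hN0 hA (L := L) (t := t) (fun m _ => ht0 m) htN
    (P := IsMajor D K N) (P' := IsMajor D' K' N) (η := δ / 8) (by positivity)
    ⟨0, by simp; positivity⟩ (by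
      rintro j ⟨b, hb⟩
      refine ⟨(D₁ * D ^ (k + 1) * (k + 1).factorial * (a.natAbs ^ 2) : ℕ) * b, ?_⟩
      set q : ℕ := D₁ * D ^ (k + 1) * (k + 1).factorial * (a.natAbs ^ 2) with hq
      have e : (D' : ℝ) * (j / (2 * N : ℕ)) - ((q * b : ℤ) : ℝ) =
          q * (D * (j / (2 * N : ℕ)) - b) := by
        rw [hD']
        push_cast
        ring
      have hqD : (q : ℝ) ≤ D' := by
        exact_mod_cast Nat.le_mul_of_pos_right q hD
      rw [e, abs_mul, Nat.abs_cast]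
      calc (q : ℝ) * |(D : ℝ) * (j / (2 * N : ℕ)) - b| ≤ D' * (K / N) :=
            mul_le_mul hqD hb (abs_nonneg _) hD'R.le
        _ = D' * K / N := by ring
        _ ≤ K' / N := by
            refine div_le_div_of_nonneg_right ?_ hNR.le
            rw [hK']
            have : 0 ≤ |(a : ℝ)| * D * (K₁ * (E * 2 ^ (k + 1))) := by positivity
            linarith)
    (by
      intro j hj m hm
      refine cos_nonneg_of_isMajor hj hD hK.le (ht0 m) (hrdvd (m + L)) ?_
      have h1 : ((4 * Kn : ℤ) : ℝ) * t m ≤ (N : ℤ) := by exact_mod_cast ht4 m hm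
      have h2 : (0 : ℝ) ≤ t m := by exact_mod_cast ht0 m
      push_cast at h1
      rw [div_mul_eq_mul_div, div_le_iff₀ hNR]
      nlinarith)
    (by
      intro j hj
      by_contra hc
      push Not at hc
      apply hj
      set α : ℝ := j / (2 * N : ℕ) with hα
      obtain ⟨b, hb⟩ := hW L hLL₁
        (fun y => α * (h.map (Int.castRingHom ℝ)).eval (D * y + (D * L + r)))
        (α * (a * D ^ (k + 1) * (k + 1).factorial))
        (fun x => by
          have := fwdDiff_iter_const_mul_comp_linear h hD α (D * L + r) x
          rw [hdeg] at this
          exact this) (by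
          refine hc.le.trans (le_of_eq ?_)
          congr 1
          refine Finset.sum_congr rfl fun m _ => ?_
          congr 2
          have h1 : (D : ℝ) * m + (D * L + r) = Int.castRingHom ℝ (ν m : ℤ) := by
            rw [hν, eq_intCast]
            push_cast
            ring
          rw [h1, eval_map_apply, eq_intCast])
      refine ⟨a * D * b, ?_⟩
      have e : (D' : ℝ) * α - ((a * D * b : ℤ) : ℝ) =
          a * D * (D₁ * (α * (a * D ^ (k + 1) * (k + 1).factorial)) - b) := by
        rw [hD']
        have : ((a.natAbs : ℕ) : ℝ) ^ 2 = (a : ℝ) ^ 2 := by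
          rw [Nat.cast_natAbs, Int.cast_abs, sq_abs]
        push_cast
        rw [this]
        ring
      rw [e, abs_mul, abs_mul, Nat.abs_cast]
      calc |(a : ℝ)| * D * |D₁ * (α * (a * D ^ (k + 1) * (k + 1).factorial)) - b|
          ≤ |(a : ℝ)| * D * (K₁ * (E * 2 ^ (k + 1)) / N) := by
            refine mul_le_mul_of_nonneg_left (hb.trans ?_) (by positivity)
            rw [div_le_div_iff₀ (by positivity) hNR, mul_assoc K₁]
            exact mul_le_mul_of_nonneg_left hNle hK₁.le
        _ = |(a : ℝ)| * D * (K₁ * (E * 2 ^ (k + 1))) / N := by ring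
        _ ≤ K' / N := by
            refine div_le_div_of_nonneg_right ?_ hNR.le
            rw [hK']
            have : 0 ≤ D' * K := by positivity
            linarith)
  have hcount : (L : ℝ) * (δ / 4 * A.card) ≤ ∑ m ∈ Finset.range L, (rCount h (ν m) A : ℝ) := by
    refine le_trans (mul_le_mul_of_nonneg_left ?_ (by positivity)) hmain
    have h1 : δ / 2 * A.card ≤ (A.card : ℝ) ^ 2 / (2 * N) := by
      rw [le_div_iff₀ (by positivity)]
      nlinarith [Nat.cast_nonneg (α := ℝ) A.card]
    linarith
  have hinj : Set.InjOn ν (Finset.range L) := by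
    intro m _ m' _ hmm
    have h1 : D * (m + L) + r = D * (m' + L) + r := hmm
    have h2 := Nat.eq_of_mul_eq_mul_left hD (Nat.add_right_cancel h1)
    omega
  have hAN : (A.card : ℝ) ≤ N := by
    have := Finset.card_le_card hA
    rw [Nat.card_Icc, Nat.add_sub_cancel] at this
    exact_mod_cast this
  calc c₀ * δ / (4 * (E * 2 ^ (k + 1))) * (A.card : ℝ) ^ 2
      = c₀ * (δ / 4 * A.card) * (A.card / (E * 2 ^ (k + 1))) := by field_simp
    _ ≤ c₀ * (δ / 4 * A.card) * (L : ℝ) ^ (k + 1) := by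
        refine mul_le_mul_of_nonneg_left ?_ (by positivity)
        rw [div_le_iff₀ (by positivity)]
        linarith
    _ = c₀ * (L : ℝ) ^ k * (L * (δ / 4 * A.card)) := by ring
    _ ≤ c₀ * (L : ℝ) ^ k * ∑ m ∈ Finset.range L, (rCount h (ν m) A : ℝ) :=
        mul_le_mul_of_nonneg_left hcount (by positivity)
    _ ≤ ∑ m ∈ Finset.range L,
          ((h.derivative.eval (ν m : ℤ) : ℤ) : ℝ) * (rCount h (ν m) A : ℝ) := by
        rw [Finset.mul_sum]
        refine Finset.sum_le_sum fun m _ => mul_le_mul_of_nonneg_right ?_ (Nat.cast_nonneg _)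
        refine le_trans ?_ (hderiv (ν m) (hLn₀.trans (hνL m)))
        refine mul_le_mul_of_nonneg_left (pow_le_pow_left₀ (by positivity) ?_ _) hc₀.le
        exact_mod_cast hνL m
    _ = ∑ n ∈ (Finset.range L).image ν,
          ((h.derivative.eval (n : ℤ) : ℤ) : ℝ) * (rCount h n A : ℝ) :=
        by rw [Finset.sum_image hinj]
    _ ≤ RR h A := hRR A _

lemma eval_natCast_map (h : ℤ[X]) (n : ℕ) :
    (h.map (Int.castRingHom ℝ)).eval (n : ℝ) = (h.eval (n : ℤ) : ℤ) := by
  simpa only [eq_intCast, Int.cast_natCast] using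
    eval_map_apply (f := Int.castRingHom ℝ) (p := h) (n : ℤ)

lemma exists_eval_le_mul_pow (h : ℤ[X]) :
    ∃ B : ℕ, ∀ n : ℕ, 1 ≤ n → h.eval (n : ℤ) ≤ B * n ^ h.natDegree := by
  refine ⟨∑ i ∈ Finset.range (h.natDegree + 1), (h.coeff i).natAbs, fun n hn => ?_⟩
  rw [eval_eq_sum_range]
  push_cast
  rw [Finset.sum_mul]
  refine Finset.sum_le_sum fun i hi => ?_
  have h1 : (1 : ℤ) ≤ n := by exact_mod_cast hn
  have hi' := Finset.mem_range.1 hi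
  exact mul_le_mul (le_abs_self _) (pow_le_pow_right₀ h1 (by omega)) (by positivity) (abs_nonneg _)

lemma exists_mul_pow_le_derivative {h : ℤ[X]} {k : ℕ} (hdeg : h.natDegree = k + 1)
    (hpos : ∀ n : ℕ, 0 ≤ h.derivative.eval (n : ℤ)) :
    ∃ c : ℝ, 0 < c ∧ ∃ n₀ : ℕ, ∀ n : ℕ, n₀ ≤ n →
      c * (n : ℝ) ^ k ≤ (h.derivative.eval (n : ℤ) : ℤ) := by
  have h1 : (X ^ k : ℝ[X]).degree ≤ (h.derivative.map (Int.castRingHom ℝ)).degree := by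
    rw [degree_X_pow, degree_map_eq_of_injective (RingHom.injective_int _),
      degree_derivative (by omega), hdeg]
    simp
  obtain ⟨C, hC, hCb⟩ := (isBigO_atTop_of_degree_le _ _ h1).exists_pos
  have h2 := tendsto_natCast_atTop_atTop (R := ℝ) |>.eventually hCb.bound
  obtain ⟨n₀, hn₀⟩ := Filter.eventually_atTop.1 h2
  refine ⟨1 / C, by positivity, n₀, fun n hn => ?_⟩
  have h3 := hn₀ n hn
  have h4 : (0 : ℝ) ≤ (h.derivative.eval (n : ℤ) : ℤ) := by exact_mod_cast hpos n
  rw [eval_natCast_map, Real.norm_of_nonneg h4, eval_pow, eval_X,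
    Real.norm_of_nonneg (by positivity)] at h3
  rw [one_div, inv_mul_le_iff₀ hC]
  exact h3

lemma sum_le_RR {h : ℤ[X]} (hle : ∀ n : ℕ, (n : ℤ) ≤ h.eval (n : ℤ))
    (hpos : ∀ n : ℕ, 0 ≤ h.derivative.eval (n : ℤ)) (A s : Finset ℕ) :
    ∑ n ∈ s, ((h.derivative.eval (n : ℤ) : ℤ) : ℝ) * (rCount h n A : ℝ) ≤ RR h A := by
  have hnn : ∀ n : ℕ, 0 ≤ ((h.derivative.eval (n : ℤ) : ℤ) : ℝ) * (rCount h n A : ℝ) := fun n =>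
    mul_nonneg (by exact_mod_cast hpos n) (Nat.cast_nonneg _)
  refine Summable.sum_le_tsum s (fun n _ => hnn n) ?_
  refine summable_of_ne_finset_zero (s := Finset.range (A.sup id + 1)) fun n hn => ?_
  have : rCount h n A = 0 := by
    rw [rCount, Finset.card_eq_zero, Finset.filter_eq_empty_iff]
    intro p hp he
    have h1 : p.1 ≤ A.sup id := Finset.le_sup (f := id) (Finset.mem_product.1 hp).1
    have h2 := hle n
    rw [Finset.mem_range] at hn
    omega
  rw [this, Nat.cast_zero, mul_zero]

/-- **Lucier's theorem (Theorem 5 of Lucier).** If `h ∈ ℤ[x]` is an intersective polynomial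
of degree `k ≥ 2`, with `h` and `h'` positive and increasing for `x ≥ 0`, then for every
`δ > 0` there is a constant `c(h, δ) > 0` such that for all sufficiently large `N`, every
`A ⊆ {1, …, N}` with `|A| ≥ δN` satisfies `R(A, h) ≥ c(h, δ)|A|²`. -/
theorem lucier_count (h : Polynomial ℤ) (k : ℕ) (hk : 2 ≤ k) (hdeg : h.natDegree = k)
    (hint : ∀ d : ℕ, 0 < d → ∃ n : ℤ, (d : ℤ) ∣ h.eval n)
    (hpos : ∀ x : ℝ, 0 ≤ x → 0 < (h.map (Int.castRingHom ℝ)).eval x)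
    (hmono : StrictMonoOn (fun x => (h.map (Int.castRingHom ℝ)).eval x) (Set.Ici 0))
    (hpos' : ∀ x : ℝ, 0 ≤ x → 0 < ((h.map (Int.castRingHom ℝ)).derivative).eval x)
    (hmono' : StrictMonoOn (fun x => ((h.map (Int.castRingHom ℝ)).derivative).eval x)
      (Set.Ici 0))
    (δ : ℝ) (hδ : 0 < δ) :
    ∃ c : ℝ, 0 < c ∧ ∃ N₀ : ℕ, ∀ N : ℕ, N₀ ≤ N →
      ∀ A : Finset ℕ, A ⊆ Finset.Icc 1 N → δ * (N : ℝ) ≤ (A.card : ℝ) →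
        c * (A.card : ℝ) ^ 2 ≤ RR h A := by
  obtain ⟨k, rfl⟩ : ∃ l, k = l + 1 := ⟨k - 1, by omega⟩
  have hpos₁ : ∀ n : ℕ, 0 < h.eval (n : ℤ) := fun n => by
    have := hpos n (Nat.cast_nonneg n)
    rw [eval_natCast_map] at this
    exact_mod_cast this
  have hpos₂ : ∀ n : ℕ, 0 ≤ h.derivative.eval (n : ℤ) := fun n => by
    have := hpos' n (Nat.cast_nonneg n)
    rw [derivative_map, eval_natCast_map] at this
    exact_mod_cast this.le
  have hle : ∀ n : ℕ, (n : ℤ) ≤ h.eval (n : ℤ) := by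
    intro n
    induction n with
    | zero => exact (hpos₁ 0).le
    | succ n ih =>
      have h1 : h.eval (n : ℤ) < h.eval ((n + 1 : ℕ) : ℤ) := by
        have := hmono (Set.mem_Ici.2 (Nat.cast_nonneg n))
          (Set.mem_Ici.2 (Nat.cast_nonneg (n + 1))) (by exact_mod_cast n.lt_succ_self)
        dsimp only at this
        rw [eval_natCast_map, eval_natCast_map] at this
        exact_mod_cast this
      push_cast at h1 ⊢
      omega
  obtain ⟨B, hB⟩ := exists_eval_le_mul_pow h
  rw [hdeg] at hB
  obtain ⟨c₀, hc₀, n₀, hn₀⟩ := exists_mul_pow_le_derivative hdeg hpos₂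
  have hiter : ∀ J : ℕ, ∃ D : ℕ, 0 < D ∧ ∃ K : ℝ, 0 < K ∧ ∃ c : ℝ, 0 < c ∧ ∃ N₀ : ℕ, ∀ N : ℕ,
      N₀ ≤ N → ∀ A : Finset ℕ, A ⊆ Finset.Icc 1 N → δ * (N : ℝ) ≤ (A.card : ℝ) →
        c * (A.card : ℝ) ^ 2 ≤ RR h A ∨
        J * (δ / 8 * A.card) ≤ energyOn N A (IsMajor D K N) := by
    intro J
    induction J with
    | zero =>
      refine ⟨1, one_pos, 1, one_pos, 1, one_pos, 0, fun N _ A _ _ => Or.inr ?_⟩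
      rw [Nat.cast_zero, zero_mul]
      exact energyOn_nonneg N A _
    | succ J ih =>
      obtain ⟨D, hD, K, hK, c, hc, N₀, hN₀⟩ := ih
      obtain ⟨D', hD', K', hK', c', hc', N₁, hN₁⟩ := energy_increment_step hdeg hint
        (fun n => (hpos₁ n).le) hB hc₀ hn₀ (sum_le_RR hle hpos₂) hδ hD hK
      refine ⟨D', hD', K', hK', min c c', lt_min hc hc', max N₀ N₁, fun N hN A hA hAδ => ?_⟩
      rcases hN₀ N ((le_max_left _ _).trans hN) A hA hAδ with h1 | h1
      · exact Or.inl ((mul_le_mul_of_nonneg_right (min_le_left _ _) (sq_nonneg _)).trans h1)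
      rcases hN₁ N ((le_max_right _ _).trans hN) A hA hAδ with h2 | h2
      · exact Or.inl ((mul_le_mul_of_nonneg_right (min_le_right _ _) (sq_nonneg _)).trans h2)
      · refine Or.inr ?_
        push_cast
        linarith
  obtain ⟨J, hJ⟩ := exists_nat_gt (8 / δ)
  obtain ⟨D, -, K, -, c, hc, N₀, hN₀⟩ := hiter J
  refine ⟨c, hc, max N₀ 1, fun N hN A hA hAδ => ?_⟩
  have hN0 : 0 < N := lt_of_lt_of_le one_pos ((le_max_right _ _).trans hN)
  rcases hN₀ N ((le_max_left _ _).trans hN) A hA hAδ with h1 | h1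
  · exact h1
  exfalso
  have h2 := h1.trans (energyOn_le_card hN0 hA _)
  have hA0 : (0 : ℝ) < A.card := lt_of_lt_of_le (by positivity) hAδ
  rw [div_lt_iff₀ hδ] at hJ
  nlinarith
end

section
/- Let h ∈ ℤ[x] be an intersective polynomial of degree k ≥ 2, and for each positive integer d let h_d be the auxiliary polynomial h_d(x) = h(r_d + d·x)/λ(d). Then for every positive integer d, λ(d) divides every coefficient of the polynomial x ↦ h(r_d + d·x), so that h_d has integer coefficients; h_d has degree k; and h_d is itself intersective (for every positive integer q there exists n ∈ ℤ with q ∣ h_d(n)). -/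
open Polynomial

/-- An integer divisibility may be checked in `ℤ_[p]` for every prime `p`. -/
theorem Int.dvd_of_forall_padicInt_dvd {a b : ℤ}
    (hab : ∀ (p : ℕ) [Fact p.Prime], (a : ℤ_[p]) ∣ (b : ℤ_[p])) : a ∣ b := by
  rw [← Int.natAbs_dvd_natAbs, Nat.dvd_iff_prime_pow_dvd_dvd]
  intro p e hp hpa
  have : Fact p.Prime := ⟨hp⟩
  have hpa' : ((p ^ e : ℕ) : ℤ) ∣ a := Int.natCast_dvd.2 hpa
  rw [← Int.natCast_dvd]
  push_cast at hpa' ⊢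
  rw [← PadicInt.pow_p_dvd_int_iff] at hpa' ⊢
  exact hpa'.trans (hab p)

/-- An integer polynomial with a root in `ℤ_[p]` for every prime `p` is intersective. -/
theorem Polynomial.exists_dvd_eval_of_forall_padicInt_root (f : ℤ[X])
    (hf : ∀ (p : ℕ) [Fact p.Prime], ∃ w : ℤ_[p], (f.map (Int.castRingHom ℤ_[p])).eval w = 0)
    (q : ℕ) (hq : 0 < q) : ∃ n : ℤ, (q : ℤ) ∣ f.eval n := by
  induction q using Nat.recOnPosPrimePosCoprime with
  | zero => exact absurd hq (lt_irrefl 0)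
  | one => exact ⟨0, by simp⟩
  | prime_pow p e hp _ =>
    have : Fact p.Prime := ⟨hp⟩
    obtain ⟨w, hw⟩ := hf p
    refine ⟨(w.appr e : ℤ), ?_⟩
    push_cast
    rw [← PadicInt.pow_p_dvd_int_iff]
    have happr := Ideal.mem_span_singleton.1 (PadicInt.appr_spec e w)
    have hsub := sub_dvd_eval_sub w (w.appr e : ℤ_[p]) (f.map (Int.castRingHom ℤ_[p]))
    rw [hw, zero_sub, dvd_neg] at hsub
    have heval : (f.map (Int.castRingHom ℤ_[p])).eval (w.appr e : ℤ_[p])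
        = ((f.eval (w.appr e : ℤ) : ℤ) : ℤ_[p]) := by simp
    rw [← heval]
    exact happr.trans hsub
  | coprime a b ha hb hab iha ihb =>
    obtain ⟨x, hx⟩ := iha (by lia)
    obtain ⟨y, hy⟩ := ihb (by lia)
    have hcop : IsCoprime (a : ℤ) (b : ℤ) := Nat.isCoprime_iff_coprime.2 hab
    obtain ⟨u, v, huv⟩ := id hcop
    refine ⟨x * (v * b) + y * (u * a), ?_⟩
    push_cast
    refine hcop.mul_dvd ?_ ?_
    · refine (dvd_iff_dvd_of_dvd_sub ?_).1 hx
      refine dvd_trans ⟨u * (x - y), ?_⟩ (sub_dvd_eval_sub x _ f)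
      linear_combination -x * huv
    · refine (dvd_iff_dvd_of_dvd_sub ?_).1 hy
      refine dvd_trans ⟨v * (y - x), ?_⟩ (sub_dvd_eval_sub y _ f)
      linear_combination -y * huv

theorem PadicInt.isUnit_natCast_of_not_dvd {p : ℕ} [hp : Fact p.Prime] {n : ℕ} (hn : ¬ p ∣ n) :
    IsUnit (n : ℤ_[p]) := by
  rw [PadicInt.isUnit_iff]
  refine le_antisymm (PadicInt.norm_le_one _) (not_lt.1 fun hlt => hn ?_)
  have := (PadicInt.norm_int_lt_one_iff_dvd (p := p) (n : ℤ)).1 (by simpa using hlt)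
  exact_mod_cast this

/-- A completely multiplicative `lam` with `lam q = q ^ m q` at primes agrees with `d ↦ d ^ m p`
up to units of `ℤ_[p]`. -/
theorem PadicInt.associated_natCast_pow_of_completelyMultiplicative
    (m : ∀ (p : ℕ) [Fact p.Prime], ℕ) (lam : ℕ → ℕ) (hlam1 : lam 1 = 1)
    (hlammul : ∀ a b : ℕ, lam (a * b) = lam a * lam b)
    (hlamp : ∀ (p : ℕ) [Fact p.Prime], lam p = p ^ m p)
    (p : ℕ) [hp : Fact p.Prime] (d : ℕ) (hd : d ≠ 0) :
    Associated (lam d : ℤ_[p]) ((d : ℤ_[p]) ^ m p) := by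
  induction d using induction_on_primes with
  | zero => exact absurd rfl hd
  | one => simp [hlam1]
  | prime_mul q a hq ih =>
    have : Fact q.Prime := ⟨hq⟩
    rw [hlammul]
    push_cast
    rw [mul_pow]
    refine Associated.mul_mul ?_ (ih (right_ne_zero_of_mul hd))
    by_cases hpq : p = q
    · subst hpq
      simp [hlamp p]
    · have hu : IsUnit (q : ℤ_[p]) :=
        isUnit_natCast_of_not_dvd fun h => hpq ((Nat.prime_dvd_prime_iff_eq hp.out hq).1 h)
      rw [hlamp q]
      push_cast
      exact associated_of_dvd_dvd (hu.pow _).dvd (hu.pow _).dvd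

theorem PadicInt.natCast_dvd_of_pow_factorization_dvd {p : ℕ} [hp : Fact p.Prime] {d : ℕ}
    (hd : d ≠ 0) {x : ℤ_[p]} (hx : p ∣ d → (p : ℤ_[p]) ^ d.factorization p ∣ x) :
    (d : ℤ_[p]) ∣ x := by
  by_cases hpd : p ∣ d
  · have hu : IsUnit ((d / p ^ d.factorization p : ℕ) : ℤ_[p]) :=
      isUnit_natCast_of_not_dvd (Nat.not_dvd_ordCompl hp.out hd)
    rw [← Nat.ordProj_mul_ordCompl_eq_self d p, Nat.cast_mul, hu.mul_right_dvd, Nat.cast_pow]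
    exact hx hpd
  · exact (isUnit_natCast_of_not_dvd hpd).dvd

/-- If `d ∣ r - z`, substituting `r + d X` makes every coefficient divisible by `d` to the
multiplicity of the root `z`. -/
theorem Polynomial.C_pow_rootMultiplicity_dvd_comp {R : Type*} [CommRing R] (f : R[X])
    {r d z : R} (hd : d ∣ r - z) :
    C (d ^ f.rootMultiplicity z) ∣ f.comp (C r + C d * X) := by
  obtain ⟨g, hg⟩ := pow_rootMultiplicity_dvd f z
  obtain ⟨t, ht⟩ := hd
  have hlin : (X - C z).comp (C r + C d * X) = C d * (X + C t) := by
    rw [sub_comp, X_comp, C_comp, mul_add, ← C_mul, ← ht, C_sub]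
    ring
  conv_rhs => rw [hg]
  rw [mul_comp, pow_comp, hlin, mul_pow, C_pow, mul_assoc]
  exact dvd_mul_right _ _

/-- **Auxiliary polynomials (Lucier).** Let `h ∈ ℤ[x]` be intersective of degree `k ≥ 2`.
For each prime `p` fix a root `z p ∈ ℤ_p` of `h`, let `m p` be its multiplicity, let
`λ` be the completely multiplicative function with `λ(p) = p^{m p}`, and for each `d > 0`
let `r d` be the integer with `-d < r d ≤ 0` congruent to `z p` mod `p^{v_p(d)} ℤ_p` for
each prime `p ∣ d`.  Then `λ(d)` divides every coefficient of `x ↦ h(r_d + d·x)`, the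
auxiliary polynomial `h_d(x) = h(r_d + d·x)/λ(d)` has integer coefficients and degree `k`,
and `h_d` is itself intersective. -/
theorem auxiliary_polynomial_integral_and_intersective
    (h : Polynomial ℤ) (k : ℕ) (hk : 2 ≤ k) (hdeg : h.natDegree = k)
    (hint : ∀ d : ℕ, 0 < d → ∃ n : ℤ, (d : ℤ) ∣ h.eval n)
    (z : ∀ (p : ℕ) [Fact p.Prime], ℤ_[p])
    (hz : ∀ (p : ℕ) [Fact p.Prime], (h.map (Int.castRingHom ℤ_[p])).eval (z p) = 0)
    (m : ∀ (p : ℕ) [Fact p.Prime], ℕ)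
    (hm : ∀ (p : ℕ) [Fact p.Prime],
      (h.map (Int.castRingHom ℤ_[p])).rootMultiplicity (z p) = m p)
    (lam : ℕ → ℕ)
    (hlam1 : lam 1 = 1)
    (hlammul : ∀ a b : ℕ, lam (a * b) = lam a * lam b)
    (hlamp : ∀ (p : ℕ) [Fact p.Prime], lam p = p ^ m p)
    (r : ℕ → ℤ)
    (hr : ∀ d : ℕ, 0 < d → -(d : ℤ) < r d ∧ r d ≤ 0)
    (hrc : ∀ d : ℕ, 0 < d → ∀ (p : ℕ) [Fact p.Prime], p ∣ d →
      ((p : ℤ_[p]) ^ (d.factorization p)) ∣ ((r d : ℤ_[p]) - z p)) :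
    ∀ d : ℕ, 0 < d →
      (∀ i : ℕ, (lam d : ℤ) ∣ (h.comp (C (r d) + C (d : ℤ) * X)).coeff i) ∧
      ∃ hd : Polynomial ℤ,
        C (lam d : ℤ) * hd = h.comp (C (r d) + C (d : ℤ) * X) ∧
        hd.natDegree = k ∧
        (∀ q : ℕ, 0 < q → ∃ n : ℤ, (q : ℤ) ∣ hd.eval n) := by
  intro d hd
  have hd0 : d ≠ 0 := hd.ne'
  have hassoc (p : ℕ) [Fact p.Prime] : Associated (lam d : ℤ_[p]) ((d : ℤ_[p]) ^ m p) :=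
    PadicInt.associated_natCast_pow_of_completelyMultiplicative m lam hlam1 hlammul hlamp p d hd0
  have hdvd (p : ℕ) [Fact p.Prime] : (d : ℤ_[p]) ∣ (r d : ℤ_[p]) - z p :=
    PadicInt.natCast_dvd_of_pow_factorization_dvd hd0 (hrc d hd p)
  have hlam0 (p : ℕ) [Fact p.Prime] : (lam d : ℤ_[p]) ≠ 0 :=
    (hassoc p).ne_zero_iff.2 (pow_ne_zero _ (Nat.cast_ne_zero.2 hd0))
  have hlamd0 : (lam d : ℤ) ≠ 0 := by
    have : Fact (Nat.Prime 2) := ⟨Nat.prime_two⟩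
    exact_mod_cast Nat.cast_ne_zero.1 (hlam0 2)
  have hmap (p : ℕ) [Fact p.Prime] :
      (h.comp (C (r d) + C (d : ℤ) * X)).map (Int.castRingHom ℤ_[p])
        = (h.map (Int.castRingHom ℤ_[p])).comp (C (r d : ℤ_[p]) + C (d : ℤ_[p]) * X) := by
    simp [Polynomial.map_comp]
  have hcoeff (i : ℕ) : (lam d : ℤ) ∣ (h.comp (C (r d) + C (d : ℤ) * X)).coeff i := by
    refine Int.dvd_of_forall_padicInt_dvd fun p _ => ?_
    have hC := C_pow_rootMultiplicity_dvd_comp (h.map (Int.castRingHom ℤ_[p])) (hdvd p)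
    rw [hm p, ← hmap p] at hC
    have hi := C_dvd_iff_dvd_coeff _ _ |>.1 hC i
    rw [coeff_map, eq_intCast] at hi
    rw [Int.cast_natCast]
    exact (hassoc p).dvd.trans hi
  refine ⟨hcoeff, ?_⟩
  obtain ⟨g, hg⟩ := (C_dvd_iff_dvd_coeff _ _).2 hcoeff
  refine ⟨g, hg.symm, ?_, exists_dvd_eval_of_forall_padicInt_root g fun p _ => ?_⟩
  · have hnat := congrArg natDegree hg
    rw [natDegree_C_mul hlamd0, natDegree_comp, hdeg, add_comm (C (r d)),
      natDegree_linear (Nat.cast_ne_zero.2 hd0), mul_one] at hnat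
    exact hnat.symm
  · obtain ⟨t, ht⟩ := hdvd p
    refine ⟨-t, (mul_eq_zero.1 ?_).resolve_left (hlam0 p)⟩
    have heval := congrArg (fun f => (f.map (Int.castRingHom ℤ_[p])).eval (-t)) hg
    simp only [hmap p, Polynomial.map_mul, map_C] at heval
    simp only [eval_comp, eval_mul, eval_add, eval_C, eval_X, eq_intCast,
      Int.cast_natCast] at heval
    rw [← heval, show (r d : ℤ_[p]) + d * -t = z p by linear_combination ht]
    exact hz p
end

section
/- If A ⊆ ℤ⁺ has positive upper density (i.e., limsup_{N→∞} |A ∩ {1,…,N}|/N > 0), then there exist two distinct elements a, a' ∈ A whose difference a − a' is a perfect square. -/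
open Filter

/-- The upper density of a set `A ⊆ ℕ`: `limsup_{N → ∞} |A ∩ {1, …, N}| / N`. -/
noncomputable def upperDensity (A : Set ℕ) : ℝ :=
  limsup (fun N : ℕ => (Nat.card ↥(A ∩ Set.Icc 1 N) : ℝ) / (N : ℝ)) atTop

section Hilbert

open Finset Topology

variable {E : Type*} [NormedAddCommGroup E] [InnerProductSpace ℝ E]

/-- Translating a bounded sequence changes its partial sums by a bounded amount. -/
lemma norm_sum_range_add_sub_le {F : Type*} [SeminormedAddCommGroup F] {y : ℕ → F} {C : ℝ}
    (hC : ∀ n, ‖y n‖ ≤ C) (i N : ℕ) :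
    ‖∑ n ∈ range N, y (n + i) - ∑ n ∈ range N, y n‖ ≤ i * (2 * C) := by
  induction i with
  | zero => simp
  | succ i ih =>
    have h : ∑ n ∈ range N, y (n + (i + 1)) - ∑ n ∈ range N, y (n + i) = y (N + i) - y i := by
      rw [← sum_sub_distrib]
      simpa [add_right_comm, add_assoc] using sum_range_sub (fun n => y (n + i)) N
    calc ‖∑ n ∈ range N, y (n + (i + 1)) - ∑ n ∈ range N, y n‖
        = ‖(y (N + i) - y i) + (∑ n ∈ range N, y (n + i) - ∑ n ∈ range N, y n)‖ := by
          rw [← h, sub_add_sub_cancel]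
      _ ≤ (‖y (N + i)‖ + ‖y i‖) + i * (2 * C) :=
          (norm_add_le _ _).trans (add_le_add (norm_sub_le _ _) ih)
      _ ≤ ((i + 1 : ℕ) : ℝ) * (2 * C) := by
          push_cast
          linarith [hC (N + i), hC i]

/-- Averages of a bounded sequence are asymptotically invariant under translation. -/
lemma tendsto_average_add_sub {y : ℕ → E} {C : ℝ} (hC : ∀ n, ‖y n‖ ≤ C) (i : ℕ) :
    Tendsto (fun N : ℕ => (N : ℝ)⁻¹ • ∑ n ∈ range N, y (n + i) - (N : ℝ)⁻¹ • ∑ n ∈ range N, y n)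
      atTop (𝓝 0) := by
  refine squeeze_zero_norm (a := fun N : ℕ => (N : ℝ)⁻¹ * (i * (2 * C))) (fun N => ?_) ?_
  · rw [← smul_sub, norm_smul, Real.norm_of_nonneg (by positivity)]
    gcongr
    exact norm_sum_range_add_sub_le hC i N
  · simpa using (tendsto_inv_atTop_nhds_zero_nat (𝕜 := ℝ)).mul_const (i * (2 * C))

lemma norm_average_sq_le (v : ℕ → E) (N : ℕ) :
    ‖(N : ℝ)⁻¹ • ∑ n ∈ range N, v n‖ ^ 2 ≤ (N : ℝ)⁻¹ * ∑ n ∈ range N, ‖v n‖ ^ 2 := by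
  rcases N.eq_zero_or_pos with rfl | hN
  · simp
  have hN' : (0 : ℝ) < N := by exact_mod_cast hN
  rw [norm_smul, mul_pow, Real.norm_of_nonneg (by positivity)]
  calc ((N : ℝ)⁻¹) ^ 2 * ‖∑ n ∈ range N, v n‖ ^ 2
      ≤ ((N : ℝ)⁻¹) ^ 2 * (N * ∑ n ∈ range N, ‖v n‖ ^ 2) := by
        gcongr
        calc ‖∑ n ∈ range N, v n‖ ^ 2 ≤ (∑ n ∈ range N, ‖v n‖) ^ 2 := by
              gcongr
              exact norm_sum_le _ _
          _ ≤ N * ∑ n ∈ range N, ‖v n‖ ^ 2 := by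
              simpa using sq_sum_le_card_mul_sum_sq (s := range N) (f := fun n => ‖v n‖)
    _ = (N : ℝ)⁻¹ * ∑ n ∈ range N, ‖v n‖ ^ 2 := by
        field_simp

/-- The norm of a double average of translates in terms of the correlations of the sequence. -/
lemma norm_average_average_sq_le (y : ℕ → E) (H N : ℕ) :
    ‖(H : ℝ)⁻¹ • ∑ i ∈ range H, (N : ℝ)⁻¹ • ∑ n ∈ range N, y (n + i)‖ ^ 2 ≤
      ((H : ℝ)⁻¹) ^ 2 * ∑ i ∈ range H, ∑ j ∈ range H,
        (N : ℝ)⁻¹ * ∑ n ∈ range N, inner ℝ (y (n + i)) (y (n + j)) := by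
  have hswap : (H : ℝ)⁻¹ • ∑ i ∈ range H, (N : ℝ)⁻¹ • ∑ n ∈ range N, y (n + i) =
      (N : ℝ)⁻¹ • ∑ n ∈ range N, (H : ℝ)⁻¹ • ∑ i ∈ range H, y (n + i) := by
    rw [← smul_sum, ← smul_sum, smul_comm, sum_comm]
  have hsq : ∀ n, ‖(H : ℝ)⁻¹ • ∑ i ∈ range H, y (n + i)‖ ^ 2 =
      ((H : ℝ)⁻¹) ^ 2 * ∑ i ∈ range H, ∑ j ∈ range H, inner ℝ (y (n + i)) (y (n + j)) := by
    intro n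
    rw [norm_smul, mul_pow, Real.norm_of_nonneg (by positivity), ← real_inner_self_eq_norm_sq,
      sum_inner]
    simp_rw [inner_sum]
  rw [hswap]
  refine (norm_average_sq_le _ N).trans_eq ?_
  simp_rw [hsq, ← mul_sum]
  rw [mul_left_comm, sum_comm]
  congr 2
  exact sum_congr rfl fun i _ => sum_comm

/-- **Van der Corput's inequality**, in asymptotic form: if the correlations of a bounded sequence
are eventually at most `η ^ 2`, then its averages are eventually at most `2 * η`. -/
lemma eventually_norm_average_le_of_correlation_le {y : ℕ → E} {C : ℝ} (hC : ∀ n, ‖y n‖ ≤ C)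
    {η : ℝ} (hη : 0 < η)
    (hcor : ∀ i j, i < j → ∀ᶠ N : ℕ in atTop,
      (N : ℝ)⁻¹ * ∑ n ∈ range N, inner ℝ (y (n + i)) (y (n + j)) ≤ η ^ 2) :
    ∀ᶠ N : ℕ in atTop, ‖(N : ℝ)⁻¹ • ∑ n ∈ range N, y n‖ ≤ 2 * η := by
  obtain ⟨H, hH⟩ := exists_nat_gt (C ^ 2 / η ^ 2)
  have hH0 : (0 : ℝ) < H := lt_of_le_of_lt (by positivity) hH
  have hHC : C ^ 2 ≤ H * η ^ 2 := ((div_lt_iff₀ (by positivity)).1 hH).le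
  have hpair : ∀ i j, ∀ᶠ N : ℕ in atTop,
      (N : ℝ)⁻¹ * ∑ n ∈ range N, inner ℝ (y (n + i)) (y (n + j)) ≤
        η ^ 2 + if i = j then C ^ 2 else 0 := by
    intro i j
    rcases lt_trichotomy i j with h | rfl | h
    · simpa [h.ne] using hcor i j h
    · refine Eventually.of_forall fun N => ?_
      have : ∑ n ∈ range N, inner ℝ (y (n + i)) (y (n + i)) ≤ N * C ^ 2 := by
        simpa using sum_le_card_nsmul (range N) (fun n => inner ℝ (y (n + i)) (y (n + i))) (C ^ 2)
          fun n _ => by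
            rw [real_inner_self_eq_norm_sq]
            exact pow_le_pow_left₀ (norm_nonneg _) (hC _) 2
      have hle : (N : ℝ)⁻¹ * (N * C ^ 2) ≤ C ^ 2 := by
        rw [← mul_assoc]
        exact mul_le_of_le_one_left (sq_nonneg C) inv_mul_le_one
      have := mul_le_mul_of_nonneg_left this (by positivity : (0 : ℝ) ≤ (N : ℝ)⁻¹)
      simp only [if_true]
      linarith [sq_nonneg η]
    · filter_upwards [hcor j i h] with N hN
      simpa [h.ne', real_inner_comm] using hN
  have hall : ∀ᶠ N : ℕ in atTop, ∀ i ∈ range H, ∀ j ∈ range H,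
      (N : ℝ)⁻¹ * ∑ n ∈ range N, inner ℝ (y (n + i)) (y (n + j)) ≤
        η ^ 2 + if i = j then C ^ 2 else 0 :=
    (eventually_all_finset _).2 fun i _ => (eventually_all_finset _).2 fun j _ => hpair i j
  have hdiff : Tendsto (fun N : ℕ => (H : ℝ)⁻¹ • ∑ i ∈ range H,
      ((N : ℝ)⁻¹ • ∑ n ∈ range N, y (n + i) - (N : ℝ)⁻¹ • ∑ n ∈ range N, y n)) atTop (𝓝 0) := by
    simpa using (tendsto_finsetSum (range H)
      fun i _ => tendsto_average_add_sub hC i).const_smul ((H : ℝ)⁻¹)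
  filter_upwards [hall, hdiff.norm.eventually_lt_const
    (show ‖(0 : E)‖ < η / 2 by simpa using half_pos hη)] with N hN hclose
  rw [sum_sub_distrib, smul_sub, sum_const, card_range, ← Nat.cast_smul_eq_nsmul ℝ,
    inv_smul_smul₀ hH0.ne'] at hclose
  have hB : ‖(H : ℝ)⁻¹ • ∑ i ∈ range H, (N : ℝ)⁻¹ • ∑ n ∈ range N, y (n + i)‖ ^ 2 ≤
      (3 / 2 * η) ^ 2 := by
    refine (norm_average_average_sq_le y H N).trans ?_
    calc ((H : ℝ)⁻¹) ^ 2 * ∑ i ∈ range H, ∑ j ∈ range H,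
          (N : ℝ)⁻¹ * ∑ n ∈ range N, inner ℝ (y (n + i)) (y (n + j))
        ≤ ((H : ℝ)⁻¹) ^ 2 * ∑ i ∈ range H, ∑ j ∈ range H,
          (η ^ 2 + if i = j then C ^ 2 else 0) := by
          gcongr with i hi j hj
          exact hN i hi j hj
      _ = ((H : ℝ)⁻¹) ^ 2 * (H * (H * η ^ 2 + C ^ 2)) := by
          congr 1
          rw [sum_congr rfl (g := fun _ => H * η ^ 2 + C ^ 2) fun i hi => by
            simp only [sum_add_distrib, sum_const, card_range, nsmul_eq_mul, sum_ite_eq, hi,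
              if_true]]
          simp
          ring
      _ ≤ ((H : ℝ)⁻¹) ^ 2 * (H * (H * η ^ 2 + H * η ^ 2)) := by gcongr
      _ = 2 * η ^ 2 := by field_simp; ring
      _ ≤ (3 / 2 * η) ^ 2 := by nlinarith [sq_nonneg η]
  have hB' := abs_le_of_sq_le_sq' hB (by positivity)
  have htri := norm_sub_norm_le ((N : ℝ)⁻¹ • ∑ n ∈ range N, y n)
    ((H : ℝ)⁻¹ • ∑ i ∈ range H, (N : ℝ)⁻¹ • ∑ n ∈ range N, y (n + i))
  rw [norm_sub_rev] at htri
  linarith [hB'.2]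


/-- The subspace of vectors fixed by `T ^ m`. -/
abbrev fixedSubspace (T : E →ₗᵢ[ℝ] E) (m : ℕ) : Submodule ℝ E :=
  (T ^ m).toContinuousLinearMap.eqLocus (1 : E →L[ℝ] E)

lemma mem_fixedSubspace {T : E →ₗᵢ[ℝ] E} {m : ℕ} {x : E} :
    x ∈ fixedSubspace T m ↔ (T ^ m) x = x := Iff.rfl

lemma fixedSubspace_mono {T : E →ₗᵢ[ℝ] E} {m n : ℕ} (h : m ∣ n) :
    fixedSubspace T m ≤ fixedSubspace T n := by
  obtain ⟨d, rfl⟩ := h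
  intro x hx
  rw [mem_fixedSubspace] at hx ⊢
  rw [pow_mul, LinearIsometry.coe_pow]
  exact Function.iterate_fixed hx d

variable [CompleteSpace E]

lemma tendsto_average_pow_mul (T : E →ₗᵢ[ℝ] E) (m : ℕ) (x : E) :
    Tendsto (fun N : ℕ => (N : ℝ)⁻¹ • ∑ n ∈ range N, (T ^ (m * n)) x) atTop
      (𝓝 ((fixedSubspace T m).starProjection x)) := by
  have h := (T ^ m).toContinuousLinearMap.tendsto_birkhoffAverage_orthogonalProjection
    (T ^ m).norm_toContinuousLinearMap_le x
  refine h.congr fun N => ?_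
  simp only [birkhoffAverage, birkhoffSum, id, pow_mul]
  congr 1
  refine sum_congr rfl fun n _ => ?_
  rw [LinearIsometry.coe_pow (T ^ m) n]
  rfl

/-- The projections onto the spaces of `T ^ m`-fixed vectors stabilise, up to a small error,
along multiples of a suitable `k`. -/
lemma exists_norm_starProjection_sub_le (T : E →ₗᵢ[ℝ] E) (f : E) {ε : ℝ} (hε : 0 < ε) :
    ∃ k, 0 < k ∧ ∀ m, 0 < m → k ∣ m →
      ‖(fixedSubspace T m).starProjection f - (fixedSubspace T k).starProjection f‖ ≤ ε := by
  have hbdd : BddAbove (Set.range fun m : ℕ => ‖(fixedSubspace T (m + 1)).starProjection f‖ ^ 2) :=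
    ⟨‖f‖ ^ 2, by
      rintro _ ⟨m, rfl⟩
      exact pow_le_pow_left₀ (norm_nonneg _) (Submodule.norm_starProjection_apply_le _ f) 2⟩
  obtain ⟨k, hk⟩ := exists_lt_of_lt_ciSup (sub_lt_self
    (⨆ m : ℕ, ‖(fixedSubspace T (m + 1)).starProjection f‖ ^ 2) (pow_pos hε 2))
  refine ⟨k + 1, k.succ_pos, fun m hm hkm => ?_⟩
  obtain ⟨m, rfl⟩ := Nat.exists_eq_succ_of_ne_zero hm.ne'
  have hcomp : (fixedSubspace T (k + 1)).starProjection ((fixedSubspace T (m + 1)).starProjection f)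
      = (fixedSubspace T (k + 1)).starProjection f :=
    DFunLike.congr_fun
      (Submodule.starProjection_comp_starProjection_of_le (fixedSubspace_mono hkm)) f
  have hpyth := Submodule.norm_sq_eq_add_norm_sq_starProjection
    ((fixedSubspace T (m + 1)).starProjection f) (fixedSubspace T (k + 1))
  rw [Submodule.starProjection_orthogonal_val, hcomp] at hpyth
  have hle := le_ciSup hbdd m
  refine (abs_le_of_sq_le_sq' ?_ hε.le).2
  simp only [Nat.succ_eq_add_one] at hle hpyth hk ⊢
  linarith

/-- The orbit of a vector with small projection onto the relevant fixed spaces has small averages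
along the squares of multiples of `k`. -/
lemma eventually_norm_average_pow_sq_le (T : E →ₗᵢ[ℝ] E) (g : E) {k : ℕ} (hk : 0 < k) {η : ℝ}
    (hη : 0 < η)
    (hg : ∀ m, 0 < m → k ∣ m → ‖(fixedSubspace T m).starProjection g‖ * ‖g‖ < η ^ 2) :
    ∀ᶠ N : ℕ in atTop,
      ‖(N : ℝ)⁻¹ • ∑ n ∈ range N, (T ^ (k * (n + 1)) ^ 2) g‖ ≤ 2 * η := by
  refine eventually_norm_average_le_of_correlation_le (y := fun n => (T ^ (k * (n + 1)) ^ 2) g)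
    (C := ‖g‖) (fun n => (LinearIsometry.norm_map _ _).le) hη fun i j hij => ?_
  obtain ⟨d, rfl⟩ := Nat.exists_eq_add_of_lt hij
  set m := k * (2 * k * (d + 1)) with hm
  set c := k ^ 2 * (d + 1) * (2 * i + d + 3) with hc
  have hinner : ∀ n, inner ℝ ((T ^ (k * (n + i + 1)) ^ 2) g)
      ((T ^ (k * (n + (i + d + 1) + 1)) ^ 2) g) = inner ℝ g ((T ^ (m * n)) ((T ^ c) g)) := by
    intro n
    have : (k * (n + (i + d + 1) + 1)) ^ 2 = (k * (n + i + 1)) ^ 2 + (m * n + c) := by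
      rw [hm, hc]; ring
    rw [this, pow_add, pow_add, LinearIsometry.coe_mul, Function.comp_apply,
      LinearIsometry.inner_map_map, LinearIsometry.coe_mul, Function.comp_apply]
  have hlim : Tendsto (fun N : ℕ => (N : ℝ)⁻¹ * ∑ n ∈ range N,
      inner ℝ ((T ^ (k * (n + i + 1)) ^ 2) g) ((T ^ (k * (n + (i + d + 1) + 1)) ^ 2) g)) atTop
      (𝓝 (inner ℝ g ((fixedSubspace T m).starProjection ((T ^ c) g)))) := by
    refine ((tendsto_const_nhds (x := g)).inner (𝕜 := ℝ)
      (tendsto_average_pow_mul T m ((T ^ c) g))).congr fun N => ?_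
    simp_rw [hinner, inner_smul_right, inner_sum]
  have hlt : inner ℝ g ((fixedSubspace T m).starProjection ((T ^ c) g)) < η ^ 2 := by
    rw [← Submodule.inner_starProjection_left_eq_right]
    refine (real_inner_le_norm _ _).trans_lt ?_
    rw [LinearIsometry.norm_map]
    exact hg m (by positivity) (dvd_mul_right _ _)
  exact (hlim.eventually_lt_const hlt).mono fun N hN => hN.le

/-- **Furstenberg's recurrence theorem along squares**, for a linear isometry of a Hilbert space. -/
theorem exists_inner_pow_sq_pos (T : E →ₗᵢ[ℝ] E) {u f : E} (hu : T u = u)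
    (hfu : inner ℝ f u ≠ 0) : ∃ n : ℕ, 0 < n ∧ 0 < inner ℝ ((T ^ n ^ 2) f) f := by
  by_contra! hneg
  have hu0 : 0 < ‖u‖ := norm_pos_iff.2 fun h => hfu (by simp [h])
  have hf0 : 0 < ‖f‖ := norm_pos_iff.2 fun h => hfu (by simp [h])
  set δ := (|inner ℝ f u| / ‖u‖) ^ 2 with hδ
  have hδ0 : 0 < δ := by have := abs_pos.2 hfu; positivity
  set η := δ / (4 * ‖f‖) with hη
  have hη0 : 0 < η := by positivity
  obtain ⟨k, hk, hkf⟩ := exists_norm_starProjection_sub_le T f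
    (ε := η ^ 2 / (2 * ‖f‖)) (by positivity)
  set p := (fixedSubspace T k).starProjection f with hp
  have hpk : p ∈ fixedSubspace T k := Submodule.starProjection_apply_mem _ _
  have hgf : ‖f - p‖ ≤ ‖f‖ := by
    rw [hp, ← Submodule.starProjection_orthogonal_val]
    exact Submodule.norm_starProjection_apply_le _ _
  have hpu : inner ℝ p u = inner ℝ f u := by
    rw [hp, Submodule.inner_starProjection_left_eq_right, Submodule.starProjection_eq_self_iff.2]
    rw [mem_fixedSubspace, LinearIsometry.coe_pow]
    exact Function.iterate_fixed hu k
  have hpδ : δ ≤ ‖p‖ ^ 2 := by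
    rw [hδ]
    gcongr
    rw [div_le_iff₀ hu0, ← hpu]
    exact abs_real_inner_le_norm _ _
  have hpf : inner ℝ p f = ‖p‖ ^ 2 := by
    rw [← real_inner_self_eq_norm_sq]
    nth_rw 3 [hp]
    rw [← Submodule.inner_starProjection_left_eq_right, Submodule.starProjection_eq_self_iff.2 hpk]
  have hsmall := eventually_norm_average_pow_sq_le T (f - p) hk hη0 fun m hm hkm => by
    rw [map_sub, Submodule.starProjection_eq_self_iff.2 (fixedSubspace_mono hkm hpk)]
    calc _ ≤ η ^ 2 / (2 * ‖f‖) * ‖f‖ := by gcongr; exact hkf m hm hkm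
      _ = η ^ 2 / 2 := by field_simp
      _ < η ^ 2 := half_lt_self (by positivity)
  obtain ⟨N, hN, hN0⟩ := (hsmall.and (eventually_gt_atTop 0)).exists
  have hterm : ∀ n, inner ℝ ((T ^ (k * (n + 1)) ^ 2) (f - p)) f ≤ -‖p‖ ^ 2 := by
    intro n
    have hfix : (T ^ (k * (n + 1)) ^ 2) p = p :=
      fixedSubspace_mono (T := T) ((dvd_mul_right k (n + 1)).trans (dvd_pow_self _ two_ne_zero)) hpk
    have := hneg (k * (n + 1)) (by positivity)
    rw [map_sub, hfix, inner_sub_left, hpf]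
    linarith
  have hN0' : (0 : ℝ) < N := by exact_mod_cast hN0
  have havg : inner ℝ ((N : ℝ)⁻¹ • ∑ n ∈ range N, (T ^ (k * (n + 1)) ^ 2) (f - p)) f ≤
      -‖p‖ ^ 2 := by
    rw [real_inner_smul_left, sum_inner, inv_mul_le_iff₀ hN0']
    simpa using sum_le_card_nsmul (range N) _ _ fun n _ => hterm n
  have hcs := (neg_le_abs _).trans (abs_real_inner_le_norm
    ((N : ℝ)⁻¹ • ∑ n ∈ range N, (T ^ (k * (n + 1)) ^ 2) (f - p)) f)
  have h2 : 2 * η * ‖f‖ = δ / 2 := by rw [hη]; field_simp; norm_num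
  have h3 := mul_le_mul_of_nonneg_right hN hf0.le
  linarith

end Hilbert

/-- Recurrence along squares for an isometry of a real vector space with a positive semidefinite
inner product. -/
theorem PreInnerProductSpace.Core.exists_inner_pow_sq_pos {V : Type*} [AddCommGroup V] [Module ℝ V]
    (c : PreInnerProductSpace.Core ℝ V) (T : V →ₗ[ℝ] V)
    (hT : ∀ x, c.inner (T x) (T x) = c.inner x x) {u f : V} (hu : T u = u)
    (hfu : c.inner f u ≠ 0) : ∃ n : ℕ, 0 < n ∧ 0 < c.inner ((T ^ n ^ 2) f) f := by
  let _ := @InnerProductSpace.Core.toSeminormedAddCommGroup ℝ V _ _ _ c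
  let _ := InnerProductSpace.ofCore c
  have hnorm : ∀ x, ‖T x‖ = ‖x‖ := fun x => by
    rw [← sq_eq_sq₀ (norm_nonneg _) (norm_nonneg _), ← real_inner_self_eq_norm_sq,
      ← real_inner_self_eq_norm_sq]
    exact hT x
  let T₁ : V →L[ℝ] V := (⟨T, hnorm⟩ : V →ₗᵢ[ℝ] V).toContinuousLinearMap
  let T₂ : UniformSpace.Completion V →ₗᵢ[ℝ] UniformSpace.Completion V :=
    ⟨T₁.completion, fun x => by
      induction x using UniformSpace.Completion.induction_on with
      | hp => exact isClosed_eq (by fun_prop) (by fun_prop)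
      | ih x =>
        change ‖T₁.completion x‖ = _
        rw [ContinuousLinearMap.completion_apply_coe, UniformSpace.Completion.norm_coe,
          UniformSpace.Completion.norm_coe]
        exact hnorm x⟩
  have hT₂ : ∀ x : V, T₂ x = (T x : V) := fun x => T₁.completion_apply_coe x
  have hpow : ∀ (n : ℕ) (x : V), (T₂ ^ n) x = ((T ^ n) x : V) := by
    intro n
    induction n with
    | zero => intro x; rfl
    | succ n ih =>
      intro x
      rw [pow_succ, pow_succ, LinearIsometry.coe_mul, Function.comp_apply, hT₂, ih,
        Module.End.mul_apply]
  obtain ⟨n, hn, h⟩ := _root_.exists_inner_pow_sq_pos T₂ (u := (u : UniformSpace.Completion V))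
    (f := f) (by rw [hT₂, hu]) (by rw [UniformSpace.Completion.inner_coe]; exact hfu)
  rw [hpow, UniformSpace.Completion.inner_coe] at h
  exact ⟨n, hn, h⟩

section Correspondence

open Finset Topology

/-- The space of bounded real sequences. -/
def boundedSequences : Submodule ℝ (ℕ → ℝ) where
  carrier := {f | ∃ C, ∀ n, ‖f n‖ ≤ C}
  zero_mem' := ⟨0, by simp⟩
  add_mem' := by
    rintro f g ⟨C, hC⟩ ⟨D, hD⟩
    exact ⟨C + D, fun n => (norm_add_le _ _).trans (add_le_add (hC n) (hD n))⟩
  smul_mem' := by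
    rintro r f ⟨C, hC⟩
    exact ⟨‖r‖ * C, fun n => by
      rw [Pi.smul_apply, norm_smul]
      exact mul_le_mul_of_nonneg_left (hC n) (norm_nonneg r)⟩

lemma mul_mem_boundedSequences {f g : ℕ → ℝ} (hf : f ∈ boundedSequences)
    (hg : g ∈ boundedSequences) : f * g ∈ boundedSequences := by
  obtain ⟨C, hC⟩ := hf
  obtain ⟨D, hD⟩ := hg
  exact ⟨C * D, fun n => by
    rw [Pi.mul_apply, norm_mul]
    exact mul_le_mul (hC n) (hD n) (norm_nonneg _) ((norm_nonneg _).trans (hC n))⟩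

/-- The average of the first `N` terms of a sequence. -/
noncomputable def cesaroAverage (f : ℕ → ℝ) (N : ℕ) : ℝ := (N : ℝ)⁻¹ • ∑ n ∈ range N, f n

lemma cesaroAverage_add (f g : ℕ → ℝ) (N : ℕ) :
    cesaroAverage (f + g) N = cesaroAverage f N + cesaroAverage g N := by
  simp [cesaroAverage, sum_add_distrib, mul_add]

lemma cesaroAverage_smul (r : ℝ) (f : ℕ → ℝ) (N : ℕ) :
    cesaroAverage (r • f) N = r * cesaroAverage f N := by
  simp [cesaroAverage, ← mul_sum, mul_left_comm]

lemma cesaroAverage_nonneg {f : ℕ → ℝ} (hf : ∀ n, 0 ≤ f n) (N : ℕ) : 0 ≤ cesaroAverage f N :=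
  smul_nonneg (by positivity) (sum_nonneg fun n _ => hf n)

lemma norm_cesaroAverage_le {f : ℕ → ℝ} {C : ℝ} (hC : ∀ n, ‖f n‖ ≤ C) (N : ℕ) :
    ‖cesaroAverage f N‖ ≤ C := by
  have hC0 : 0 ≤ C := (norm_nonneg _).trans (hC 0)
  have hsum : ‖∑ n ∈ range N, f n‖ ≤ N * C := by
    simpa using norm_sum_le_of_le (range N) fun n _ => hC n
  rw [cesaroAverage, norm_smul, Real.norm_of_nonneg (by positivity)]
  calc (N : ℝ)⁻¹ * ‖∑ n ∈ range N, f n‖ ≤ (N : ℝ)⁻¹ * (N * C) := by gcongr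
    _ = ((N : ℝ)⁻¹ * N) * C := by ring
    _ ≤ C := mul_le_of_le_one_left hC0 inv_mul_le_one

/-- The limit of the averages of a sequence along an ultrafilter. -/
noncomputable def ultraMean (U : Ultrafilter ℕ) (f : ℕ → ℝ) : ℝ := limUnder U (cesaroAverage f)

lemma tendsto_ultraMean (U : Ultrafilter ℕ) {f : ℕ → ℝ} (hf : f ∈ boundedSequences) :
    Tendsto (cesaroAverage f) U (𝓝 (ultraMean U f)) := by
  obtain ⟨C, hC⟩ := hf
  obtain ⟨x, -, hx⟩ := (isCompact_closedBall (0 : ℝ) C).ultrafilter_le_nhds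
    (U.map (cesaroAverage f)) (by
      rw [le_principal_iff]
      exact (Eventually.of_forall fun N => by simpa using norm_cesaroAverage_le hC N :
        ∀ᶠ N in (U : Filter ℕ), cesaroAverage f N ∈ Metric.closedBall 0 C))
  exact tendsto_nhds_limUnder ⟨x, hx⟩

/-- The positive semidefinite form `(f, g) ↦ ultraMean U (f * g)` on bounded sequences. -/
noncomputable abbrev ultraMeanCore (U : Ultrafilter ℕ) :
    PreInnerProductSpace.Core ℝ boundedSequences where
  inner f g := ultraMean U (f * g : ℕ → ℝ)
  conj_inner_symm f g := by simp [mul_comm]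
  re_inner_nonneg f := ge_of_tendsto' (tendsto_ultraMean U (mul_mem_boundedSequences f.2 f.2))
    fun N => cesaroAverage_nonneg (fun n => mul_self_nonneg _) N
  add_left f g h := by
    refine tendsto_nhds_unique
      (tendsto_ultraMean U (mul_mem_boundedSequences (f + g).2 h.2)) ?_
    refine ((tendsto_ultraMean U (mul_mem_boundedSequences f.2 h.2)).add
      (tendsto_ultraMean U (mul_mem_boundedSequences g.2 h.2))).congr fun N => ?_
    rw [← cesaroAverage_add, Submodule.coe_add, add_mul]
  smul_left f g r := by
    refine tendsto_nhds_unique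
      (tendsto_ultraMean U (mul_mem_boundedSequences (r • f).2 g.2)) ?_
    refine ((tendsto_ultraMean U (mul_mem_boundedSequences f.2 g.2)).const_mul r).congr
      fun N => ?_
    rw [← cesaroAverage_smul, Submodule.coe_smul, smul_mul_assoc]

/-- The shift `f ↦ (n ↦ f (n + 1))` on bounded sequences. -/
def boundedShift : boundedSequences →ₗ[ℝ] boundedSequences :=
  (LinearMap.funLeft ℝ ℝ Nat.succ).restrict fun _ ⟨C, hC⟩ => ⟨C, fun n => hC (n + 1)⟩

lemma boundedShift_apply (f : boundedSequences) (k : ℕ) :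
    (boundedShift f : ℕ → ℝ) k = (f : ℕ → ℝ) (k + 1) := rfl

lemma boundedShift_pow_apply (n : ℕ) (f : boundedSequences) (k : ℕ) :
    ((boundedShift ^ n) f : ℕ → ℝ) k = (f : ℕ → ℝ) (k + n) := by
  induction n generalizing k with
  | zero => rfl
  | succ n ih => rw [pow_succ', Module.End.mul_apply, boundedShift_apply, ih, add_right_comm,
      add_assoc]

lemma ultraMean_add_one {U : Ultrafilter ℕ} (hU : (U : Filter ℕ) ≤ atTop) {f : ℕ → ℝ}
    (hf : f ∈ boundedSequences) : ultraMean U (fun n => f (n + 1)) = ultraMean U f := by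
  have hf' : (fun n => f (n + 1)) ∈ boundedSequences := (boundedShift ⟨f, hf⟩).2
  obtain ⟨C, hC⟩ := hf
  exact sub_eq_zero.1 (tendsto_nhds_unique
    ((tendsto_ultraMean U hf').sub (tendsto_ultraMean U ⟨C, hC⟩))
    ((tendsto_average_add_sub hC 1).mono_left hU))

/-- **Furstenberg's correspondence and recurrence**: a set whose averages do not tend to zero along
an ultrafilter contains two elements that differ by a nonzero square. -/
lemma exists_mem_add_sq_mem_of_ultraMean_pos {U : Ultrafilter ℕ} (hU : (U : Filter ℕ) ≤ atTop)
    {B : Set ℕ} (hB : 0 < ultraMean U (B.indicator 1)) :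
    ∃ n : ℕ, 0 < n ∧ ∃ k ∈ B, k + n ^ 2 ∈ B := by
  let one : boundedSequences := ⟨1, 1, by simp⟩
  let f : boundedSequences := ⟨B.indicator 1, 1, fun n => by
    by_cases h : n ∈ B <;> simp [h]⟩
  obtain ⟨n, hn, hpos⟩ := (ultraMeanCore U).exists_inner_pow_sq_pos boundedShift
    (u := one) (f := f)
    (fun x => ultraMean_add_one hU (f := (x : ℕ → ℝ) * (x : ℕ → ℝ))
      (mul_mem_boundedSequences x.2 x.2)) rfl
    (by
      change ultraMean U (B.indicator 1 * 1) ≠ 0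
      rw [mul_one]
      exact hB.ne')
  refine ⟨n, hn, ?_⟩
  by_contra! hempty
  refine hpos.ne' (tendsto_nhds_unique (tendsto_ultraMean U
    (mul_mem_boundedSequences ((boundedShift ^ n ^ 2) f).2 f.2)) ?_)
  have hzero : (((boundedShift ^ n ^ 2) f : ℕ → ℝ) * (f : ℕ → ℝ)) = 0 := by
    ext k
    rw [Pi.mul_apply, boundedShift_pow_apply]
    by_cases hk : k ∈ B
    · simp [f, hempty k hk]
    · simp [f, hk]
  rw [hzero]
  exact tendsto_const_nhds.congr fun N => by simp [cesaroAverage]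

lemma cesaroAverage_indicator_add_one (A : Set ℕ) (N : ℕ) :
    cesaroAverage ({k | k + 1 ∈ A}.indicator 1) N = (Nat.card ↥(A ∩ Set.Icc 1 N) : ℝ) / N := by
  classical
  have hcard : Nat.card ↥(A ∩ Set.Icc 1 N) = #{k ∈ range N | k + 1 ∈ A} := by
    rw [← card_map (addRightEmbedding 1), Nat.card_coe_set_eq, ← Set.ncard_coe_finset]
    congr 1
    ext a
    simp only [Set.mem_inter_iff, Set.mem_Icc, coe_map, coe_filter, mem_range, Set.mem_image,
      Set.mem_ofPred_eq, addRightEmbedding_apply]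
    constructor
    · rintro ⟨ha, h1, hN⟩
      exact ⟨a - 1, ⟨by lia, by rwa [Nat.sub_add_cancel h1]⟩, Nat.sub_add_cancel h1⟩
    · rintro ⟨k, ⟨hk, hkA⟩, rfl⟩
      exact ⟨hkA, by lia, by lia⟩
  rw [hcard, cesaroAverage, smul_eq_mul, div_eq_inv_mul]
  simp [Set.indicator_apply]

end Correspondence

/-- **Sárközy–Furstenberg theorem.** If `A ⊆ ℤ⁺` has positive upper density then there are
two distinct elements of `A` whose difference is a perfect square. -/
theorem sarkozy_furstenberg (A : Set ℕ) (hpos : ∀ a ∈ A, 0 < a)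
    (hA : 0 < upperDensity A) :
    ∃ a ∈ A, ∃ a' ∈ A, a ≠ a' ∧ ∃ n : ℕ, (a : ℤ) - (a' : ℤ) = (n : ℤ) ^ 2 := by
  obtain ⟨δ, hδ0, hδ⟩ := exists_between hA
  have hfreq : ∃ᶠ N : ℕ in atTop, δ < (Nat.card ↥(A ∩ Set.Icc 1 N) : ℝ) / N :=
    frequently_lt_of_lt_limsup
      (isBoundedUnder_of ⟨0, fun N => by positivity⟩ : IsBoundedUnder _ _ _).isCoboundedUnder_le hδ
  have hne := frequently_iff_neBot.1 hfreq
  let U := Ultrafilter.of (atTop ⊓ 𝓟 {N : ℕ | δ < (Nat.card ↥(A ∩ Set.Icc 1 N) : ℝ) / N})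
  have hU := Ultrafilter.of_le (atTop ⊓ 𝓟 {N : ℕ | δ < (Nat.card ↥(A ∩ Set.Icc 1 N) : ℝ) / N})
  have hmean : δ ≤ ultraMean U ({k | k + 1 ∈ A}.indicator 1) := by
    refine ge_of_tendsto (tendsto_ultraMean U ⟨1, fun n => ?_⟩)
      (mem_of_superset (le_principal_iff.1 (hU.trans inf_le_right)) fun N hN => ?_)
    · by_cases h : n + 1 ∈ A <;> simp [h]
    · rw [Set.mem_ofPred_eq, cesaroAverage_indicator_add_one]
      exact le_of_lt hN
  obtain ⟨n, hn, k, hk, hkn⟩ := exists_mem_add_sq_mem_of_ultraMean_pos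
    (hU.trans inf_le_left) (hδ0.trans_le hmean)
  refine ⟨k + n ^ 2 + 1, hkn, k + 1, hk, ?_, n, ?_⟩
  · have := pow_pos hn 2
    lia
  · push_cast
    ring
end

section
/- Let h ∈ ℤ[x] be an intersective polynomial of degree k ≥ 2 such that h and h' are positive and increasing for x ≥ 0, and let δ > 0. There is a constant c(h,δ) > 0 depending only on h and δ such that for all N sufficiently large depending on h and δ: for every function f : ℤ/Nℤ → [0, 1] with (1/N)·Σ_{n ∈ ℤ/Nℤ} f(n) ≥ δ, one has Σ_{a ∈ ℤ/Nℤ} Σ_{d ∈ ℤ/Nℤ} f(a)·f(a+d)·S_{N,h}(d) ≥ c(h,δ)·N². -/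
open Polynomial
open scoped Classical

/-- `Sf N f x = f'(n)` if the representative of `x` in `(0, N)` satisfies `0 < x < N/2`
and `x = f(n)` for some nonnegative integer `n`, and `0` otherwise. -/
noncomputable def Sf (N : ℕ) (f : Polynomial ℤ) (x : ZMod N) : ℝ :=
  if hx : 0 < x.val ∧ 2 * x.val < N ∧ ∃ n : ℕ, (x.val : ℤ) = f.eval (n : ℤ)
  then ((f.derivative.eval ((hx.2.2.choose : ℕ) : ℤ) : ℤ) : ℝ)
  else 0

/-- The distance from `x` to the nearest integer is at most `c`. -/
def NearInt (c x : ℝ) : Prop := ∃ z : ℤ, |x - z| ≤ c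

lemma NearInt.mono {c c' x : ℝ} (hx : NearInt c x) (hc : c ≤ c') : NearInt c' x := by
  obtain ⟨z, hz⟩ := hx
  exact ⟨z, hz.trans hc⟩

lemma NearInt.nat_mul {c x : ℝ} (hx : NearInt c x) (n : ℕ) : NearInt (n * c) (n * x) := by
  obtain ⟨z, hz⟩ := hx
  refine ⟨n * z, ?_⟩
  push_cast
  rw [← mul_sub, abs_mul, Nat.abs_cast]
  gcongr

lemma nearInt_half (x : ℝ) : NearInt (1 / 2) x := ⟨round x, abs_sub_round x⟩

/-- A finite set of naturals of diameter at most `X` has at most `X + 1` elements. -/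
lemma card_le_of_diam_le {T : Finset ℕ} {X : ℝ}
    (hT : ∀ i ∈ T, ∀ j ∈ T, i ≤ j → (j : ℝ) - i ≤ X) : T.card ≤ ⌊X⌋₊ + 1 := by
  rcases T.eq_empty_or_nonempty with rfl | hne
  · simp
  have hsub : T ⊆ Finset.Icc (T.min' hne) (T.min' hne + ⌊X⌋₊) := by
    intro j hj
    have h1 := T.min'_le j hj
    have h2 := hT _ (T.min'_mem hne) j hj h1
    rw [Finset.mem_Icc]
    refine ⟨h1, ?_⟩
    have : j - T.min' hne ≤ ⌊X⌋₊ := Nat.le_floor (by rw [Nat.cast_sub h1]; exact h2)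
    omega
  have := Finset.card_le_card hsub
  rw [Nat.card_Icc] at this
  omega

/-- Pigeonhole: a dense set of naturals has two elements at bounded distance. -/
lemma exists_close_pair {ε : ℝ} (hε : 0 < ε) {M : ℕ} {A : Finset ℕ} (hAM : ∀ l ∈ A, l ≤ M)
    (hcard : ε * M ≤ A.card) (hM : 2 < ε * M) :
    ∃ l ∈ A, ∃ l' ∈ A, l < l' ∧ l' - l < ⌈2 / ε⌉₊ := by
  set B := ⌈2 / ε⌉₊ with hB
  have hB0 : 0 < B := Nat.ceil_pos.2 (by positivity)
  have hB1 : 2 / ε ≤ B := Nat.le_ceil _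
  have hlt : (Finset.range (M / B + 1)).card < A.card := by
    rw [Finset.card_range]
    have h1 : ((M / B : ℕ) : ℝ) ≤ (M : ℝ) / B := Nat.cast_div_le
    have h2 : (M : ℝ) / B ≤ ε * M / 2 := by
      rw [div_le_iff₀ (by positivity)]
      rw [div_le_iff₀ hε] at hB1
      nlinarith [Nat.cast_nonneg (α := ℝ) M]
    have h3 : ((M / B + 1 : ℕ) : ℝ) < A.card := by
      push_cast
      linarith
    exact_mod_cast h3
  obtain ⟨x, hx, y, hy, hxy, he⟩ := Finset.exists_ne_map_eq_of_card_lt_of_maps_to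
    (f := fun l => l / B) hlt (fun l hl => by
      simp only [Finset.coe_range, Set.mem_Iio]
      exact Nat.lt_succ_of_le (Nat.div_le_div_right (hAM l hl)))
  have key : ∀ u v : ℕ, u < v → u / B = v / B → v - u < B := by
    intro u v _ hq
    have hu := Nat.div_add_mod u B
    have hv := Nat.div_add_mod v B
    have := Nat.mod_lt v hB0
    rw [hq] at hu
    omega
  rcases lt_or_gt_of_ne hxy with h | h
  · exact ⟨x, hx, y, hy, h, key x y h he⟩
  · exact ⟨y, hy, x, hx, h, key y x h he.symm⟩

/-- If `‖lα‖ ≤ κ` for a positive proportion of `l ≤ M`, then `‖qα‖ ≪ κ / M` for some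
bounded `q`. -/
lemma exists_strong_recurrence {ε κ α : ℝ} (hε : 0 < ε) (hε1 : ε ≤ 1) (hκ : 0 ≤ κ)
    (hκε : κ ≤ ε / 32) {M : ℕ} {A : Finset ℕ} (hAM : ∀ l ∈ A, l ≤ M)
    (hA : ∀ l ∈ A, NearInt κ (l * α)) (hcard : ε * M ≤ A.card) (hM : 60 / ε ^ 2 ≤ M) :
    ∃ q : ℕ, 1 ≤ q ∧ (q : ℝ) ≤ 3 / ε ∧ NearInt (60 * κ / (ε ^ 2 * M)) (q * α) := by
  have hM' : 60 ≤ ε ^ 2 * M := by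
    rw [div_le_iff₀ (by positivity)] at hM
    linarith
  have hM0 : (0 : ℝ) < M := lt_of_lt_of_le (by positivity) hM
  have hεM : 60 ≤ ε * M := by nlinarith
  obtain ⟨l₁, hl₁, l₂, hl₂, hlt, hB⟩ := exists_close_pair hε hAM hcard (by linarith)
  set q := l₂ - l₁ with hq
  have hq0 : 0 < q := by omega
  have hqR : (0 : ℝ) < q := by exact_mod_cast hq0
  have hqB : (q : ℝ) ≤ 3 / ε := by
    have h1 : ((q : ℕ) : ℝ) ≤ (⌈2 / ε⌉₊ : ℝ) := by exact_mod_cast hB.le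
    have h2 : (⌈2 / ε⌉₊ : ℝ) < 2 / ε + 1 := Nat.ceil_lt_add_one (by positivity)
    have h3 : 1 ≤ 1 / ε := by rw [le_div_iff₀ hε]; linarith
    have h4 : 3 / ε = 2 / ε + 1 / ε := by ring
    linarith
  refine ⟨q, hq0, hqB, ?_⟩
  choose! Z hZ using hA
  set z₀ : ℤ := Z l₂ - Z l₁ with hz₀
  set γ : ℝ := q * α - z₀ with hγ
  have hγκ : |γ| ≤ 2 * κ := by
    have h1 := abs_le.1 (hZ l₁ hl₁)
    have h2 := abs_le.1 (hZ l₂ hl₂)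
    have : γ = (l₂ * α - Z l₂) - (l₁ * α - Z l₁) := by
      rw [hγ, hz₀, hq, Nat.cast_sub hlt.le]
      push_cast
      ring
    rw [this, abs_le]
    constructor <;> linarith
  refine ⟨z₀, ?_⟩
  rw [← hγ]
  rcases eq_or_ne γ 0 with h0 | h0
  · rw [h0, abs_zero]
    positivity
  have hγ0 : 0 < |γ| := abs_pos.2 h0
  -- each `l ∈ A` is encoded by its residue and by the integer near `sα + jγ`
  set y : ℕ → ℤ := fun l => Z l - (l / q : ℕ) * z₀ with hy
  have hyl : ∀ l ∈ A, |(l % q : ℕ) * α + (l / q : ℕ) * γ - y l| ≤ κ := by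
    intro l hl
    have h1 : ((l % q : ℕ) : ℝ) + q * (l / q : ℕ) = l := by exact_mod_cast Nat.mod_add_div l q
    have : (l % q : ℕ) * α + (l / q : ℕ) * γ - y l = l * α - Z l := by
      simp only [hy, hγ, Int.cast_sub, Int.cast_mul, Int.cast_natCast]
      rw [← h1]
      ring
    rw [this]
    exact hZ l hl
  set W : ℝ := M * |γ| / q + 2 with hW
  have hW0 : 0 ≤ W := by positivity
  set R : ℕ := ⌊W⌋₊ with hR
  set g : ℕ → ℕ × ℤ := fun l => (l % q, y l - ⌊(l % q : ℕ) * α⌋) with hg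
  have hmaps : Set.MapsTo g (A : Set ℕ)
      ((Finset.range q ×ˢ Finset.Icc (-(R : ℤ)) R : Finset (ℕ × ℤ)) : Set (ℕ × ℤ)) := by
    intro l hl
    have hl' : l ∈ A := hl
    have hj : ((l / q : ℕ) : ℝ) ≤ M / q := by
      refine Nat.cast_div_le.trans ?_
      have : (l : ℝ) ≤ M := by exact_mod_cast hAM l hl'
      gcongr
    have hjγ : |((l / q : ℕ) : ℝ) * γ| ≤ M * |γ| / q := by
      rw [abs_mul, Nat.abs_cast, mul_div_right_comm]
      gcongr
    have h1 := abs_le.1 (hyl l hl')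
    have h2 := abs_le.1 hjγ
    have h3 := Int.floor_le ((l % q : ℕ) * α)
    have h4 := Int.lt_floor_add_one ((l % q : ℕ) * α)
    have h5 : |((y l - ⌊(l % q : ℕ) * α⌋ : ℤ) : ℝ)| ≤ W := by
      push_cast
      rw [abs_le, hW]
      constructor <;> linarith
    have h6 : (y l - ⌊(l % q : ℕ) * α⌋).natAbs ≤ R := by
      refine Nat.le_floor ?_
      rw [Nat.cast_natAbs]
      exact_mod_cast h5
    simp only [hg, Finset.coe_product, Set.mem_prod, Finset.coe_range, Set.mem_Iio,
      Finset.coe_Icc, Set.mem_Icc]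
    exact ⟨Nat.mod_lt _ hq0, by omega, by omega⟩
  have hfib : ∀ b ∈ (Finset.range q ×ˢ Finset.Icc (-(R : ℤ)) R : Finset (ℕ × ℤ)),
      (A.filter fun l => g l = b).card ≤ ⌊2 * κ / |γ|⌋₊ + 1 := by
    intro b _
    have hmod : ∀ l ∈ A.filter (fun l => g l = b), l % q = b.1 := by
      intro l hl
      rw [← (Finset.mem_filter.1 hl).2]
    rw [← Finset.card_image_of_injOn (s := A.filter fun l => g l = b) (f := fun l => l / q)]
    · refine card_le_of_diam_le ?_
      intro i hi j hj hij
      obtain ⟨l, hl, rfl⟩ := Finset.mem_image.1 hi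
      obtain ⟨l', hl', rfl⟩ := Finset.mem_image.1 hj
      have e1 := hmod l hl
      have e2 := hmod l' hl'
      obtain ⟨hlA, hlb⟩ := Finset.mem_filter.1 hl
      obtain ⟨hlA', hlb'⟩ := Finset.mem_filter.1 hl'
      have hyy : y l = y l' := by
        have := congrArg Prod.snd (hlb.trans hlb'.symm)
        simp only [hg, e1, e2] at this
        linarith
      have h1 := hyl l hlA
      have h2 := hyl l' hlA'
      rw [e1, hyy] at h1
      rw [e2] at h2
      have h3 : |(((l' / q : ℕ) : ℝ) - (l / q : ℕ)) * γ| ≤ 2 * κ := by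
        rw [abs_le] at h1 h2 ⊢
        constructor <;> linarith
      rw [abs_mul] at h3
      rw [le_div_iff₀ hγ0]
      exact (mul_le_mul_of_nonneg_right (le_abs_self _) hγ0.le).trans h3
    · intro l hl l' hl' hll
      have e1 := hmod l hl
      have e2 := hmod l' hl'
      simp only at hll
      rw [← Nat.div_add_mod l q, ← Nat.div_add_mod l' q, e1, e2, hll]
  have hcount := Finset.card_le_mul_card_image_of_maps_to hmaps _ hfib
  have hcount' : (A.card : ℝ) ≤ (2 * κ / |γ| + 1) * (q * (2 * W + 1)) := by
    have h1 : (A.card : ℝ) ≤ (⌊2 * κ / |γ|⌋₊ + 1) * (q * (2 * R + 1)) := by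
      rw [Finset.card_product, Finset.card_range, Int.card_Icc] at hcount
      have : ((R : ℤ) + 1 - -(R : ℤ)).toNat = 2 * R + 1 := by omega
      rw [this] at hcount
      exact_mod_cast hcount
    have h2 : ((⌊2 * κ / |γ|⌋₊ : ℕ) : ℝ) ≤ 2 * κ / |γ| := Nat.floor_le (by positivity)
    have h3 : (R : ℝ) ≤ W := Nat.floor_le hW0
    refine h1.trans ?_
    gcongr
  have hexp : (2 * κ / |γ| + 1) * (q * (2 * W + 1)) =
      4 * κ * M + 10 * κ * q / |γ| + 2 * M * |γ| + 5 * q := by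
    rw [hW]
    field_simp
    ring
  have hγM : 2 * M * |γ| ≤ 4 * κ * M := by nlinarith
  have hκM : 8 * κ * M ≤ ε * M / 4 := by nlinarith
  have hqM : 5 * (q : ℝ) ≤ ε * M / 4 := by
    rw [le_div_iff₀ hε] at hqB
    nlinarith
  have hmain : ε * M / 2 ≤ 10 * κ * q / |γ| := by linarith
  rw [le_div_iff₀ hγ0] at hmain
  rw [le_div_iff₀ (by positivity)]
  rw [le_div_iff₀ hε] at hqB
  calc |γ| * (ε ^ 2 * M) = 2 * ε * (ε * M / 2 * |γ|) := by ring
    _ ≤ 2 * ε * (10 * κ * q) := by gcongr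
    _ = 20 * κ * (q * ε) := by ring
    _ ≤ 20 * κ * 3 := by gcongr
    _ = 60 * κ := by ring

/-- `e(x) = exp(2πix)`. -/
noncomputable def expTurn (x : ℝ) : ℂ := Complex.exp ((2 * Real.pi * x : ℝ) * Complex.I)

lemma norm_expTurn (x : ℝ) : ‖expTurn x‖ = 1 := Complex.norm_exp_ofReal_mul_I _

lemma expTurn_add (x y : ℝ) : expTurn (x + y) = expTurn x * expTurn y := by
  rw [expTurn, expTurn, expTurn, ← Complex.exp_add]
  push_cast
  ring_nf

lemma expTurn_re (x : ℝ) : (expTurn x).re = Real.cos (2 * Real.pi * x) :=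
  Complex.exp_ofReal_mul_I_re _

lemma conj_expTurn_mul (x y : ℝ) :
    (starRingEnd ℂ) (expTurn x) * expTurn y = expTurn (y - x) := by
  have h : (starRingEnd ℂ) (expTurn x) = expTurn (-x) := by
    rw [expTurn, expTurn, ← Complex.exp_conj, map_mul, Complex.conj_I, Complex.conj_ofReal]
    push_cast
    ring_nf
  rw [h, ← expTurn_add]
  ring_nf

lemma expTurn_nat_mul (n : ℕ) (x : ℝ) : expTurn (n * x) = expTurn x ^ n := by
  rw [expTurn, expTurn, ← Complex.exp_nat_mul]
  push_cast
  ring_nf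

lemma expTurn_sub_int (x : ℝ) (z : ℤ) : expTurn (x - z) = expTurn x := by
  rw [expTurn, expTurn, Complex.exp_eq_exp_iff_exists_int]
  refine ⟨-z, ?_⟩
  push_cast
  ring

lemma four_mul_abs_le_norm_expTurn_sub_one {x : ℝ} (hx : |x| ≤ 1 / 2) :
    4 * |x| ≤ ‖expTurn x - 1‖ := by
  have h0 := Real.pi_pos
  rw [expTurn, mul_comm _ Complex.I, Complex.norm_exp_I_mul_ofReal_sub_one, norm_mul,
    Real.norm_ofNat, Real.norm_eq_abs]
  have h1 : 2 * Real.pi * x / 2 = Real.pi * x := by ring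
  rw [h1]
  have h2 : |Real.pi * x| = Real.pi * |x| := by rw [abs_mul, abs_of_pos h0]
  have h3 := Real.mul_abs_le_abs_sin (x := Real.pi * x) (by rw [h2]; nlinarith)
  rw [h2] at h3
  have h4 : 2 / Real.pi * (Real.pi * |x|) = 2 * |x| := by field_simp
  linarith

/-- `p` behaves like a polynomial phase of degree at most `k`, with `k`-fold differences
determined by `α`. -/
def IsPhase : ℕ → ℝ → (ℕ → ℝ) → Prop
  | 0, α, p => ∀ m, p m = α
  | k + 1, α, p => ∀ l : ℕ, IsPhase k (l * α) fun m => p (m + l) - p m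

lemma IsPhase.const_mul {k : ℕ} {α : ℝ} {p : ℕ → ℝ} (hp : IsPhase k α p) (θ : ℝ) :
    IsPhase k (α * θ) fun m => p m * θ := by
  induction k generalizing α p with
  | zero =>
    intro m
    simp only [hp m]
  | succ k ih =>
    intro l
    have := ih (hp l)
    rw [mul_assoc] at this
    convert this using 2
    ring

lemma IsPhase.comp_affine {k : ℕ} {α : ℝ} {p : ℕ → ℝ} (hp : IsPhase k α p) (b D : ℕ) :
    IsPhase k (D ^ k * α) fun m => p (b + D * m) := by
  induction k generalizing α p with
  | zero =>
    intro m
    rw [pow_zero, one_mul]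
    exact hp _
  | succ k ih =>
    intro l
    have := ih (hp (D * l))
    convert this using 1
    · push_cast
      ring
    · ext m
      ring_nf

lemma isPhase_eval (k : ℕ) (P : ℝ[X]) (hP : P.natDegree ≤ k) :
    IsPhase k (k.factorial * P.coeff k) fun m => P.eval (m : ℝ) := by
  induction k generalizing P with
  | zero =>
    intro m
    rw [eq_C_of_natDegree_le_zero hP]
    simp
  | succ k ih =>
    intro l
    have htop : ∀ n, k + 1 ≤ n → (taylor (l : ℝ) P).coeff n = P.coeff n := by
      intro n hn
      rw [taylor_coeff]
      have : (hasseDeriv n P).natDegree ≤ 0 := (natDegree_hasseDeriv_le P n).trans (by omega)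
      rw [eq_C_of_natDegree_le_zero this, eval_C, hasseDeriv_coeff]
      simp
    have hk : (taylor (l : ℝ) P).coeff k = P.coeff k + (k + 1) * l * P.coeff (k + 1) := by
      rw [taylor_coeff]
      have h1 : (hasseDeriv k P).natDegree ≤ 1 := (natDegree_hasseDeriv_le P k).trans (by omega)
      rw [eq_X_add_C_of_natDegree_le_one h1]
      simp only [eval_add, eval_mul, eval_C, eval_X, hasseDeriv_coeff]
      have h2 : (1 + k).choose k = k + 1 := by rw [add_comm, Nat.choose_succ_self_right]
      rw [h2, zero_add, Nat.choose_self, add_comm 1 k]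
      push_cast
      ring
    have hdeg : (taylor (l : ℝ) P - P).natDegree ≤ k := by
      rw [natDegree_le_iff_coeff_eq_zero]
      intro n hn
      rw [coeff_sub, htop n hn, sub_self]
    have := ih _ hdeg
    rw [coeff_sub, hk] at this
    convert this using 1
    · rw [Nat.factorial_succ]
      push_cast
      ring
    · ext m
      rw [eval_sub, taylor_eval]
      push_cast
      rfl

/-- The van der Corput identity for the square of an exponential sum. -/
lemma norm_sq_sum_eq (z : ℕ → ℂ) (hz : ∀ m, ‖z m‖ = 1) (L : ℕ) :
    ‖∑ m ∈ Finset.range L, z m‖ ^ 2 = L + 2 * (∑ l ∈ Finset.range L,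
      ∑ m ∈ Finset.range (L - 1 - l), (starRingEnd ℂ) (z m) * z (m + (l + 1))).re := by
  induction L with
  | zero => simp
  | succ L ih =>
    have hT : ∑ l ∈ Finset.range (L + 1), ∑ m ∈ Finset.range (L + 1 - 1 - l),
        (starRingEnd ℂ) (z m) * z (m + (l + 1)) =
        (∑ l ∈ Finset.range L, ∑ m ∈ Finset.range (L - 1 - l),
          (starRingEnd ℂ) (z m) * z (m + (l + 1))) +
        (starRingEnd ℂ) (∑ m ∈ Finset.range L, z m) * z L := by
      rw [Finset.sum_range_succ, ← Finset.sum_range_reflect z L, map_sum, Finset.sum_mul,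
        ← Finset.sum_add_distrib]
      simp only [Nat.add_sub_cancel, Nat.sub_self, Finset.range_zero, Finset.sum_empty, add_zero]
      refine Finset.sum_congr rfl fun l hl => ?_
      have hl' := Finset.mem_range.1 hl
      have h1 : L - l = (L - 1 - l) + 1 := by omega
      rw [h1, Finset.sum_range_succ]
      congr 4
      omega
    rw [hT, Finset.sum_range_succ, Complex.add_re, mul_add, ← add_assoc]
    set S := ∑ m ∈ Finset.range L, z m
    have h2 : ‖S + z L‖ ^ 2 = ‖S‖ ^ 2 + 1 + 2 * ((starRingEnd ℂ) S * z L).re := by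
      have h3 := hz L
      have h4 : ‖z L‖ ^ 2 = 1 := by rw [h3, one_pow]
      rw [Complex.sq_norm, Complex.normSq_apply] at h4 ⊢
      rw [Complex.sq_norm, Complex.normSq_apply]
      simp only [Complex.add_re, Complex.add_im, Complex.mul_re, Complex.conj_re, Complex.conj_im]
      linear_combination h4
    rw [h2, ih]
    push_cast
    ring

lemma norm_sq_sum_le (p : ℕ → ℝ) (L : ℕ) :
    ‖∑ m ∈ Finset.range L, expTurn (p m)‖ ^ 2 ≤ L + 2 * ∑ l ∈ Finset.range L,
      ‖∑ m ∈ Finset.range (L - 1 - l), expTurn (p (m + (l + 1)) - p m)‖ := by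
  rw [norm_sq_sum_eq _ (fun m => norm_expTurn _)]
  simp only [conj_expTurn_mul]
  gcongr
  exact (Complex.re_le_norm _).trans (norm_sum_le _ _)

lemma norm_sum_expTurn_le (p : ℕ → ℝ) (L : ℕ) :
    ‖∑ m ∈ Finset.range L, expTurn (p m)‖ ≤ L := by
  refine (norm_sum_le _ _).trans ?_
  simp [norm_expTurn]

lemma weyl_linear {α ε : ℝ} (hε : 0 < ε) {p : ℕ → ℝ} (hp : IsPhase 1 α p) {M L : ℕ}
    (hM : 1 ≤ M) (hS : ε * M ≤ ‖∑ m ∈ Finset.range L, expTurn (p m)‖) :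
    NearInt (1 / ε / M) α := by
  have hM' : (0 : ℝ) < M := by exact_mod_cast hM
  set β := α - round α with hβ
  refine ⟨round α, ?_⟩
  have hpm : ∀ m, expTurn (p m) = expTurn (p 0) * expTurn β ^ m := by
    intro m
    have h1 : p (0 + m) - p 0 = m * α := hp m 0
    rw [zero_add] at h1
    rw [hβ, expTurn_sub_int, ← expTurn_nat_mul, ← expTurn_add, ← h1]
    ring_nf
  rw [Finset.sum_congr rfl fun m _ => hpm m, ← Finset.mul_sum, norm_mul,
    norm_expTurn, one_mul] at hS
  have h2 := mul_geom_sum (expTurn β) L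
  have h3 : ‖expTurn β - 1‖ * ‖∑ i ∈ Finset.range L, expTurn β ^ i‖ ≤ 2 := by
    rw [← norm_mul, h2]
    refine (norm_sub_le _ _).trans ?_
    rw [norm_pow, norm_expTurn, one_pow, norm_one]
    norm_num
  have h4 := four_mul_abs_le_norm_expTurn_sub_one (abs_sub_round α)
  rw [← hβ] at h4 ⊢
  rw [le_div_iff₀ hM', le_div_iff₀ hε]
  have h5 : 4 * |β| * (ε * M) ≤ 2 := (mul_le_mul h4 hS (by positivity) (norm_nonneg _)).trans h3
  nlinarith

/-- If `a` is bounded by `M` on `range L` and has a large sum, then it is often large. -/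
lemma card_filter_ge {a : ℕ → ℝ} {L M : ℕ} {η : ℝ} (hη : 0 ≤ η) (hM : 0 < M) (hLM : L ≤ M)
    (ha : ∀ l ∈ Finset.range L, a l ≤ M) (hsum : 2 * η * M ^ 2 ≤ ∑ l ∈ Finset.range L, a l) :
    η * M ≤ ((Finset.range L).filter fun l => η * M ≤ a l).card := by
  have hM' : (0 : ℝ) < M := by exact_mod_cast hM
  have hLM' : (L : ℝ) ≤ M := by exact_mod_cast hLM
  have h1 : ∑ l ∈ Finset.range L, a l ≤
      ∑ l ∈ Finset.range L, (η * M + if η * M ≤ a l then (M : ℝ) else 0) := by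
    refine Finset.sum_le_sum fun l hl => ?_
    split_ifs with h
    · have := ha l hl
      nlinarith
    · linarith
  rw [Finset.sum_add_distrib, ← Finset.sum_filter, Finset.sum_const, Finset.sum_const,
    Finset.card_range, nsmul_eq_mul, nsmul_eq_mul] at h1
  set c := (((Finset.range L).filter fun l => η * M ≤ a l).card : ℝ)
  have h2 : (L : ℝ) * (η * M) ≤ M * (η * M) := by gcongr
  have h3 : η * M * M ≤ c * M := by nlinarith
  exact le_of_mul_le_mul_right h3 hM'

/-- Weyl's inequality in qualitative form: if an exponential sum with a phase of degree `k + 1`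
is large, then its leading coefficient is close to a rational with bounded denominator. -/
lemma weyl (k : ℕ) : ∀ ε : ℝ, 0 < ε → ∃ Q : ℕ, ∀ (α : ℝ) (p : ℕ → ℝ),
    IsPhase (k + 1) α p → ∀ M L : ℕ, 1 ≤ M → L ≤ M →
    ε * M ≤ ‖∑ m ∈ Finset.range L, expTurn (p m)‖ →
    ∃ q : ℕ, 1 ≤ q ∧ q ≤ Q ∧ NearInt (Q / M ^ (k + 1)) (q * α) := by
  induction k with
  | zero =>
    intro ε hε
    refine ⟨⌈1 / ε⌉₊ + 1, fun α p hp M L hM hL hS => ⟨1, le_rfl, by omega, ?_⟩⟩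
    rw [Nat.cast_one, one_mul, zero_add, pow_one]
    refine (weyl_linear hε hp hM hS).mono ?_
    have := Nat.le_ceil (1 / ε)
    gcongr
    push_cast
    linarith
  | succ k ih =>
    intro ε hε
    by_cases hε1 : ε ≤ 1
    swap
    · refine ⟨0, fun α p hp M L hM hL hS => absurd hε1 (not_not.2 ?_)⟩
      have h1 := hS.trans (norm_sum_expTurn_le p L)
      have h2 : (L : ℝ) ≤ M := by exact_mod_cast hL
      have h3 : (1 : ℝ) ≤ M := by exact_mod_cast hM
      exact le_of_mul_le_mul_right (by linarith : ε * M ≤ 1 * M) (by linarith)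
    set η := ε ^ 2 / 8 with hη
    have hη0 : 0 < η := by positivity
    have hη1 : η ≤ 1 := by nlinarith
    obtain ⟨Q, hQ⟩ := ih η hη0
    set P := Q.factorial with hP
    set M₀ := ⌈32 * (P * Q) / η + 60 / η ^ 2⌉₊ with hM₀
    refine ⟨⌈3 / η * P⌉₊ + ⌈60 * (P * Q) / η ^ 2⌉₊ + M₀ ^ (k + 2) + 1, ?_⟩
    intro α p hp M L hM hL hS
    have hMR : (1 : ℝ) ≤ M := by exact_mod_cast hM
    rcases lt_or_ge M M₀ with hsmall | hlarge
    · refine ⟨1, le_rfl, by omega, ?_⟩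
      refine (nearInt_half _).mono ?_
      rw [le_div_iff₀ (by positivity)]
      have h1 : ((M : ℝ)) ^ (k + 1 + 1) ≤ (M₀ : ℝ) ^ (k + 2) := by
        have : (M : ℝ) ≤ M₀ := by exact_mod_cast hsmall.le
        gcongr
      push_cast
      have h2 : (0 : ℝ) ≤ ((M : ℝ)) ^ (k + 1 + 1) := by positivity
      have h3 : (0 : ℝ) ≤ ⌈3 / η * P⌉₊ := by positivity
      have h4 : (0 : ℝ) ≤ ⌈60 * (P * Q) / η ^ 2⌉₊ := by positivity
      linarith
    have hMbig : 32 * (P * Q) / η + 60 / η ^ 2 ≤ M :=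
      (Nat.le_ceil _).trans (Nat.cast_le.2 hlarge)
    have hpos1 : 0 ≤ 32 * ((P : ℝ) * Q) / η := by positivity
    have hpos2 : 0 ≤ 60 / η ^ 2 := by positivity
    have hM60 : 60 / η ^ 2 ≤ M := by linarith
    have hM32 : 32 * (P * Q) / η ≤ M := by linarith
    set a : ℕ → ℝ := fun l =>
      ‖∑ m ∈ Finset.range (L - 1 - l), expTurn (p (m + (l + 1)) - p m)‖ with ha
    have hsum : 2 * η * M ^ 2 ≤ ∑ l ∈ Finset.range L, a l := by
      have h1 := norm_sq_sum_le p L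
      have h2 : (ε * M) ^ 2 ≤ ‖∑ m ∈ Finset.range L, expTurn (p m)‖ ^ 2 := by gcongr
      have h3 : (L : ℝ) ≤ M := by exact_mod_cast hL
      have h4 : 60 ≤ η * M := by
        rw [div_le_iff₀ (by positivity)] at hM60
        nlinarith
      have h5 : (ε * M) ^ 2 = 8 * η * M ^ 2 := by rw [hη]; ring
      nlinarith
    have haM : ∀ l ∈ Finset.range L, a l ≤ M := by
      intro l _
      refine (norm_sum_expTurn_le _ _).trans ?_
      exact_mod_cast (by omega : L - 1 - l ≤ M)
    have hcard := card_filter_ge hη0.le hM hL haM hsum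
    set G := (Finset.range L).filter fun l => η * M ≤ a l with hG
    have hnear : ∀ l ∈ G, NearInt (P * Q / M ^ (k + 1)) ((l + 1 : ℕ) * (P * α)) := by
      intro l hl
      obtain ⟨-, hl2⟩ := Finset.mem_filter.1 hl
      obtain ⟨q, hq1, hqQ, hq⟩ := hQ _ _ (hp (l + 1)) M (L - 1 - l) hM (by omega) hl2
      obtain ⟨c, hc⟩ := Nat.dvd_factorial hq1 hqQ
      have hcP : c ≤ P := Nat.le_of_dvd (Nat.factorial_pos _) ⟨q, by rw [hP, hc, mul_comm]⟩
      have h1 := hq.nat_mul c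
      have h2 : (c : ℝ) * (q * ((l + 1 : ℕ) * α)) = (l + 1 : ℕ) * (P * α) := by
        rw [hP, hc]
        push_cast
        ring
      rw [h2] at h1
      refine h1.mono ?_
      rw [← mul_div_assoc]
      have : (c : ℝ) ≤ P := by exact_mod_cast hcP
      gcongr
    have hP0 : 0 < P := Nat.factorial_pos _
    have hκ : (P * Q / M ^ (k + 1) : ℝ) ≤ η / 32 := by
      rw [div_le_iff₀ (by positivity)]
      rw [div_le_iff₀ hη0] at hM32
      have : (M : ℝ) ≤ M ^ (k + 1) := le_self_pow₀ hMR (by omega)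
      nlinarith
    obtain ⟨q, hq1, hqη, hq⟩ := exists_strong_recurrence (A := G.image (· + 1)) (α := P * α)
      hη0 hη1 (by positivity) hκ
      (fun l hl => by
        obtain ⟨l', hl', rfl⟩ := Finset.mem_image.1 hl
        have := Finset.mem_range.1 (Finset.mem_filter.1 hl').1
        omega)
      (fun l hl => by
        obtain ⟨l', hl', rfl⟩ := Finset.mem_image.1 hl
        exact hnear l' hl')
      (by rw [Finset.card_image_of_injective _ (add_left_injective 1)]; exact hcard) hM60
    refine ⟨q * P, Nat.mul_pos hq1 hP0, ?_, ?_⟩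
    · have h1 : ((q * P : ℕ) : ℝ) ≤ 3 / η * P := by
        push_cast
        gcongr
      have h2 : q * P ≤ ⌈3 / η * P⌉₊ := by exact_mod_cast h1.trans (Nat.le_ceil _)
      omega
    · push_cast
      rw [mul_assoc]
      refine hq.mono ?_
      have h1 : 60 * (P * Q / M ^ (k + 1)) / (η ^ 2 * M) =
          (60 * (P * Q) / η ^ 2) / (M : ℝ) ^ (k + 1 + 1) := by
        field_simp
        ring
      rw [h1]
      have h2 := Nat.le_ceil (60 * ((P : ℝ) * Q) / η ^ 2)
      have h3 : (0 : ℝ) ≤ ⌈3 / η * P⌉₊ := by positivity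
      have h4 : (0 : ℝ) ≤ (M₀ : ℝ) ^ (k + 2) := by positivity
      gcongr
      linarith

/-- The normalised squared Fourier coefficients of `f`. -/
noncomputable def spectralWeight {N : ℕ} [NeZero N] (f : ZMod N → ℝ) (t : ZMod N) : ℝ :=
  ‖∑ a : ZMod N, (f a : ℂ) * ZMod.stdAddChar (t * a)‖ ^ 2 / N

section Spectral

variable {N : ℕ} [NeZero N] (f : ZMod N → ℝ)

lemma spectralWeight_nonneg (t : ZMod N) : 0 ≤ spectralWeight f t := by
  unfold spectralWeight
  positivity

lemma spectralWeight_zero : spectralWeight f 0 = (∑ a, f a) ^ 2 / N := by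
  unfold spectralWeight
  simp only [zero_mul, AddChar.map_zero_eq_one, mul_one]
  rw [← Complex.ofReal_sum, Complex.norm_real, Real.norm_eq_abs, sq_abs]

lemma stdAddChar_neg_mul_re (t : ZMod N) (y : ℕ) :
    (ZMod.stdAddChar (-(t * (y : ZMod N))) : ℂ).re =
      Real.cos (2 * Real.pi * (y * (t.val / N))) := by
  have h1 : -(t * (y : ZMod N)) = ((-(t.val * y : ℤ) : ℤ) : ZMod N) := by
    push_cast
    rw [ZMod.natCast_zmod_val]
  rw [h1, ZMod.stdAddChar_coe]
  have h2 : 2 * (Real.pi : ℂ) * Complex.I * ((-(t.val * y : ℤ) : ℤ) : ℂ) / N =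
      ((-(2 * Real.pi * (y * (t.val / N))) : ℝ) : ℂ) * Complex.I := by
    push_cast
    ring
  rw [h2, Complex.exp_ofReal_mul_I_re, Real.cos_neg]

/-- Correlations are the Fourier transform of the spectral weight. -/
lemma sum_mul_shift_eq (y : ℕ) :
    ∑ a, f a * f (a + y) =
      ∑ t, spectralWeight f t * Real.cos (2 * Real.pi * (y * (t.val / N))) := by
  have hN : (N : ℂ) ≠ 0 := by exact_mod_cast NeZero.ne N
  have hsq : ∀ t : ZMod N,
      ((‖∑ a : ZMod N, (f a : ℂ) * ZMod.stdAddChar (t * a)‖ ^ 2 : ℝ) : ℂ) =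
        ∑ a : ZMod N, ∑ b : ZMod N, (f a : ℂ) * f b * ZMod.stdAddChar (t * (b - a)) := by
    intro t
    push_cast
    rw [← Complex.conj_mul', map_sum, Finset.sum_mul_sum]
    refine Finset.sum_congr rfl fun a _ => Finset.sum_congr rfl fun b _ => ?_
    rw [map_mul, Complex.conj_ofReal, ← AddChar.map_neg_eq_conj, mul_sub, sub_eq_neg_add,
      AddChar.map_add_eq_mul]
    ring
  have horth : ∀ a b : ZMod N,
      ∑ t : ZMod N, (ZMod.stdAddChar (t * (b - a - (y : ZMod N))) : ℂ) =
        if b = a + y then (N : ℂ) else 0 := by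
    intro a b
    rw [AddChar.sum_mulShift _ (ZMod.isPrimitive_stdAddChar N), ZMod.card]
    have : b - a - y = 0 ↔ b = a + y := by rw [sub_sub, sub_eq_zero]
    simp only [this]
    split_ifs <;> simp
  have key : ∑ t : ZMod N, (spectralWeight f t : ℂ) * ZMod.stdAddChar (-(t * (y : ZMod N))) =
      ((∑ a, f a * f (a + y) : ℝ) : ℂ) := by
    calc ∑ t : ZMod N, (spectralWeight f t : ℂ) * ZMod.stdAddChar (-(t * (y : ZMod N)))
        = ∑ t : ZMod N, ∑ a : ZMod N, ∑ b : ZMod N,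
          (f a : ℂ) * f b / N * ZMod.stdAddChar (t * (b - a - (y : ZMod N))) := by
          refine Finset.sum_congr rfl fun t _ => ?_
          rw [spectralWeight, Complex.ofReal_div, hsq, Complex.ofReal_natCast, Finset.sum_div,
            Finset.sum_mul]
          refine Finset.sum_congr rfl fun a _ => ?_
          rw [Finset.sum_div, Finset.sum_mul]
          refine Finset.sum_congr rfl fun b _ => ?_
          rw [mul_sub t (b - a), sub_eq_add_neg (t * (b - a)), AddChar.map_add_eq_mul]
          ring
      _ = ∑ a : ZMod N, ∑ b : ZMod N, (f a : ℂ) * f b / N * if b = a + y then (N : ℂ) else 0 := by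
          rw [Finset.sum_comm]
          refine Finset.sum_congr rfl fun a _ => ?_
          rw [Finset.sum_comm]
          refine Finset.sum_congr rfl fun b _ => ?_
          rw [← Finset.mul_sum, horth]
      _ = _ := by
          push_cast
          refine Finset.sum_congr rfl fun a _ => ?_
          simp only [mul_ite, mul_zero, Finset.sum_ite_eq', Finset.mem_univ, if_true]
          field_simp
  have := congrArg Complex.re key
  rw [Complex.re_sum, Complex.ofReal_re] at this
  rw [← this]
  refine Finset.sum_congr rfl fun t _ => ?_
  rw [Complex.re_ofReal_mul, stdAddChar_neg_mul_re]

lemma sum_spectralWeight : ∑ t, spectralWeight f t = ∑ a, f a ^ 2 := by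
  have := sum_mul_shift_eq f 0
  simp only [Nat.cast_zero, add_zero, zero_mul, mul_zero, Real.cos_zero, mul_one] at this
  rw [← this]
  exact Finset.sum_congr rfl fun a _ => (sq (f a)).symm

end Spectral

lemma cos_nonneg_of_nearInt {x : ℝ} (hx : NearInt (1 / 4) x) : 0 ≤ Real.cos (2 * Real.pi * x) := by
  obtain ⟨z, hz⟩ := hx
  have h1 : Real.cos (2 * Real.pi * x) = Real.cos (2 * Real.pi * (x - z)) := by
    rw [← Real.cos_sub_int_mul_two_pi _ z]
    ring_nf
  have hpi := Real.pi_pos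
  rw [abs_le] at hz
  rw [h1]
  exact Real.cos_nonneg_of_neg_pi_div_two_le_of_le (by nlinarith) (by nlinarith)

lemma exists_maximal_pow {B k : ℕ} (hB : 0 < B) (hk : 0 < k) {N M₀ : ℕ} (hM₀ : 0 < M₀)
    (hN : B * M₀ ^ k ≤ N) :
    ∃ M, M₀ ≤ M ∧ B * M ^ k ≤ N ∧ N ≤ B * 2 ^ k * M ^ k := by
  set M := Nat.findGreatest (fun m => B * m ^ k ≤ N) N with hM
  have hbound : ∀ m, B * m ^ k ≤ N → m ≤ N := fun m hm =>
    (Nat.le_self_pow hk.ne' m).trans ((Nat.le_mul_of_pos_left _ hB).trans hm)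
  have h1 : M₀ ≤ M := Nat.le_findGreatest (hbound _ hN) hN
  have h2 : B * M ^ k ≤ N :=
    Nat.findGreatest_spec (P := fun m => B * m ^ k ≤ N) (hbound _ hN) hN
  refine ⟨M, h1, h2, ?_⟩
  have h3 : N < B * (M + 1) ^ k := by
    by_contra! h
    have := Nat.le_findGreatest (P := fun m => B * m ^ k ≤ N) (hbound _ h) h
    omega
  refine h3.le.trans ?_
  rw [mul_assoc, ← mul_pow]
  gcongr
  omega

lemma exists_residue {h : ℤ[X]} (hint : ∀ d : ℕ, 0 < d → ∃ n : ℤ, (d : ℤ) ∣ h.eval n)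
    {D : ℕ} (hD : 0 < D) : ∃ r : ℕ, ∀ j : ℕ, (D : ℤ) ∣ h.eval ((r + D * j : ℕ) : ℤ) := by
  obtain ⟨n, hn⟩ := hint D hD
  have hDZ : (D : ℤ) ≠ 0 := by exact_mod_cast hD.ne'
  refine ⟨(n % D).toNat, fun j => ?_⟩
  have h1 : (D : ℤ) ∣ (((n % D).toNat + D * j : ℕ) : ℤ) - n := by
    push_cast
    rw [Int.toNat_of_nonneg (Int.emod_nonneg _ hDZ)]
    refine ⟨j - n / D, ?_⟩
    linear_combination Int.emod_add_mul_ediv n D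
  have h2 := h1.trans (sub_dvd_eval_sub (((n % D).toNat + D * j : ℕ) : ℤ) n h)
  exact (dvd_iff_dvd_of_dvd_sub h2).2 hn

lemma eval_map_natCast (P : ℤ[X]) (n : ℕ) :
    (P.map (Int.castRingHom ℝ)).eval (n : ℝ) = ((P.eval (n : ℤ) : ℤ) : ℝ) := by
  rw [← Int.cast_natCast, eval_intCast_map]
  simp

lemma exists_growth {h : ℤ[X]} {k : ℕ} (hk : 1 ≤ k) (hdeg : h.natDegree = k)
    (hpos' : ∀ n : ℕ, 0 < h.derivative.eval (n : ℤ)) :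
    ∃ C x₀ : ℕ, 0 < C ∧ 0 < x₀ ∧ ∀ n : ℕ, x₀ ≤ n →
      ((h.eval (n : ℤ) : ℤ) : ℝ) ≤ C * n ^ k ∧
      (n : ℝ) ^ (k - 1) ≤ C * ((h.derivative.eval (n : ℤ) : ℤ) : ℝ) := by
  set H := h.map (Int.castRingHom ℝ) with hH
  have hHdeg : H.natDegree = k := by
    rw [hH, natDegree_map_eq_of_injective (RingHom.injective_int _), hdeg]
  have hd' : H.derivative.degree = ((k - 1 : ℕ) : WithBot ℕ) := by
    rw [degree_derivative (by omega), hHdeg]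
  have hd : H.degree ≤ (X ^ k : ℝ[X]).degree := by
    rw [degree_X_pow]
    exact degree_le_of_natDegree_le hHdeg.le
  have hd2 : (X ^ (k - 1) : ℝ[X]).degree ≤ H.derivative.degree := by
    rw [degree_X_pow, hd']
  obtain ⟨C₁, hC₁⟩ := (isBigO_atTop_of_degree_le H _ hd).bound
  obtain ⟨C₂, hC₂⟩ := (isBigO_atTop_of_degree_le _ H.derivative hd2).bound
  obtain ⟨x₁, hx₁⟩ := Filter.eventually_atTop.1 (hC₁.and hC₂)
  refine ⟨⌈max C₁ C₂⌉₊ + 1, ⌈x₁⌉₊ + 1, by omega, by omega, fun n hn => ?_⟩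
  have hn' : x₁ ≤ n := (Nat.le_ceil _).trans (by exact_mod_cast (by omega : ⌈x₁⌉₊ ≤ n))
  obtain ⟨h1, h2⟩ := hx₁ n hn'
  have hC : max C₁ C₂ ≤ ((⌈max C₁ C₂⌉₊ + 1 : ℕ) : ℝ) := by
    push_cast
    linarith [Nat.le_ceil (max C₁ C₂)]
  have hc1 := (le_max_left C₁ C₂).trans hC
  have hc2 := (le_max_right C₁ C₂).trans hC
  simp only [eval_pow, eval_X, norm_pow, Real.norm_natCast, hH, derivative_map,
    eval_map_natCast] at h1 h2
  have hp : (0 : ℝ) < ((h.derivative.eval (n : ℤ) : ℤ) : ℝ) := by exact_mod_cast hpos' n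
  rw [Real.norm_of_nonneg hp.le] at h2
  constructor
  · refine (Real.le_norm_self _).trans (h1.trans ?_)
    gcongr
  · refine h2.trans ?_
    gcongr

lemma NearInt.neg {c x : ℝ} (hx : NearInt c x) : NearInt c (-x) := by
  obtain ⟨z, hz⟩ := hx
  refine ⟨-z, ?_⟩
  rw [abs_sub_comm] at hz
  push_cast
  rwa [sub_neg_eq_add, neg_add_eq_sub]

lemma NearInt.int_mul {c x : ℝ} (hx : NearInt c x) {w : ℤ} (hw : 0 ≤ w) :
    NearInt (w * c) (w * x) := by
  lift w to ℕ using hw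
  exact_mod_cast hx.nat_mul w

/-- The phases `h(r + D(M + m))θ` satisfy Weyl's inequality uniformly in `M`. -/
lemma exists_weyl_polynomial {h : ℤ[X]} {k : ℕ} (hk : 1 ≤ k) (hdeg : h.natDegree = k) {D : ℕ}
    (hD : 0 < D) (r : ℕ) {ε : ℝ} (hε : 0 < ε) :
    ∃ u Q : ℕ, 0 < u ∧ ∀ (θ : ℝ) (M : ℕ), 1 ≤ M →
      ε * M ≤ ‖∑ m ∈ Finset.range M,
        expTurn (((h.eval ((r + D * (M + m) : ℕ) : ℤ) : ℤ) : ℝ) * θ)‖ →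
      NearInt (Q / M ^ k) ((D * u : ℕ) * θ) := by
  obtain ⟨j, rfl⟩ : ∃ j, k = j + 1 := ⟨k - 1, by omega⟩
  obtain ⟨Q, hQ⟩ := weyl j ε hε
  set a := h.coeff (j + 1) with ha
  have ha0 : a ≠ 0 := by
    rw [ha, ← hdeg, coeff_natDegree, leadingCoeff_ne_zero]
    rintro rfl
    simp at hdeg
  refine ⟨Q.factorial * (D ^ j * (j + 1).factorial * a.natAbs), Q.factorial * Q, ?_, ?_⟩
  · have := Int.natAbs_pos.2 ha0
    positivity
  intro θ M hM hS
  have hphase := ((isPhase_eval (j + 1) (h.map (Int.castRingHom ℝ))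
    (natDegree_map_le.trans hdeg.le)).comp_affine (r + D * M) D).const_mul θ
  obtain ⟨q, hq1, hqQ, hq⟩ := hQ _ _ hphase M M hM le_rfl (by
    refine hS.trans_eq ?_
    congr 1
    refine Finset.sum_congr rfl fun m _ => ?_
    rw [eval_map_natCast, mul_add, add_assoc])
  rw [coeff_map, ← ha, eq_intCast] at hq
  obtain ⟨c, hc⟩ := Nat.dvd_factorial hq1 hqQ
  have hcQ : c ≤ Q.factorial := Nat.le_of_dvd (Nat.factorial_pos _) ⟨q, by rw [hc, mul_comm]⟩
  have h1 : NearInt (c * (Q / M ^ (j + 1)))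
      ((D * (Q.factorial * (D ^ j * (j + 1).factorial * a.natAbs)) : ℕ) * θ) := by
    rw [hc]
    have h2 := hq.nat_mul c
    rcases Int.natAbs_eq a with hs | hs
    · convert h2 using 1
      have : (a : ℝ) = (a.natAbs : ℝ) :=
        (congrArg (Int.cast (R := ℝ)) hs).trans (Int.cast_natCast _)
      rw [this]
      push_cast
      ring
    · convert h2.neg using 1
      have : (a : ℝ) = -(a.natAbs : ℝ) :=
        (congrArg (Int.cast (R := ℝ)) hs).trans (by rw [Int.cast_neg, Int.cast_natCast])
      rw [this]
      push_cast
      ring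
  refine h1.mono ?_
  have : (c : ℝ) ≤ Q.factorial := by exact_mod_cast hcQ
  push_cast
  rw [← mul_div_assoc]
  gcongr

/-- One step of the iteration: at the level `(D, κ)` there is a family of values of `h` whose
exponential sums are essentially nonnegative on the major arcs `‖Dθ‖ ≤ κ / N` and small outside
the larger major arcs `‖D'θ‖ ≤ κ' / N`. -/
lemma exists_scale_s16 {h : ℤ[X]} {k : ℕ} (hk : 1 ≤ k) (hdeg : h.natDegree = k)
    (hint : ∀ d : ℕ, 0 < d → ∃ n : ℤ, (d : ℤ) ∣ h.eval n)
    (hpos : ∀ n : ℕ, 0 < h.eval (n : ℤ)) (hpos' : ∀ n : ℕ, 0 < h.derivative.eval (n : ℤ))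
    {D : ℕ} (hD : 0 < D) {κ : ℝ} (hκ : 0 ≤ κ) {ε : ℝ} (hε : 0 < ε) :
    ∃ (D' : ℕ) (κ' c : ℝ) (N₀ : ℕ), 0 < D' ∧ 0 ≤ κ' ∧ 0 < c ∧
      (∀ (N : ℕ) (θ : ℝ), NearInt (κ / N) (D * θ) → NearInt (κ' / N) (D' * θ)) ∧
      ∀ N : ℕ, N₀ ≤ N → ∃ (M : ℕ) (n : ℕ → ℕ), 0 < M ∧ StrictMono n ∧
        (∀ m < M, 2 * h.eval (n m : ℤ) < N ∧
          c * N ≤ M * ((h.derivative.eval (n m : ℤ) : ℤ) : ℝ) ∧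
          ∀ θ : ℝ, NearInt (κ / N) (D * θ) →
            NearInt (1 / 4) (((h.eval (n m : ℤ) : ℤ) : ℝ) * θ)) ∧
        ∀ θ : ℝ, ¬ NearInt (κ' / N) (D' * θ) →
          ‖∑ m ∈ Finset.range M, expTurn (((h.eval (n m : ℤ) : ℤ) : ℝ) * θ)‖ ≤ ε * M := by
  obtain ⟨C, x₀, hC, hx₀, hgrow⟩ := exists_growth hk hdeg hpos'
  obtain ⟨r, hr⟩ := exists_residue hint hD
  obtain ⟨u, Q, hu, hweyl⟩ := exists_weyl_polynomial hk hdeg hD r hε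
  set B := ⌈(2 + 4 * κ) * (C * (r + 2 * D) ^ k)⌉₊ + 1 with hB
  have hBle : (2 + 4 * κ) * (C * (r + 2 * D) ^ k) < B := by
    rw [hB]
    push_cast
    linarith [Nat.le_ceil ((2 + 4 * κ) * (C * ((r : ℝ) + 2 * D) ^ k))]
  have hB0 : 0 < B := by omega
  refine ⟨D * u, Q * (B * 2 ^ k) + u * κ, 1 / (C * (B * 2 ^ k)), B * x₀ ^ k,
    Nat.mul_pos hD hu, by positivity, by positivity, ?_, ?_⟩
  · intro N θ hθ
    have h1 := hθ.nat_mul u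
    have h2 : (u : ℝ) * (D * θ) = (D * u : ℕ) * θ := by
      push_cast
      ring
    rw [h2] at h1
    refine h1.mono ?_
    rw [← mul_div_assoc]
    gcongr
    have : (0 : ℝ) ≤ Q * (B * 2 ^ k) := by positivity
    linarith
  intro N hN
  obtain ⟨M, hxM, hBM, hNM⟩ := exists_maximal_pow hB0 hk hx₀ hN
  have hM : 0 < M := by omega
  have hMR : (1 : ℝ) ≤ M := by exact_mod_cast hM
  have hBMR : (B : ℝ) * M ^ k ≤ N := by exact_mod_cast hBM
  have hNMR : (N : ℝ) ≤ B * 2 ^ k * M ^ k := by exact_mod_cast hNM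
  have hN0 : (0 : ℝ) < N := lt_of_lt_of_le (by positivity) hBMR
  refine ⟨M, fun m => r + D * (M + m), hM, ?_, ?_, ?_⟩
  · intro m m' hmm
    have : D * (M + m) < D * (M + m') := Nat.mul_lt_mul_of_pos_left (by omega) hD
    simp only
    omega
  · intro m hm
    set n := r + D * (M + m) with hn
    have hnM : M ≤ n := by nlinarith
    have hnM' : n ≤ (r + 2 * D) * M := by nlinarith
    obtain ⟨g1, g2⟩ := hgrow n (hxM.trans hnM)
    have hup : ((h.eval (n : ℤ) : ℤ) : ℝ) ≤ C * (r + 2 * D) ^ k * M ^ k := by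
      refine g1.trans ?_
      have : (n : ℝ) ≤ (r + 2 * D) * M := by exact_mod_cast hnM'
      rw [mul_assoc, ← mul_pow]
      gcongr
    have hall : (2 + 4 * κ) * ((h.eval (n : ℤ) : ℤ) : ℝ) < N := by
      calc (2 + 4 * κ) * ((h.eval (n : ℤ) : ℤ) : ℝ)
          ≤ (2 + 4 * κ) * (C * (r + 2 * D) ^ k * M ^ k) := by gcongr
        _ = (2 + 4 * κ) * (C * (r + 2 * D) ^ k) * M ^ k := by ring
        _ < B * M ^ k := by gcongr
        _ ≤ N := hBMR
    have hhpos : (0 : ℝ) < ((h.eval (n : ℤ) : ℤ) : ℝ) := by exact_mod_cast hpos n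
    refine ⟨?_, ?_, ?_⟩
    · have : 2 * ((h.eval (n : ℤ) : ℤ) : ℝ) < N := by nlinarith
      exact_mod_cast this
    · rw [div_mul_eq_mul_div, one_mul, div_le_iff₀ (by positivity)]
      calc (N : ℝ) ≤ B * 2 ^ k * (M * M ^ (k - 1)) := by
            rw [← pow_succ', Nat.sub_add_cancel hk]
            exact hNMR
        _ ≤ B * 2 ^ k * (M * (C * ((h.derivative.eval (n : ℤ) : ℤ) : ℝ))) := by
            have : (M : ℝ) ≤ n := by exact_mod_cast hnM
            have : (M : ℝ) ^ (k - 1) ≤ n ^ (k - 1) := by gcongr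
            have := this.trans g2
            gcongr
        _ = _ := by ring
    · intro θ hθ
      obtain ⟨w, hw⟩ := hr (M + m)
      rw [← hn] at hw
      have hw0 : 0 ≤ w := by
        have := hpos n
        rw [hw] at this
        exact (pos_of_mul_pos_right this (Int.natCast_nonneg D)).le
      have hwR : ((h.eval (n : ℤ) : ℤ) : ℝ) = D * w := by rw [hw]; push_cast; rfl
      have h1 := hθ.int_mul hw0
      have h2 : (w : ℝ) * (D * θ) = ((h.eval (n : ℤ) : ℤ) : ℝ) * θ := by rw [hwR]; ring
      rw [h2] at h1
      refine h1.mono ?_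
      rw [← mul_div_assoc, div_le_iff₀ hN0]
      have hw' : (w : ℝ) ≤ ((h.eval (n : ℤ) : ℤ) : ℝ) := by
        rw [hwR]
        have h3 : (1 : ℝ) ≤ D := by exact_mod_cast hD
        have h4 : (0 : ℝ) ≤ w := by exact_mod_cast hw0
        nlinarith
      nlinarith
  · intro θ hθ
    by_contra! hlt
    refine hθ ((hweyl θ M hM hlt.le).mono ?_)
    rw [div_le_div_iff₀ (by positivity) hN0]
    have h1 : (0 : ℝ) ≤ u * κ * M ^ k := by positivity
    have h2 : (Q : ℝ) * N ≤ Q * (B * 2 ^ k * M ^ k) := by gcongr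
    linarith

lemma strictMono_eval_natCast {h : ℤ[X]}
    (hmono : StrictMonoOn (fun x => (h.map (Int.castRingHom ℝ)).eval x) (Set.Ici 0)) :
    StrictMono fun n : ℕ => h.eval (n : ℤ) := by
  intro a b hab
  have := hmono (Set.mem_Ici.2 (Nat.cast_nonneg a)) (Set.mem_Ici.2 (Nat.cast_nonneg b))
    (by exact_mod_cast hab : (a : ℝ) < b)
  simp only [eval_map_natCast] at this
  exact_mod_cast this

lemma Sf_nonneg {h : ℤ[X]} (hpos' : ∀ n : ℕ, 0 < h.derivative.eval (n : ℤ)) (N : ℕ)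
    (x : ZMod N) : 0 ≤ Sf N h x := by
  unfold Sf
  split_ifs with hx
  · exact_mod_cast (hpos' _).le
  · exact le_rfl

lemma val_eval_natCast {N : ℕ} {y : ℤ} (hy : 0 < y) (hyN : 2 * y < N) :
    (((y.toNat : ZMod N)).val : ℤ) = y := by
  rw [ZMod.val_natCast, Nat.mod_eq_of_lt (by omega)]
  omega

lemma Sf_eval {h : ℤ[X]} (hinj : Function.Injective fun n : ℕ => h.eval (n : ℤ)) {N n : ℕ}
    (hy : 0 < h.eval (n : ℤ)) (hyN : 2 * h.eval (n : ℤ) < N) :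
    Sf N h ((h.eval (n : ℤ)).toNat : ZMod N) = ((h.derivative.eval (n : ℤ) : ℤ) : ℝ) := by
  have hv := val_eval_natCast hy hyN
  have hx : 0 < ((h.eval (n : ℤ)).toNat : ZMod N).val ∧
      2 * ((h.eval (n : ℤ)).toNat : ZMod N).val < N ∧
      ∃ m : ℕ, (((h.eval (n : ℤ)).toNat : ZMod N).val : ℤ) = h.eval (m : ℤ) :=
    ⟨by omega, by omega, n, hv⟩
  rw [Sf, dif_pos hx]
  have h1 : n = hx.2.2.choose := hinj (hv.symm.trans hx.2.2.choose_spec)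
  rw [← h1]

/-- Restricting the count to a finite family of values of `h`. -/
lemma sum_family_le {h : ℤ[X]} (hinj : Function.Injective fun n : ℕ => h.eval (n : ℤ))
    (hpos : ∀ n : ℕ, 0 < h.eval (n : ℤ)) (hpos' : ∀ n : ℕ, 0 < h.derivative.eval (n : ℤ))
    {N : ℕ} [NeZero N] {f : ZMod N → ℝ} (hf : ∀ n, 0 ≤ f n) {M : ℕ} {n : ℕ → ℕ}
    (hn : Function.Injective n) {b : ℝ}
    (hN : ∀ m < M, 2 * h.eval (n m : ℤ) < N)
    (hb : ∀ m < M, b ≤ ((h.derivative.eval (n m : ℤ) : ℤ) : ℝ)) :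
    b * ∑ m ∈ Finset.range M, ∑ a, f a * f (a + ((h.eval (n m : ℤ)).toNat : ZMod N)) ≤
      ∑ a, ∑ d, f a * f (a + d) * Sf N h d := by
  rw [Finset.sum_comm (s := Finset.univ) (t := Finset.univ), Finset.mul_sum]
  set g : ℕ → ZMod N := fun m => ((h.eval (n m : ℤ)).toNat : ZMod N) with hg
  have hginj : Set.InjOn g (Finset.range M) := by
    intro i hi j hj hij
    have h1 := val_eval_natCast (hpos (n i)) (hN i (Finset.mem_range.1 hi))
    have h2 := val_eval_natCast (hpos (n j)) (hN j (Finset.mem_range.1 hj))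
    have h3 : ((g i).val : ℤ) = (g j).val := by rw [hij]
    exact hn (hinj (h1.symm.trans (h3.trans h2)))
  calc ∑ m ∈ Finset.range M, b * ∑ a, f a * f (a + g m)
      ≤ ∑ m ∈ Finset.range M, ∑ a, f a * f (a + g m) * Sf N h (g m) := by
        refine Finset.sum_le_sum fun m hm => ?_
        have hm' := Finset.mem_range.1 hm
        rw [← Finset.sum_mul, mul_comm b, hg, Sf_eval hinj (hpos _) (hN m hm')]
        exact mul_le_mul_of_nonneg_left (hb m hm')
          (Finset.sum_nonneg fun a _ => mul_nonneg (hf _) (hf _))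
    _ = ∑ d ∈ (Finset.range M).image g, ∑ a, f a * f (a + d) * Sf N h d :=
        (Finset.sum_image (f := fun d => ∑ a, f a * f (a + d) * Sf N h d) hginj).symm
    _ ≤ ∑ d, ∑ a, f a * f (a + d) * Sf N h d :=
        Finset.sum_le_sum_of_subset_of_nonneg (Finset.subset_univ _) fun d _ _ =>
          Finset.sum_nonneg fun a _ =>
            mul_nonneg (mul_nonneg (hf _) (hf _)) (Sf_nonneg hpos' N d)

/-- The spectral energy of `f` outside the major arcs `‖Dt/N‖ ≤ κ / N`. -/
noncomputable def minorEnergy {N : ℕ} [NeZero N] (f : ZMod N → ℝ) (D : ℕ) (κ : ℝ) : ℝ :=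
  ∑ t, if NearInt (κ / N) (D * ((t.val : ℝ) / N)) then 0 else spectralWeight f t

/-- If a family of frequencies has exponential sums that are nonnegative on the major arcs at
level `(D, κ)` and small outside those at level `(D', κ')`, then the average correlation is
bounded below up to the energy between the two levels. -/
lemma sum_correlation_ge {N : ℕ} [NeZero N] (f : ZMod N → ℝ) {D D' : ℕ} {κ κ' ε : ℝ}
    (hκ : 0 ≤ κ) (hε : 0 ≤ ε) {M : ℕ} {y : ℕ → ℕ}
    (hnest : ∀ θ : ℝ, NearInt (κ / N) (D * θ) → NearInt (κ' / N) (D' * θ))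
    (hmajor : ∀ m < M, ∀ θ : ℝ, NearInt (κ / N) (D * θ) → NearInt (1 / 4) (y m * θ))
    (hminor : ∀ θ : ℝ, ¬ NearInt (κ' / N) (D' * θ) →
      ‖∑ m ∈ Finset.range M, expTurn (y m * θ)‖ ≤ ε * M) :
    M * ((∑ a, f a) ^ 2 / N - minorEnergy f D κ + minorEnergy f D' κ' - ε * ∑ a, f a ^ 2) ≤
      ∑ m ∈ Finset.range M, ∑ a, f a * f (a + y m) := by
  simp only [sum_mul_shift_eq]
  rw [Finset.sum_comm]
  have hzero : (∑ a, f a) ^ 2 / N = ∑ t, if t = 0 then spectralWeight f t else 0 := by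
    rw [← spectralWeight_zero]
    simp
  rw [hzero, ← sum_spectralWeight, minorEnergy, minorEnergy, Finset.mul_sum,
    ← Finset.sum_sub_distrib, ← Finset.sum_add_distrib, ← Finset.sum_sub_distrib,
    Finset.mul_sum]
  refine Finset.sum_le_sum fun t _ => ?_
  rw [← Finset.mul_sum]
  set w := spectralWeight f t
  have hw : 0 ≤ w := spectralWeight_nonneg f t
  set θ : ℝ := (t.val : ℝ) / N with hθ
  set S := ∑ m ∈ Finset.range M, Real.cos (2 * Real.pi * (y m * θ)) with hS
  have hre : S = (∑ m ∈ Finset.range M, expTurn (y m * θ)).re := by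
    rw [Complex.re_sum]
    simp only [expTurn_re, hS]
  have habs : |S| ≤ ‖∑ m ∈ Finset.range M, expTurn (y m * θ)‖ := by
    rw [hre]
    exact Complex.abs_re_le_norm _
  have hM : (0 : ℝ) ≤ M := Nat.cast_nonneg M
  have hMw : 0 ≤ M * w := mul_nonneg hM hw
  have hεw : 0 ≤ ε * (M * w) := mul_nonneg hε hMw
  rcases eq_or_ne t 0 with ht | ht
  · have hθ0 : θ = 0 := by simp [hθ, ht]
    have hSM : S = M := by simp [hS, hθ0]
    have hN0 : NearInt (κ / N) (D * θ) := ⟨0, by rw [hθ0]; simp; positivity⟩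
    rw [if_pos ht, if_pos hN0, if_pos (hnest θ hN0), hSM]
    linarith
  rw [if_neg ht]
  by_cases h1 : NearInt (κ / N) (D * θ)
  · rw [if_pos h1, if_pos (hnest θ h1)]
    have hS0 : 0 ≤ S := Finset.sum_nonneg fun m hm =>
      cos_nonneg_of_nearInt (hmajor m (Finset.mem_range.1 hm) θ h1)
    have := mul_nonneg hw hS0
    linarith
  rw [if_neg h1]
  by_cases h2 : NearInt (κ' / N) (D' * θ)
  · rw [if_pos h2]
    have h3 : -(M : ℝ) ≤ S := (abs_le.1 (habs.trans (norm_sum_expTurn_le _ M))).1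
    have := mul_le_mul_of_nonneg_left h3 hw
    linarith
  · rw [if_neg h2]
    have h3 : -(ε * M) ≤ S := (abs_le.1 (habs.trans (hminor θ h2))).1
    have := mul_le_mul_of_nonneg_left h3 hw
    linarith

lemma minorEnergy_le {N : ℕ} [NeZero N] (f : ZMod N → ℝ) (D : ℕ) (κ : ℝ) :
    minorEnergy f D κ ≤ ∑ a, f a ^ 2 := by
  rw [← sum_spectralWeight]
  refine Finset.sum_le_sum fun t _ => ?_
  have := spectralWeight_nonneg f t
  split_ifs <;> linarith

lemma minorEnergy_nonneg {N : ℕ} [NeZero N] (f : ZMod N → ℝ) (D : ℕ) (κ : ℝ) :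
    0 ≤ minorEnergy f D κ := by
  refine Finset.sum_nonneg fun t _ => ?_
  have := spectralWeight_nonneg f t
  split_ifs <;> linarith

lemma sum_sq_le {N : ℕ} [NeZero N] {f : ZMod N → ℝ} (hf : ∀ n, 0 ≤ f n ∧ f n ≤ 1) :
    ∑ a, f a ^ 2 ≤ N := by
  have : ∑ a, f a ^ 2 ≤ ∑ _a : ZMod N, (1 : ℝ) :=
    Finset.sum_le_sum fun a _ => pow_le_one₀ (hf a).1 (hf a).2
  simpa [ZMod.card] using this

/-- Energy increment: the count is large for functions whose energy outside the major arcs at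
level `(D, κ)` is less than `I · εN`, where `ε = δ² / 4`. -/
lemma exists_count_ge_of_minorEnergy_lt {h : ℤ[X]} {k : ℕ} (hk : 1 ≤ k) (hdeg : h.natDegree = k)
    (hint : ∀ d : ℕ, 0 < d → ∃ n : ℤ, (d : ℤ) ∣ h.eval n)
    (hinj : Function.Injective fun n : ℕ => h.eval (n : ℤ))
    (hpos : ∀ n : ℕ, 0 < h.eval (n : ℤ)) (hpos' : ∀ n : ℕ, 0 < h.derivative.eval (n : ℤ))
    {δ : ℝ} (hδ : 0 < δ) (I : ℕ) : ∀ D : ℕ, 0 < D → ∀ κ : ℝ, 0 ≤ κ →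
    ∃ c : ℝ, 0 < c ∧ ∃ N₀ : ℕ, ∀ (N : ℕ) [NeZero N], N₀ ≤ N →
      ∀ f : ZMod N → ℝ, (∀ n, 0 ≤ f n ∧ f n ≤ 1) →
        δ ≤ (∑ n : ZMod N, f n) / (N : ℝ) → minorEnergy f D κ < I * (δ ^ 2 / 4 * N) →
        c * (N : ℝ) ^ 2 ≤ ∑ a : ZMod N, ∑ d : ZMod N, f a * f (a + d) * Sf N h d := by
  induction I with
  | zero =>
    intro D _ κ _
    refine ⟨1, one_pos, 0, fun N _ _ f _ _ hE => absurd hE (not_lt.2 ?_)⟩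
    rw [Nat.cast_zero, zero_mul]
    exact minorEnergy_nonneg f D κ
  | succ I ih =>
    intro D hD κ hκ
    set ε := δ ^ 2 / 4 with hε
    have hε0 : 0 < ε := by positivity
    obtain ⟨D', κ', c₁, N₁, hD', hκ', hc₁, hnest, hscale⟩ :=
      exists_scale_s16 hk hdeg hint hpos hpos' hD hκ hε0
    obtain ⟨c₂, hc₂, N₂, hrec⟩ := ih D' hD' κ' hκ'
    refine ⟨min c₂ (c₁ * (δ ^ 2 / 2)), lt_min hc₂ (by positivity), max N₁ N₂, ?_⟩
    intro N _ hN f hf hmean hE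
    rcases lt_or_ge (minorEnergy f D' κ') (I * (ε * N)) with hlt | hge
    · refine le_trans ?_ (hrec N ((le_max_right _ _).trans hN) f hf hmean hlt)
      gcongr
      exact min_le_left _ _
    obtain ⟨M, n, hM, hn, hfam, hminor⟩ := hscale N ((le_max_left _ _).trans hN)
    have hcast : ∀ m, (((h.eval (n m : ℤ)).toNat : ℕ) : ℝ) = ((h.eval (n m : ℤ) : ℤ) : ℝ) := by
      intro m
      rw [← Int.cast_natCast, Int.toNat_of_nonneg (hpos _).le]
    have hN0 : (0 : ℝ) < N := by exact_mod_cast Nat.pos_of_ne_zero (NeZero.ne N)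
    have hM0 : (0 : ℝ) < M := by exact_mod_cast hM
    have hcorr := sum_correlation_ge f (D := D) (D' := D') (κ' := κ') hκ hε0.le (M := M)
      (y := fun m => (h.eval (n m : ℤ)).toNat) (hnest N)
      (fun m hm θ hθ => by
        rw [hcast]
        exact (hfam m hm).2.2 θ hθ)
      (fun θ hθ => by
        simp only [hcast]
        exact hminor θ hθ)
    have hsum := sum_family_le hinj hpos hpos' (fun a => (hf a).1) hn.injective
      (b := c₁ * N / M) (fun m hm => (hfam m hm).1) (fun m hm => by
        rw [div_le_iff₀ hM0, mul_comm _ (M : ℝ)]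
        exact (hfam m hm).2.1)
    have hw0 : δ ^ 2 * N ≤ (∑ a, f a) ^ 2 / N := by
      rw [le_div_iff₀ hN0] at hmean ⊢
      calc δ ^ 2 * N * N = (δ * N) ^ 2 := by ring
        _ ≤ _ := by gcongr
    have hsq := mul_le_mul_of_nonneg_left (sum_sq_le hf) hε0.le
    have hE' : minorEnergy f D κ < I * (ε * N) + ε * N := by
      push_cast at hE
      linarith
    have hlower : δ ^ 2 / 2 * N ≤ (∑ a, f a) ^ 2 / N - minorEnergy f D κ +
        minorEnergy f D' κ' - ε * ∑ a, f a ^ 2 := by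
      have : δ ^ 2 / 2 * N = δ ^ 2 * N - ε * N - ε * N := by rw [hε]; ring
      linarith
    calc min c₂ (c₁ * (δ ^ 2 / 2)) * (N : ℝ) ^ 2 ≤ c₁ * (δ ^ 2 / 2) * (N : ℝ) ^ 2 := by
          gcongr
          exact min_le_right _ _
      _ = c₁ * N / M * (M * (δ ^ 2 / 2 * N)) := by
          field_simp
      _ ≤ c₁ * N / M * ∑ m ∈ Finset.range M,
            ∑ a, f a * f (a + ((h.eval (n m : ℤ)).toNat : ZMod N)) := by
          gcongr
          exact (mul_le_mul_of_nonneg_left hlower hM0.le).trans hcorr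
      _ ≤ _ := hsum

/-- **Functional form of Lucier's theorem.** Let `h ∈ ℤ[x]` be intersective of degree
`k ≥ 2` with `h, h'` positive and increasing for `x ≥ 0`, and let `δ > 0`. There is
`c(h, δ) > 0` such that for all sufficiently large `N`, every `f : ℤ/Nℤ → [0, 1]` of mean
at least `δ` satisfies `Σ_{a,d} f(a)·f(a+d)·S_h(d) ≥ c(h, δ)·N²`. -/
theorem functional_lucier
    (h : Polynomial ℤ) (k : ℕ) (hk : 2 ≤ k) (hdeg : h.natDegree = k)
    (hint : ∀ d : ℕ, 0 < d → ∃ n : ℤ, (d : ℤ) ∣ h.eval n)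
    (hpos : ∀ x : ℝ, 0 ≤ x → 0 < (h.map (Int.castRingHom ℝ)).eval x)
    (hmono : StrictMonoOn (fun x => (h.map (Int.castRingHom ℝ)).eval x) (Set.Ici 0))
    (hpos' : ∀ x : ℝ, 0 ≤ x → 0 < ((h.map (Int.castRingHom ℝ)).derivative).eval x)
    (hmono' : StrictMonoOn (fun x => ((h.map (Int.castRingHom ℝ)).derivative).eval x)
      (Set.Ici 0))
    (δ : ℝ) (hδ : 0 < δ) :
    ∃ c : ℝ, 0 < c ∧ ∃ N₀ : ℕ, ∀ (N : ℕ) [NeZero N], N₀ ≤ N →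
      ∀ f : ZMod N → ℝ, (∀ n, 0 ≤ f n ∧ f n ≤ 1) →
        δ ≤ (∑ n : ZMod N, f n) / (N : ℝ) →
        c * (N : ℝ) ^ 2 ≤ ∑ a : ZMod N, ∑ d : ZMod N, f a * f (a + d) * Sf N h d := by
  have hposZ : ∀ n : ℕ, 0 < h.eval (n : ℤ) := by
    intro n
    have := hpos n (Nat.cast_nonneg n)
    rw [eval_map_natCast] at this
    exact_mod_cast this
  have hposZ' : ∀ n : ℕ, 0 < h.derivative.eval (n : ℤ) := by
    intro n
    have := hpos' n (Nat.cast_nonneg n)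
    rw [derivative_map, eval_map_natCast] at this
    exact_mod_cast this
  obtain ⟨I, hI⟩ := exists_nat_gt (1 / (δ ^ 2 / 4))
  obtain ⟨c, hc, N₀, hN₀⟩ := exists_count_ge_of_minorEnergy_lt (by omega) hdeg hint
    (strictMono_eval_natCast hmono).injective hposZ hposZ' hδ I 1 one_pos 0 le_rfl
  refine ⟨c, hc, N₀, fun N _ hN f hf hmean => hN₀ N hN f hf hmean ?_⟩
  have hN0 : (0 : ℝ) < N := by exact_mod_cast Nat.pos_of_ne_zero (NeZero.ne N)
  refine ((minorEnergy_le f 1 0).trans (sum_sq_le hf)).trans_lt ?_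
  rw [div_lt_iff₀ (by positivity)] at hI
  rw [← mul_assoc]
  exact lt_mul_of_one_lt_left hN0 hI
end
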